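/- arXiv:0806.0097 — 2 statements merged into one kernel-verified Lean document; each statement's English description precedes it below -/
import Mathlib

section
/- Let E ⊂ ℝ be a closed set with at least two points, let D₀ = ℂ \ E and D = D₀ ∩ {z ∈ ℂ : Im z ≥ 0}. Then the metric space (D, h_{D₀|D}), where h_{D₀|D} is the inner metric on D obtained from the restriction of the Poincaré metric of D₀, is Gromov δ-hyperbolic with δ = log(1 + √2); indeed every geodesic triangle in (D, h_{D₀|D}) is log(1 + √2)-thin. -/
open Set Metric Filter Complex

noncomputable section

/-- The length of a curve `γ : [0,1] → E` with respect to the conformal density `ρ`. -/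
def curveLen {E : Type*} [NormedAddCommGroup E] [NormedSpace ℝ E]
    (ρ : E → ℝ) (γ : ℝ → E) : ℝ :=
  ∫ t in (0:ℝ)..1, ρ (γ t) * ‖deriv γ t‖

/-- The distance induced on the set `S` by the conformal density `ρ`, defined as the infimum
of the `ρ`-lengths of C¹ curves joining the two points inside `S`. -/
def densityDist {E : Type*} [NormedAddCommGroup E] [NormedSpace ℝ E]
    (S : Set E) (ρ : E → ℝ) (z w : E) : ℝ :=
  sInf { L | ∃ γ : ℝ → E, ContDiffOn ℝ 1 γ (Icc 0 1) ∧ γ 0 = z ∧ γ 1 = w ∧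
      (∀ t ∈ Icc (0:ℝ) 1, γ t ∈ S) ∧ L = curveLen ρ γ }

/-- The quasihyperbolic density `1/δ_Ω(z)` of a domain `Ω`. -/
def qhDensity {E : Type*} [NormedAddCommGroup E] [NormedSpace ℝ E] (Ω : Set E) : E → ℝ :=
  fun z => (Metric.infDist z Ωᶜ)⁻¹

/-- The quasihyperbolic distance of a domain `Ω`. -/
def qhDist {E : Type*} [NormedAddCommGroup E] [NormedSpace ℝ E] (Ω : Set E) : E → E → ℝ :=
  densityDist Ω (qhDensity Ω)

/-- `lam` is the density of the Poincaré (hyperbolic) metric of the plane domain `Ω`: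
it is the pushforward of the density `2/(1-|z|²)` of the unit disk under a holomorphic
universal covering map `p : 𝔻 → Ω`. -/
def IsPoincareDensity (Ω : Set ℂ) (lam : ℂ → ℝ) : Prop :=
  ∃ p : ℂ → ℂ,
    (∀ z ∈ ball (0:ℂ) 1, DifferentiableAt ℂ p z) ∧
    p '' ball (0:ℂ) 1 = Ω ∧
    IsCoveringMapOn (fun z : ball (0:ℂ) 1 => p z) Ω ∧
    ∀ z ∈ ball (0:ℂ) 1, lam (p z) * ‖deriv p z‖ = 2 / (1 - ‖z‖ ^ 2)

/-- `g` is a geodesic in `(S, d)` from `x` to `y`, parametrized by arclength on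
`[0, d x y]`. -/
def IsGeodesicIn {α : Type*} (S : Set α) (d : α → α → ℝ) (g : ℝ → α) (x y : α) : Prop :=
  g 0 = x ∧ g (d x y) = y ∧ (∀ t ∈ Icc (0:ℝ) (d x y), g t ∈ S) ∧
  ∀ s ∈ Icc (0:ℝ) (d x y), ∀ t ∈ Icc (0:ℝ) (d x y), d (g s) (g t) = |s - t|

/-- Every geodesic triangle of `(S, d)` is `δ`-thin (Rips condition). -/
def GromovHyperbolicWith {α : Type*} (S : Set α) (d : α → α → ℝ) (δ : ℝ) : Prop :=
  ∀ x ∈ S, ∀ y ∈ S, ∀ z ∈ S, ∀ gxy gxz gzy : ℝ → α,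
    IsGeodesicIn S d gxy x y → IsGeodesicIn S d gxz x z → IsGeodesicIn S d gzy z y →
    ∀ t ∈ Icc (0:ℝ) (d x y),
      ∃ p ∈ gxz '' Icc (0:ℝ) (d x z) ∪ gzy '' Icc (0:ℝ) (d z y), d (gxy t) p ≤ δ

/-- `(S, d)` is Gromov hyperbolic: some `δ ≥ 0` works for all geodesic triangles. -/
def IsGromovHyperbolic {α : Type*} (S : Set α) (d : α → α → ℝ) : Prop :=
  ∃ δ : ℝ, 0 ≤ δ ∧ GromovHyperbolicWith S d δ

/-- The real axis inside `ℂ`. -/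
def realLine : Set ℂ := {z : ℂ | z.im = 0}

/-- A Denjoy domain: a domain whose boundary is contained in the real axis. -/
def IsDenjoyDomain (Ω : Set ℂ) : Prop :=
  IsOpen Ω ∧ IsConnected Ω ∧ frontier Ω ⊆ realLine

/-- The distance (for the distance function `d`) from a point to a set. -/
def distToSet {α : Type*} (d : α → α → ℝ) (z : α) (A : Set α) : ℝ :=
  sInf (d z '' A)

/-- A fundamental geodesic: a geodesic of `(S, d)` contained in the closed upper half plane,
joining a point of the boundary interval `I` (on the real axis) to a point of the boundary
interval `J`. -/
def IsFundGeodesic (S : Set ℂ) (d : ℂ → ℂ → ℝ) (I J : Set ℝ) (g : ℝ → ℂ) (x y : ℂ) : Prop :=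
  IsGeodesicIn S d g x y ∧ x.im = 0 ∧ x.re ∈ I ∧ y.im = 0 ∧ y.re ∈ J ∧
  ∀ t ∈ Icc (0:ℝ) (d x y), 0 ≤ (g t).im

end

theorem UpperHalfPlane.cosh_dist_eq_div (z w : UpperHalfPlane) :
    Real.cosh (dist z w) = (z.im⁻¹ * ((w.re ^ 2 + w.im ^ 2) / w.im)
      + (z.re ^ 2 + z.im ^ 2) / z.im * w.im⁻¹) / 2 - z.re / z.im * (w.re / w.im) := by
  have hz := z.im_pos.ne'
  have hw := w.im_pos.ne'
  rw [UpperHalfPlane.cosh_dist, Complex.dist_eq, Complex.sq_norm, Complex.normSq_apply]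
  simp only [Complex.sub_re, Complex.sub_im, UpperHalfPlane.coe_re, UpperHalfPlane.coe_im]
  field_simp
  ring

/-- In the quadratic form `X₁ X₃ - X₂²` of signature `(1, 2)`, a null vector orthogonal to a unit
vector vanishes. -/
theorem eq_zero_of_null_of_orthogonal {x₁ x₂ x₃ v₁ v₂ v₃ : ℝ} (hx : x₁ * x₃ - x₂ ^ 2 = 1)
    (hv : v₁ * v₃ - v₂ ^ 2 = 0) (h : (x₁ * v₃ + x₃ * v₁) / 2 - x₂ * v₂ = 0) :
    v₁ = 0 ∧ v₂ = 0 ∧ v₃ = 0 := by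
  have hx₁ : x₁ ≠ 0 := by rintro rfl; nlinarith [sq_nonneg x₂]
  have key : v₁ ^ 2 + (x₂ * v₁ - x₁ * v₂) ^ 2 = 0 := by
    linear_combination (-v₁ ^ 2) * hx - x₁ ^ 2 * hv + 2 * x₁ * v₁ * h
  have h₁ : v₁ = 0 := by
    have : v₁ ^ 2 = 0 := by nlinarith [sq_nonneg v₁, sq_nonneg (x₂ * v₁ - x₁ * v₂)]
    simpa using this
  subst h₁
  have h₂ : v₂ = 0 := by simpa using hv
  subst h₂
  refine ⟨rfl, rfl, ?_⟩
  have : x₁ * v₃ = 0 := by linarith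
  simpa [hx₁] using this

/-- The hyperbolic Stewart theorem: the law for the distance from a point to a point of a
geodesic segment. -/
theorem UpperHalfPlane.cosh_dist_mul_sinh_of_dist_add {x z m : UpperHalfPlane}
    (q : UpperHalfPlane) (h : dist x m + dist m z = dist x z) :
    Real.cosh (dist q m) * Real.sinh (dist x z)
      = Real.sinh (dist m z) * Real.cosh (dist q x)
        + Real.sinh (dist x m) * Real.cosh (dist q z) := by
  have norm_one : ∀ u : UpperHalfPlane,
      u.im⁻¹ * ((u.re ^ 2 + u.im ^ 2) / u.im) - (u.re / u.im) ^ 2 = 1 := by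
    intro u
    have := u.im_pos.ne'
    field_simp
    ring
  have hxm := cosh_dist_eq_div x m
  have hmz := cosh_dist_eq_div m z
  have hxz := cosh_dist_eq_div x z
  have hqm := cosh_dist_eq_div q m
  have hqx := cosh_dist_eq_div q x
  have hqz := cosh_dist_eq_div q z
  have hx := norm_one x
  have hz := norm_one z
  have hm := norm_one m
  set s := dist x m
  set r := dist m z
  rw [← h, Real.cosh_add] at hxz
  rw [← h, Real.sinh_add]
  have hs := Real.cosh_sq s
  have hr := Real.cosh_sq r
  generalize Real.cosh s = Cs at *
  generalize Real.sinh s = Ss at *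
  generalize Real.cosh r = Cr at *
  generalize Real.sinh r = Sr at *
  rw [hqm, hqx, hqz]
  generalize (x.re ^ 2 + x.im ^ 2) / x.im = x₃ at *
  generalize (z.re ^ 2 + z.im ^ 2) / z.im = z₃ at *
  generalize (m.re ^ 2 + m.im ^ 2) / m.im = m₃ at *
  generalize x.re / x.im = x₂ at *
  generalize z.re / z.im = z₂ at *
  generalize m.re / m.im = m₂ at *
  generalize x.im⁻¹ = x₁ at *
  generalize z.im⁻¹ = z₁ at *
  generalize m.im⁻¹ = m₁ at *
  obtain ⟨h₁, h₂, h₃⟩ := eq_zero_of_null_of_orthogonal hx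
    (v₁ := (Ss * Cr + Cs * Sr) * m₁ - Sr * x₁ - Ss * z₁)
    (v₂ := (Ss * Cr + Cs * Sr) * m₂ - Sr * x₂ - Ss * z₂)
    (v₃ := (Ss * Cr + Cs * Sr) * m₃ - Sr * x₃ - Ss * z₃)
    (by
      have : ((Ss * Cr + Cs * Sr) * m₁ - Sr * x₁ - Ss * z₁)
          * ((Ss * Cr + Cs * Sr) * m₃ - Sr * x₃ - Ss * z₃)
          - ((Ss * Cr + Cs * Sr) * m₂ - Sr * x₂ - Ss * z₂) ^ 2
          = (Ss * Cr + Cs * Sr) ^ 2 * (m₁ * m₃ - m₂ ^ 2) + Sr ^ 2 * (x₁ * x₃ - x₂ ^ 2)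
            + Ss ^ 2 * (z₁ * z₃ - z₂ ^ 2)
            - 2 * (Ss * Cr + Cs * Sr) * Sr * ((x₁ * m₃ + x₃ * m₁) / 2 - x₂ * m₂)
            - 2 * (Ss * Cr + Cs * Sr) * Ss * ((m₁ * z₃ + m₃ * z₁) / 2 - m₂ * z₂)
            + 2 * Sr * Ss * ((x₁ * z₃ + x₃ * z₁) / 2 - x₂ * z₂) := by ring
      rw [this, hm, hx, hz, ← hxm, ← hmz, ← hxz]
      linear_combination (-Sr ^ 2) * hs - Ss ^ 2 * hr)
    (by
      have : (x₁ * ((Ss * Cr + Cs * Sr) * m₃ - Sr * x₃ - Ss * z₃)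
          + x₃ * ((Ss * Cr + Cs * Sr) * m₁ - Sr * x₁ - Ss * z₁)) / 2
          - x₂ * ((Ss * Cr + Cs * Sr) * m₂ - Sr * x₂ - Ss * z₂)
          = (Ss * Cr + Cs * Sr) * ((x₁ * m₃ + x₃ * m₁) / 2 - x₂ * m₂)
            - Sr * (x₁ * x₃ - x₂ ^ 2) - Ss * ((x₁ * z₃ + x₃ * z₁) / 2 - x₂ * z₂) := by ring
      rw [this, hx, ← hxm, ← hxz]
      linear_combination Sr * hs)
  linear_combination (q.im⁻¹ / 2) * h₃ + ((q.re ^ 2 + q.im ^ 2) / q.im / 2) * h₁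
    - q.re / q.im * h₂

/-- A point between `x` and `z` is determined by its distance to `x`. -/
theorem UpperHalfPlane.eq_of_dist_add {x z m m' : UpperHalfPlane}
    (h : dist x m + dist m z = dist x z) (h' : dist x m' + dist m' z = dist x z)
    (hm : dist x m = dist x m') : m = m' := by
  rcases (dist_nonneg (x := x) (y := z)).eq_or_lt with h0 | h0
  · have h1 : dist x m = 0 := by
      linarith [dist_nonneg (x := x) (y := m), dist_nonneg (x := m) (y := z)]
    rw [← dist_eq_zero.1 h1, ← dist_eq_zero.1 (hm.symm.trans h1)]
  · have key := cosh_dist_mul_sinh_of_dist_add m' h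
    have h2 : dist m z = dist m' z := by linarith
    rw [dist_comm m' x, h2, ← hm] at key
    have h3 : Real.sinh (dist m' z) * Real.cosh (dist x m)
        + Real.sinh (dist x m) * Real.cosh (dist m' z) = Real.sinh (dist x z) := by
      rw [← h', ← hm, Real.sinh_add]; ring
    rw [h3] at key
    have h4 : Real.sinh (dist x z) ≠ 0 := (Real.sinh_pos_iff.2 h0).ne'
    have h5 : Real.cosh (dist m' m) = 1 := by
      have : (Real.cosh (dist m' m) - 1) * Real.sinh (dist x z) = 0 := by linarith
      rcases mul_eq_zero.1 this with h | h
      · linarith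
      · exact absurd h h4
    by_contra hne
    exact absurd h5 (Real.one_lt_cosh.2 (dist_pos.2 (Ne.symm hne)).ne').ne'

/-- If the angle of a hyperbolic triangle at `q` is at least `π / 2`, then the opposite side
comes within distance `log (1 + √2)` of `q`. -/
theorem UpperHalfPlane.exists_dist_le_of_cosh_mul_cosh_le {q : UpperHalfPlane}
    {x z : UpperHalfPlane} {g : ℝ → UpperHalfPlane}
    (hq : Real.cosh (dist x q) * Real.cosh (dist q z) ≤ Real.cosh (dist x z))
    (hg : ∀ s ∈ Icc 0 (dist x z), dist x (g s) = s ∧ dist (g s) z = dist x z - s) :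
    ∃ s ∈ Icc 0 (dist x z), dist q (g s) ≤ Real.log (1 + √2) := by
  set c := dist x z with hc
  rw [dist_comm x q] at hq
  have hA := Real.one_le_cosh (dist q x)
  have hB := Real.one_le_cosh (dist q z)
  set A := Real.cosh (dist q x)
  set B := Real.cosh (dist q z)
  have hc0 : 0 ≤ c := dist_nonneg
  have hstewart : ∀ s ∈ Icc 0 c, Real.cosh (dist q (g s)) * Real.sinh c
      = Real.sinh (c - s) * A + Real.sinh s * B := by
    intro s hs
    have h := hg s hs
    have := cosh_dist_mul_sinh_of_dist_add (x := x) (z := z) (m := g s) q (by rw [h.1, h.2]; ring)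
    rwa [h.1, h.2] at this
  have hlog : ∀ {t : ℝ}, Real.cosh t ≤ √2 → t ≤ Real.log (1 + √2) := by
    intro t ht
    have h2 : Real.cosh (Real.log (1 + √2)) = √2 := by
      have h3 : (√2) ^ 2 = 2 := Real.sq_sqrt (by norm_num)
      rw [Real.cosh_log (by positivity)]
      field_simp
      nlinarith
    rw [← h2, Real.cosh_le_cosh] at ht
    calc t ≤ |t| := le_abs_self t
      _ ≤ |Real.log (1 + √2)| := ht
      _ = _ := abs_of_nonneg (Real.log_nonneg (by linarith [Real.sqrt_nonneg 2]))
  rcases hc0.eq_or_lt with h0 | h0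
  · refine ⟨0, ⟨le_rfl, hc0⟩, hlog ?_⟩
    have hg0 := (hg 0 ⟨le_rfl, hc0⟩).1
    rw [← dist_eq_zero.1 hg0]
    rw [← h0, Real.cosh_zero] at hq
    have : A ≤ 1 := by nlinarith
    exact this.trans (by rw [Real.one_le_sqrt]; norm_num)
  set C := Real.cosh c with hC
  have hS : 0 < Real.sinh c := Real.sinh_pos_iff.2 h0
  have hC1 : 1 ≤ C := Real.one_le_cosh c
  have hAC : A ≤ C := by nlinarith
  have hBC : B ≤ C := by nlinarith
  let f' : ℝ → ℝ := fun s => -Real.cosh (c - s) * A + Real.cosh s * B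
  have hf' : Continuous f' := by fun_prop
  obtain ⟨s, hs, hs0⟩ := intermediate_value_Icc hc0 hf'.continuousOn
    (show (0 : ℝ) ∈ Icc (f' 0) (f' c) by
      constructor
      · simp only [f', sub_zero, Real.cosh_zero, ← hC]; nlinarith
      · simp only [f', sub_self, Real.cosh_zero, ← hC]; nlinarith)
  refine ⟨s, hs, hlog ?_⟩
  apply Real.le_sqrt_of_sq_le
  have h1 := hstewart s hs
  set F := Real.cosh (dist q (g s))
  have h2 : (F * Real.sinh c) ^ 2 = 2 * A * B * C - A ^ 2 - B ^ 2 := by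
    have h3 : -Real.cosh (c - s) * A + Real.cosh s * B = 0 := hs0
    have h4 : C = Real.cosh (c - s) * Real.cosh s + Real.sinh (c - s) * Real.sinh s := by
      rw [← Real.cosh_add]; simp [C]
    have h5 := Real.cosh_sq (c - s)
    have h6 := Real.cosh_sq s
    rw [h1, h4]
    linear_combination (-A ^ 2) * h5 - B ^ 2 * h6
      + (Real.cosh s * B - Real.cosh (c - s) * A) * h3
  have h7 := Real.cosh_sq c
  rw [← hC] at h7
  have h8 : F ^ 2 * Real.sinh c ^ 2 ≤ 2 * Real.sinh c ^ 2 := by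
    nlinarith [mul_nonneg (by linarith : (0:ℝ) ≤ C) (by linarith : 0 ≤ C - A * B)]
  exact le_of_mul_le_mul_right h8 (by positivity)

/-- Geodesic triangles of the hyperbolic plane are `log (1 + √2)`-thin. -/
theorem UpperHalfPlane.exists_dist_le_of_triangle {x y z q : UpperHalfPlane}
    {g k : ℝ → UpperHalfPlane} (hq : dist x q + dist q y = dist x y)
    (hg : ∀ s ∈ Icc 0 (dist x z), dist x (g s) = s ∧ dist (g s) z = dist x z - s)
    (hk : ∀ s ∈ Icc 0 (dist z y), dist z (k s) = s ∧ dist (k s) y = dist z y - s) :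
    (∃ s ∈ Icc 0 (dist x z), dist q (g s) ≤ Real.log (1 + √2)) ∨
      ∃ s ∈ Icc 0 (dist z y), dist q (k s) ≤ Real.log (1 + √2) := by
  have key := cosh_dist_mul_sinh_of_dist_add z hq
  by_cases h1 : Real.cosh (dist x q) * Real.cosh (dist q z) ≤ Real.cosh (dist x z)
  · exact Or.inl (exists_dist_le_of_cosh_mul_cosh_le h1 hg)
  by_cases h2 : Real.cosh (dist z q) * Real.cosh (dist q y) ≤ Real.cosh (dist z y)
  · exact Or.inr (exists_dist_le_of_cosh_mul_cosh_le h2 hk)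
  exfalso
  push Not at h1 h2
  rw [dist_comm q z, dist_comm x z] at h1
  rw [← hq, Real.sinh_add] at key
  rcases (dist_nonneg (x := x) (y := q)).eq_or_lt with h0 | h0
  · rw [dist_eq_zero.1 h0.symm] at h1; simp at h1
  · have h3 : 0 < Real.sinh (dist x q) := Real.sinh_pos_iff.2 h0
    have h4 : 0 ≤ Real.sinh (dist q y) := Real.sinh_nonneg_iff.2 dist_nonneg
    nlinarith

/-- Two points of the hyperbolic plane are joined by a smooth curve of constant hyperbolic speed
equal to their distance. -/
theorem UpperHalfPlane.exists_curve_of_constant_speed (z w : UpperHalfPlane) :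
    ∃ (γ : ℝ → UpperHalfPlane) (γ' : ℝ → ℂ), Continuous γ' ∧ γ 0 = z ∧ γ 1 = w ∧
      (∀ t, HasDerivAt (fun t => (γ t : ℂ)) (γ' t) t) ∧
      ∀ t, ‖γ' t‖ = dist z w * (γ t).im := by
  rcases eq_or_ne z w with rfl | hne
  · exact ⟨fun _ => z, fun _ => 0, continuous_const, rfl, rfl, fun t => hasDerivAt_const t _,
      fun t => by simp⟩
  have hL : 0 < dist z w := dist_pos.2 hne
  have hcosh := cosh_dist_eq_div z w
  set L := dist z w
  have hS : 0 < Real.sinh L := Real.sinh_pos_iff.2 hL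
  have hz := z.im_pos
  have hw := w.im_pos
  have hCS := Real.cosh_sq L
  obtain ⟨a, ha⟩ : ∃ a, a = z.im⁻¹ := ⟨_, rfl⟩
  obtain ⟨b, hb⟩ : ∃ b, b = z.re / z.im := ⟨_, rfl⟩
  obtain ⟨c, hc⟩ : ∃ c, c = (w.im⁻¹ - Real.cosh L * a) / Real.sinh L := ⟨_, rfl⟩
  obtain ⟨d, hd⟩ : ∃ d, d = (w.re / w.im - Real.cosh L * b) / Real.sinh L := ⟨_, rfl⟩
  have ha0 : 0 < a := by rw [ha]; positivity
  have hκ : (d * a - b * c) ^ 2 + c ^ 2 = a ^ 2 := by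
    have h1 : d * a - b * c = (w.re / w.im * a - b * w.im⁻¹) / Real.sinh L := by
      rw [hc, hd]; field_simp; ring
    rw [h1, hc, div_pow, div_pow, ← add_div, div_eq_iff (by positivity)]
    have h2 : (w.re / w.im * a - b * w.im⁻¹) ^ 2 + (w.im⁻¹) ^ 2 + a ^ 2
        = 2 * Real.cosh L * a * w.im⁻¹ := by
      rw [hcosh, ha, hb]; field_simp; ring
    linear_combination h2 + a ^ 2 * hCS
  have hM : ∀ s, 0 < a * Real.cosh s + c * Real.sinh s := by
    intro s
    have h1 : |c| ≤ a := abs_le_of_sq_le_sq (by nlinarith [sq_nonneg (d * a - b * c)]) ha0.le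
    have h2 : |Real.sinh s| < Real.cosh s :=
      abs_lt_of_sq_lt_sq (by linarith [Real.cosh_sq s]) (Real.cosh_pos s).le
    have h3 : |c * Real.sinh s| < a * Real.cosh s := by
      rw [abs_mul]
      nlinarith [abs_nonneg c, abs_nonneg (Real.sinh s)]
    linarith [neg_abs_le (c * Real.sinh s)]
  let M₁ : ℝ → ℝ := fun t => a * Real.cosh (L * t) + c * Real.sinh (L * t)
  let M₂ : ℝ → ℝ := fun t => b * Real.cosh (L * t) + d * Real.sinh (L * t)
  let N₁ : ℝ → ℝ := fun t => L * (a * Real.sinh (L * t) + c * Real.cosh (L * t))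
  let N₂ : ℝ → ℝ := fun t => L * (b * Real.sinh (L * t) + d * Real.cosh (L * t))
  have hM₁ : ∀ t, 0 < M₁ t := fun t => hM _
  have hderiv : ∀ p q t : ℝ, HasDerivAt (fun t => p * Real.cosh (L * t) + q * Real.sinh (L * t))
      (L * (p * Real.sinh (L * t) + q * Real.cosh (L * t))) t := by
    intro p q t
    have h := ((hasDerivAt_id t).const_mul L)
    convert! (h.cosh.const_mul p).add (h.sinh.const_mul q) using 1
    simp; ring
  have him : ∀ t, (((M₂ t : ℂ) + Complex.I) / (M₁ t : ℂ)).im = (M₁ t)⁻¹ := by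
    intro t
    rw [Complex.div_ofReal_im]; simp
  refine ⟨fun t => ⟨((M₂ t : ℂ) + Complex.I) / (M₁ t : ℂ), by rw [him]; exact inv_pos.2 (hM₁ t)⟩,
    fun t => ((N₂ t : ℂ) * M₁ t - ((M₂ t : ℂ) + Complex.I) * N₁ t) / (M₁ t : ℂ) ^ 2,
    ?_, ?_, ?_, ?_, ?_⟩
  · have : ∀ t, (M₁ t : ℂ) ^ 2 ≠ 0 := fun t => by
      have := (hM₁ t).ne'; exact_mod_cast pow_ne_zero 2 this
    have h1 : Continuous M₁ := by fun_prop
    have h2 : Continuous M₂ := by fun_prop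
    have h3 : Continuous N₁ := by fun_prop
    have h4 : Continuous N₂ := by fun_prop
    exact Continuous.div (by fun_prop) (by fun_prop) this
  · ext
    simp only [M₁, M₂]
    rw [show (z : ℂ) = z.re + z.im * Complex.I from (Complex.re_add_im (z : ℂ)).symm, ha, hb]
    have : (z.im : ℂ) ≠ 0 := by exact_mod_cast hz.ne'
    simp
    field_simp
  · ext
    simp only [M₁, M₂]
    rw [show (w : ℂ) = w.re + w.im * Complex.I from (Complex.re_add_im (w : ℂ)).symm]
    have h1 : a * Real.cosh (L * 1) + c * Real.sinh (L * 1) = w.im⁻¹ := by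
      rw [hc, mul_one]; field_simp; ring
    have h2 : b * Real.cosh (L * 1) + d * Real.sinh (L * 1) = w.re / w.im := by
      rw [hd, mul_one]; field_simp; ring
    rw [h1, h2]
    have : (w.im : ℂ) ≠ 0 := by exact_mod_cast hw.ne'
    simp
    field_simp
  · intro t
    have h₁ : HasDerivAt (fun t => (M₁ t : ℂ)) (N₁ t) t := (hderiv a c t).ofReal_comp
    have h₂ : HasDerivAt (fun t => (M₂ t : ℂ)) (N₂ t) t := (hderiv b d t).ofReal_comp
    exact (h₂.add_const Complex.I).fun_div h₁ (by exact_mod_cast (hM₁ t).ne')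
  · intro t
    have h1 : ‖((N₂ t : ℂ) * M₁ t - ((M₂ t : ℂ) + Complex.I) * N₁ t)‖ ^ 2 = (L * M₁ t) ^ 2 := by
      rw [Complex.sq_norm, Complex.normSq_apply]
      have h2 := Real.cosh_sq (L * t)
      have hre : ((N₂ t : ℂ) * M₁ t - ((M₂ t : ℂ) + Complex.I) * N₁ t).re
          = N₂ t * M₁ t - M₂ t * N₁ t := by simp
      have him : ((N₂ t : ℂ) * M₁ t - ((M₂ t : ℂ) + Complex.I) * N₁ t).im = -N₁ t := by simp
      rw [hre, him]
      simp only [M₁, M₂, N₁, N₂]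
      generalize Real.cosh (L * t) = C at *
      generalize Real.sinh (L * t) = S at *
      have h3 : L * (b * S + d * C) * (a * C + c * S) - (b * C + d * S) * (L * (a * S + c * C))
          = L * (d * a - b * c) := by linear_combination (L * (d * a - b * c)) * h2
      rw [h3]
      linear_combination L ^ 2 * hκ + L ^ 2 * (c ^ 2 - a ^ 2) * h2
    have h2 : ‖((N₂ t : ℂ) * M₁ t - ((M₂ t : ℂ) + Complex.I) * N₁ t)‖ = L * M₁ t :=
      (pow_left_inj₀ (norm_nonneg _) (mul_pos hL (hM₁ t)).le two_ne_zero).1 h1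
    have h3 : UpperHalfPlane.im ⟨((M₂ t : ℂ) + Complex.I) / (M₁ t : ℂ),
        by rw [him]; exact inv_pos.2 (hM₁ t)⟩ = (M₁ t)⁻¹ := him t
    rw [norm_div, h2, h3, norm_pow, Complex.norm_real, Real.norm_of_nonneg (hM₁ t).le]
    have := (hM₁ t).ne'
    field_simp

/-- A curve in the upper half plane whose Euclidean speed at `t` is at most `k` has hyperbolic
speed at most `k / im`. -/
theorem UpperHalfPlane.eventually_dist_lt_mul {c : ℝ → UpperHalfPlane} {t k : ℝ}
    (hc : ContinuousWithinAt c (Ioi t) t)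
    (h : ∀ r > k, ∀ᶠ s in nhdsWithin t (Ioi t), ‖(c s : ℂ) - c t‖ ≤ r * (s - t)) :
    ∀ r > k / (c t).im, ∀ᶠ s in nhdsWithin t (Ioi t), dist (c t) (c s) < r * (s - t) := by
  intro r hr
  have ht := (c t).im_pos
  rw [gt_iff_lt, div_lt_iff₀ ht] at hr
  obtain ⟨r', hkr', hr'⟩ := exists_between hr
  have htend : Tendsto (fun s => r * √((c t).im * (c s).im)) (nhdsWithin t (Ioi t))
      (nhds (r * (c t).im)) := by
    have h1 : Tendsto (fun s => (c s).im) (nhdsWithin t (Ioi t)) (nhds (c t).im) :=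
      UpperHalfPlane.continuous_im.continuousAt.tendsto.comp hc
    have h2 := ((h1.const_mul (c t).im).sqrt).const_mul r
    rwa [Real.sqrt_mul_self ht.le] at h2
  filter_upwards [h r' hkr', htend.eventually (lt_mem_nhds hr'), self_mem_nhdsWithin]
    with s hs hs' hts
  have hts' : 0 < s - t := sub_pos.2 hts
  have hpos : 0 < √((c t).im * (c s).im) := Real.sqrt_pos.2 (mul_pos ht (c s).im_pos)
  calc dist (c t) (c s) ≤ dist (c t : ℂ) (c s) / √((c t).im * (c s).im) :=
        UpperHalfPlane.dist_le_dist_coe_div_sqrt _ _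
    _ < r * (s - t) := by
        rw [div_lt_iff₀ hpos, dist_comm, dist_eq_norm]
        calc _ ≤ r' * (s - t) := hs
          _ < (r * √((c t).im * (c s).im)) * (s - t) := by gcongr
          _ = _ := by ring

/-- A curve in a metric space is no longer than the integral of its speed. -/
theorem dist_le_of_eventually_dist_lt_mul {X : Type*} [PseudoMetricSpace X] {c : ℝ → X} {a b : ℝ}
    {B v : ℝ → ℝ} (hc : ContinuousOn c (Icc a b)) (hB : ContinuousOn B (Icc a b))
    (hBa : 0 ≤ B a) (hB' : ∀ t ∈ Ico a b, HasDerivWithinAt B (v t) (Ici t) t)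
    (h : ∀ t ∈ Ico a b, ∀ r > v t, ∀ᶠ s in nhdsWithin t (Ioi t), dist (c t) (c s) < r * (s - t))
    {t : ℝ} (ht : t ∈ Icc a b) : dist (c a) (c t) ≤ B t := by
  refine image_le_of_liminf_slope_right_le_deriv_boundary (f := fun t => dist (c a) (c t))
    (by fun_prop) (by simpa using hBa) hB hB' (fun t ht r hr => ?_) ht
  apply Eventually.frequently
  filter_upwards [h t ht r hr, self_mem_nhdsWithin] with s hs hts
  have hts' : 0 < s - t := sub_pos.2 hts
  rw [slope_def_field, div_lt_iff₀ hts']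
  linarith [dist_triangle (c a) (c t) (c s)]

theorem HasDerivWithinAt.eventually_norm_sub_le {f : ℝ → ℂ} {f' : ℂ} {t : ℝ}
    (h : HasDerivWithinAt f f' (Ioi t) t) :
    ∀ r > ‖f'‖, ∀ᶠ s in nhdsWithin t (Ioi t), ‖f s - f t‖ ≤ r * (s - t) := by
  intro r hr
  filter_upwards [h.limsup_norm_slope_le hr, self_mem_nhdsWithin] with s hs hts
  have hts' : 0 < s - t := sub_pos.2 hts
  rw [Real.norm_of_nonneg hts'.le, inv_mul_lt_iff₀ hts'] at hs
  linarith

/-- Schwarz-Pick lemma for the upper half plane. -/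
theorem norm_deriv_le_im_div_im {g : ℂ → ℂ} (hg : DifferentiableOn ℂ g {z | 0 < z.im})
    (hmaps : MapsTo g {z | 0 < z.im} {z | 0 < z.im}) {z : ℂ} (hz : 0 < z.im) :
    ‖deriv g z‖ ≤ (g z).im / z.im := by
  have hgz : 0 < (g z).im := hmaps hz
  have hopen : IsOpen {z : ℂ | 0 < z.im} := isOpen_lt continuous_const Complex.continuous_im
  let N : ℂ → ℂ := fun w => (z - (starRingEnd ℂ) z * w) / (1 - w)
  let M : ℂ → ℂ := fun ζ => (ζ - g z) / (ζ - (starRingEnd ℂ) (g z))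
  have hne : ∀ w ∈ ball (0 : ℂ) 1, 1 - w ≠ 0 := by
    intro w hw h
    rw [← sub_eq_zero.1 h] at hw
    simp at hw
  have hN : ∀ w ∈ ball (0 : ℂ) 1, 0 < (N w).im := by
    intro w hw
    have hw1 : Complex.normSq w < 1 := by
      rw [Complex.normSq_eq_norm_sq]
      have : ‖w‖ < 1 := by simpa using hw
      nlinarith [norm_nonneg w]
    have h1 := Complex.normSq_pos.2 (hne w hw)
    have : (N w).im = z.im * (1 - Complex.normSq w) / Complex.normSq (1 - w) := by
      rw [eq_div_iff h1.ne']
      simp only [N, Complex.div_im]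
      field_simp
      simp [Complex.normSq_apply]
      ring
    rw [this]
    exact div_pos (mul_pos hz (by linarith)) h1
  have hM0 : ∀ ζ : ℂ, 0 < ζ.im → ζ - (starRingEnd ℂ) (g z) ≠ 0 := by
    intro ζ hζ h
    have := congrArg Complex.im h
    simp at this
    linarith
  have hM : ∀ ζ : ℂ, 0 < ζ.im → ‖M ζ‖ < 1 := by
    intro ζ hζ
    rw [norm_div, div_lt_one (norm_pos_iff.2 (hM0 ζ hζ)),
      ← sq_lt_sq₀ (norm_nonneg _) (norm_nonneg _), Complex.sq_norm, Complex.sq_norm,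
      Complex.normSq_apply, Complex.normSq_apply]
    simp
    nlinarith
  have hNd : ∀ w ∈ ball (0 : ℂ) 1, HasDerivAt N
      ((-(starRingEnd ℂ) z * (1 - w) - (z - (starRingEnd ℂ) z * w) * (-1)) / (1 - w) ^ 2) w := by
    intro w hw
    refine HasDerivAt.div ?_ ?_ (hne w hw)
    · simpa using ((hasDerivAt_id w).const_mul ((starRingEnd ℂ) z)).const_sub z
    · simpa using (hasDerivAt_id w).const_sub 1
  have hMd : ∀ ζ : ℂ, 0 < ζ.im → HasDerivAt M
      ((1 * (ζ - (starRingEnd ℂ) (g z)) - (ζ - g z) * 1) / (ζ - (starRingEnd ℂ) (g z)) ^ 2) ζ :=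
    fun ζ hζ => ((hasDerivAt_id ζ).sub_const _).div ((hasDerivAt_id ζ).sub_const _) (hM0 ζ hζ)
  have hgd : ∀ ζ : ℂ, 0 < ζ.im → HasDerivAt g (deriv g ζ) ζ :=
    fun ζ hζ => (hg.differentiableAt (hopen.mem_nhds hζ)).hasDerivAt
  have hd : ∀ w ∈ ball (0 : ℂ) 1, DifferentiableAt ℂ (fun w => M (g (N w))) w := by
    intro w hw
    exact ((hMd _ (hmaps (hN w hw))).comp w ((hgd _ (hN w hw)).comp w (hNd w hw))).differentiableAt
  have h00 : (0 : ℂ) ∈ ball (0 : ℂ) 1 := by simp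
  have hN0 : N 0 = z := by simp [N]
  have hMg : M (g z) = 0 := by simp [M]
  have key := Complex.norm_deriv_le_one_of_mapsTo_ball (f := fun w => M (g (N w))) (c := 0) (R := 1)
    (fun w hw => (hd w hw).differentiableWithinAt)
    (fun w hw => by
      simp only [hN0, hMg, mem_closedBall_zero_iff]
      exact (hM _ (hmaps (hN w hw))).le) one_pos
  have hder : HasDerivAt (fun w => M (g (N w))) _ 0 :=
    HasDerivAt.comp (h₂ := M) (h := fun w => g (N w)) 0 (hMd (g (N 0)) (hmaps (hN 0 h00)))
      (HasDerivAt.comp (h₂ := g) (h := N) 0 (hgd _ (hN 0 h00)) (hNd 0 h00))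
  rw [hder.deriv, hN0] at key
  simp only [sub_zero, mul_one, one_mul, mul_zero, one_pow, div_one, sub_self, mul_neg,
    sub_neg_eq_add] at key
  have e1 : ‖-(starRingEnd ℂ) z + z‖ = 2 * z.im := by
    rw [neg_add_eq_sub, Complex.sub_conj]
    simp [abs_of_pos hz]
  have e2 : ‖g z - (starRingEnd ℂ) (g z)‖ = 2 * (g z).im := by
    rw [Complex.sub_conj]
    simp [abs_of_pos hgz]
  rw [norm_mul, norm_mul, norm_div, norm_pow, e1, e2] at key
  rw [le_div_iff₀ hz]
  have e3 : 2 * (g z).im / (2 * (g z).im) ^ 2 * (‖deriv g z‖ * (2 * z.im))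
      = ‖deriv g z‖ * z.im / (g z).im := by field_simp
  rw [e3, div_le_one hgz] at key
  exact key

/-- Holomorphic maps from a simply connected open set lift through a holomorphic covering map of
the disk. -/
theorem IsCoveringMapOn.exists_holomorphic_lift {Ω : Set ℂ} {p : ℂ → ℂ}
    (hp : ∀ z ∈ ball (0 : ℂ) 1, DifferentiableAt ℂ p z)
    (hp' : ∀ z ∈ ball (0 : ℂ) 1, deriv p z ≠ 0)
    (himage : p '' ball (0 : ℂ) 1 = Ω)
    (hcov : IsCoveringMapOn (fun z : ball (0 : ℂ) 1 => p z) Ω)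
    {U : Set ℂ} (hU : IsOpen U) [SimplyConnectedSpace U] {f : ℂ → ℂ}
    (hf : DifferentiableOn ℂ f U) (hfU : MapsTo f U Ω) :
    ∃ g : ℂ → ℂ, DifferentiableOn ℂ g U ∧ MapsTo g U (ball 0 1) ∧ ∀ z ∈ U, p (g z) = f z := by
  classical
  have : LocallyPathConnectedSpace U := hU.locallyPathConnectedSpace
  obtain ⟨a₀⟩ : Nonempty U := inferInstance
  obtain ⟨e, he, hpe⟩ : f a₀ ∈ p '' ball (0 : ℂ) 1 := himage ▸ hfU a₀.2
  obtain ⟨F, ⟨-, hF⟩, -⟩ := hcov.existsUnique_continuousMap_lifts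
    (⟨fun z : U => f z, hf.continuousOn.domRestrict⟩ : C(U, ℂ)) (a₀ := a₀) (e₀ := ⟨e, he⟩) hpe
    (fun z => hfU z.2)
  let g : ℂ → ℂ := fun z => if h : z ∈ U then (F ⟨z, h⟩ : ℂ) else 0
  have hgF : ∀ z : U, g z = F z := fun z => by simp [g]
  have hgU : MapsTo g U (ball 0 1) := fun z hz => by
    have := hgF ⟨z, hz⟩
    simp only at this
    rw [this]; exact (F ⟨z, hz⟩).2
  have hpg : ∀ z ∈ U, p (g z) = f z := fun z hz => by
    have h := congrFun hF ⟨z, hz⟩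
    have := hgF ⟨z, hz⟩
    simp only at this
    rw [this]; exact h
  have hgc : ContinuousOn g U := by
    rw [continuousOn_iff_continuous_domRestrict]
    have : U.domRestrict g = fun z => (F z : ℂ) := funext hgF
    rw [this]
    fun_prop
  refine ⟨g, fun z hz => DifferentiableAt.differentiableWithinAt ?_, hgU, hpg⟩
  have hstrict : HasStrictDerivAt p (deriv p (g z)) (g z) := by
    have hd : DifferentiableOn ℂ p (ball 0 1) := fun w hw => (hp w hw).differentiableWithinAt
    exact ((hd.analyticAt (isOpen_ball.mem_nhds (hgU hz))).contDiffAt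
      (n := 1)).hasStrictDerivAt one_ne_zero
  have hne := hp' _ (hgU hz)
  have hinv' : HasStrictDerivAt (hstrict.localInverse p _ _ hne) (deriv p (g z))⁻¹ (p (g z)) :=
    hstrict.to_localInverse hne
  have hinv := hinv'.hasDerivAt.differentiableAt
  rw [hpg z hz] at hinv
  have hcomp := hinv.comp z (hf.differentiableAt (hU.mem_nhds hz))
  refine hcomp.congr_of_eventuallyEq ?_
  have hleft := (hstrict.hasStrictFDerivAt_equiv hne).eventually_left_inverse
  filter_upwards [(hgc.continuousAt (hU.mem_nhds hz)).eventually hleft, hU.mem_nhds hz]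
    with w hw hwU
  rw [Function.comp_apply, ← hpg w hwU]
  exact hw.symm

/-- The uniformization of a hyperbolic domain by the disk, transferred to the upper half plane. -/
theorem IsPoincareDensity.exists_upperHalfPlane_covering {Ω : Set ℂ} {lam : ℂ → ℝ}
    (h : IsPoincareDensity Ω lam) :
    ∃ P : ℂ → ℂ, (∀ z : ℂ, 0 < z.im → DifferentiableAt ℂ P z) ∧
      (∀ z : ℂ, 0 < z.im → P z ∈ Ω) ∧ (∀ w ∈ Ω, ∃ z : ℂ, 0 < z.im ∧ P z = w) ∧
      (∀ z : ℂ, 0 < z.im → lam (P z) * ‖deriv P z‖ = 1 / z.im) ∧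
      ∀ (U : Set ℂ) (f : ℂ → ℂ), IsOpen U → SimplyConnectedSpace U → DifferentiableOn ℂ f U →
        MapsTo f U Ω → ∃ g : ℂ → ℂ, DifferentiableOn ℂ g U ∧ (∀ z ∈ U, 0 < (g z).im) ∧
          ∀ z ∈ U, P (g z) = f z := by
  obtain ⟨p, hp, himage, hcov, hlam⟩ := h
  have hp' : ∀ z ∈ ball (0 : ℂ) 1, deriv p z ≠ 0 := by
    intro z hz h0
    have h1 := hlam z hz
    have h2 : ‖z‖ < 1 := by simpa using hz
    rw [h0, norm_zero, mul_zero] at h1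
    have : 0 < 2 / (1 - ‖z‖ ^ 2) := by
      apply div_pos two_pos
      nlinarith [norm_nonneg z]
    linarith
  let K : ℂ → ℂ := fun z => (z - I) / (z + I)
  let T : ℂ → ℂ := fun w => I * (1 + w) / (1 - w)
  have hne : ∀ z : ℂ, 0 < z.im → z + I ≠ 0 := by
    intro z hz h0
    have := congrArg Complex.im h0
    simp at this
    linarith
  have hne' : ∀ w ∈ ball (0 : ℂ) 1, 1 - w ≠ 0 := by
    intro w hw h
    rw [← sub_eq_zero.1 h] at hw
    simp at hw
  have hK1 : ∀ z : ℂ, 0 < z.im → 1 - ‖K z‖ ^ 2 = 4 * z.im / ‖z + I‖ ^ 2 := by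
    intro z hz
    have h1 := norm_pos_iff.2 (hne z hz)
    rw [norm_div, div_pow, eq_div_iff (by positivity), sub_mul, div_mul_cancel₀ _ (by positivity),
      Complex.sq_norm, Complex.sq_norm, Complex.normSq_apply, Complex.normSq_apply]
    simp
    ring
  have hK : ∀ z : ℂ, 0 < z.im → K z ∈ ball (0 : ℂ) 1 := by
    intro z hz
    have h1 := norm_pos_iff.2 (hne z hz)
    have h2 : 0 < 1 - ‖K z‖ ^ 2 := by rw [hK1 z hz]; positivity
    rw [mem_ball_zero_iff]
    nlinarith [norm_nonneg (K z)]
  have hT : ∀ w ∈ ball (0 : ℂ) 1, 0 < (T w).im := by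
    intro w hw
    have hw1 : Complex.normSq w < 1 := by
      rw [Complex.normSq_eq_norm_sq]
      have : ‖w‖ < 1 := by simpa using hw
      nlinarith [norm_nonneg w]
    have h1 := Complex.normSq_pos.2 (hne' w hw)
    have : (T w).im = (1 - Complex.normSq w) / Complex.normSq (1 - w) := by
      rw [eq_div_iff h1.ne']
      simp only [T, Complex.div_im]
      field_simp
      simp [Complex.normSq_apply]
      ring
    rw [this]
    exact div_pos (by linarith) h1
  have hKT : ∀ w ∈ ball (0 : ℂ) 1, K (T w) = w := by
    intro w hw
    have h1 := hne' w hw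
    have h2 := hne _ (hT w hw)
    simp only [K]
    rw [div_eq_iff h2]
    simp only [T]
    field_simp
    ring
  have hKd : ∀ z : ℂ, 0 < z.im → HasDerivAt K ((1 * (z + I) - (z - I) * 1) / (z + I) ^ 2) z :=
    fun z hz => ((hasDerivAt_id z).sub_const I).fun_div ((hasDerivAt_id z).add_const I) (hne z hz)
  have hPd : ∀ z : ℂ, 0 < z.im → HasDerivAt (fun z => p (K z))
      (deriv p (K z) * ((1 * (z + I) - (z - I) * 1) / (z + I) ^ 2)) z := fun z hz =>
    HasDerivAt.comp (h₂ := p) z (hp _ (hK z hz)).hasDerivAt (hKd z hz)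
  refine ⟨fun z => p (K z), fun z hz => (hPd z hz).differentiableAt,
    fun z hz => himage ▸ mem_image_of_mem p (hK z hz), ?_, ?_, ?_⟩
  · intro w hw
    rw [← himage] at hw
    obtain ⟨v, hv, rfl⟩ := hw
    exact ⟨T v, hT v hv, congrArg p (hKT v hv)⟩
  · intro z hz
    have h1 := norm_pos_iff.2 (hne z hz)
    rw [(hPd z hz).deriv, norm_mul, ← mul_assoc, hlam _ (hK z hz), hK1 z hz, norm_div, norm_pow]
    have : ‖1 * (z + I) - (z - I) * 1‖ = 2 := by
      rw [show 1 * (z + I) - (z - I) * 1 = 2 * I by ring]; simp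
    rw [this]
    field_simp
    norm_num
  · intro U f hU hsc hf hfU
    obtain ⟨g, hg, hgU, hpg⟩ := hcov.exists_holomorphic_lift hp hp' himage hU hf hfU
    refine ⟨fun z => T (g z), ?_, fun z hz => hT _ (hgU hz), fun z hz => ?_⟩
    · exact DifferentiableOn.div (by fun_prop) (by fun_prop) fun z hz => hne' _ (hgU hz)
    · exact (congrArg p (hKT _ (hgU hz))).trans (hpg z hz)

/-- The Poincaré density of a domain symmetric in the real axis is symmetric. -/
theorem IsPoincareDensity.conj {Ω : Set ℂ} {lam : ℂ → ℝ} (h : IsPoincareDensity Ω lam)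
    (hΩ : ∀ z ∈ Ω, (starRingEnd ℂ) z ∈ Ω) {w : ℂ} (hw : w ∈ Ω) :
    lam ((starRingEnd ℂ) w) = lam w := by
  obtain ⟨P, hP, hPΩ, hsurj, hlam, hlift⟩ := h.exists_upperHalfPlane_covering
  have hopen : IsOpen {z : ℂ | 0 < z.im} := isOpen_lt continuous_const Complex.continuous_im
  have hsc : SimplyConnectedSpace {z : ℂ | 0 < z.im} := by
    have : ContractibleSpace {z : ℂ | 0 < z.im} :=
      (convex_halfSpace_im_gt 0).contractibleSpace ⟨I, by simp⟩
    infer_instance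
  let q : ℂ → ℂ := fun z => (starRingEnd ℂ) (P (-(starRingEnd ℂ) z))
  have him : ∀ z : ℂ, (-(starRingEnd ℂ) z).im = z.im := fun z => by simp
  have hq : ∀ z : ℂ, 0 < z.im →
      HasDerivAt q (-(starRingEnd ℂ) (deriv P (-(starRingEnd ℂ) z))) z := by
    intro z hz
    have h1 : HasDerivAt P (deriv P (-(starRingEnd ℂ) z)) (-(starRingEnd ℂ) z) :=
      (hP _ (by rwa [him])).hasDerivAt
    have h2 : HasDerivAt (fun u => P (-u)) (deriv P (-(starRingEnd ℂ) z) * -1)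
        ((starRingEnd ℂ) z) :=
      HasDerivAt.comp (h₂ := P) ((starRingEnd ℂ) z) h1 (hasDerivAt_neg _)
    have h3 := h2.conj_conj
    rw [Complex.conj_conj] at h3
    simpa [q, Function.comp_def] using h3
  obtain ⟨g, hg, hgim, hPg⟩ := hlift {z : ℂ | 0 < z.im} q hopen hsc
    (fun z hz => (hq z hz).differentiableAt.differentiableWithinAt)
    (fun z hz => hΩ _ (hPΩ _ (by rw [him]; exact hz)))
  have hle : ∀ v ∈ Ω, lam ((starRingEnd ℂ) v) ≤ lam v := by
    intro v hv
    obtain ⟨u, hu, rfl⟩ := hsurj v hv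
    obtain ⟨z, rfl⟩ : ∃ z, u = -(starRingEnd ℂ) z := ⟨-(starRingEnd ℂ) u, by simp⟩
    rw [him] at hu
    have hgz := hgim z hu
    have hSP := norm_deriv_le_im_div_im hg hgim hu
    have h1 := hlam _ ((him z).symm ▸ hu)
    have h2 := hlam _ hgz
    rw [hPg z hu] at h2
    rw [him] at h1
    have hgd : HasDerivAt g (deriv g z) z :=
      (hg.differentiableAt (hopen.mem_nhds hu)).hasDerivAt
    have hcomp : HasDerivAt q (deriv P (g z) * deriv g z) z := by
      refine ((hP _ hgz).hasDerivAt.comp z hgd).congr_of_eventuallyEq ?_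
      filter_upwards [hopen.mem_nhds hu] with y hy
      exact (hPg y hy).symm
    have h3 : ‖deriv P (-(starRingEnd ℂ) z)‖ = ‖deriv P (g z)‖ * ‖deriv g z‖ := by
      rw [← norm_mul, hcomp.unique (hq z hu), norm_neg, RCLike.norm_conj]
    have h4 : q z = (starRingEnd ℂ) (P (-(starRingEnd ℂ) z)) := rfl
    rw [← h4]
    have h5 := norm_nonneg (deriv g z)
    have hpos : 0 < ‖deriv P (g z)‖ * ‖deriv g z‖ := by
      rw [← h3]
      refine (norm_nonneg _).lt_of_ne fun h0 => ?_
      rw [← h0, mul_zero] at h1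
      exact (one_div_pos.2 hu).ne h1
    rw [h3] at h1
    refine le_of_mul_le_mul_right ?_ hpos
    rw [h1, ← mul_assoc, h2]
    calc 1 / (g z).im * ‖deriv g z‖ ≤ 1 / (g z).im * ((g z).im / z.im) := by gcongr
      _ = 1 / z.im := by field_simp
  apply le_antisymm (hle w hw)
  simpa using hle _ (hΩ w hw)

/-- The set of points visible from `c` inside an open set is open. -/
theorem isOpen_setOf_segment_subset {Ω : Set ℂ} (hΩ : IsOpen Ω) (c : ℂ) :
    IsOpen {z | segment ℝ c z ⊆ Ω} := by
  have : {z | segment ℝ c z ⊆ Ω}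
      = {z | ∀ t ∈ Icc (0 : ℝ) 1, AffineMap.lineMap c z t ∈ Ω} := by
    ext z
    simp only [mem_ofPred_eq, segment_eq_image_lineMap, image_subset_iff]
    rfl
  rw [this, isOpen_iff_eventually]
  intro z hz
  refine isCompact_Icc.eventually_forall_of_forall_eventually fun t ht => ?_
  have hcont : Continuous fun q : ℂ × ℝ => AffineMap.lineMap (k := ℝ) c q.1 q.2 := by
    simp only [AffineMap.lineMap_apply]
    fun_prop
  exact hcont.continuousAt.eventually (hΩ.mem_nhds (hz t ht))

theorem starConvex_setOf_segment_subset {Ω : Set ℂ} (c : ℂ) :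
    StarConvex ℝ c {z | segment ℝ c z ⊆ Ω} := by
  intro z hz a b ha hb hab
  exact ((convex_segment c z).segment_subset (left_mem_segment ℝ c z)
    ⟨a, b, ha, hb, hab, rfl⟩).trans hz

/-- A curve whose Euclidean speed in the upper half plane is at most `L` times its height is
`L`-Lipschitz for the hyperbolic distance. -/
theorem UpperHalfPlane.dist_le_mul_sub {c : ℝ → UpperHalfPlane} {L : ℝ} (hc : Continuous c)
    (h : ∀ t, ∀ r > L * (c t).im, ∀ᶠ s in nhdsWithin t (Ioi t), ‖(c s : ℂ) - c t‖ ≤ r * (s - t))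
    {a b : ℝ} (hab : a ≤ b) : dist (c a) (c b) ≤ L * (b - a) := by
  refine dist_le_of_eventually_dist_lt_mul (a := a) (b := b) (B := fun t => L * (t - a))
    (v := fun _ => L) hc.continuousOn (by fun_prop) (by simp) (fun t _ => ?_) (fun t _ r hr => ?_)
    (right_mem_Icc.2 hab)
  · simpa using (((hasDerivAt_id t).sub_const a).const_mul L).hasDerivWithinAt
  · refine eventually_dist_lt_mul hc.continuousAt.continuousWithinAt (h t) r ?_
    rwa [mul_div_cancel_right₀ _ (c t).im_pos.ne']

/-- If the density `lam` is the pullback of the hyperbolic density of the upper half plane by `φ`,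
then `φ` does not increase distances. -/
theorem dist_le_curveLen {U : Set ℂ} (hU : IsOpen U) {φ : ℂ → UpperHalfPlane}
    (hφ : DifferentiableOn ℂ (fun z => (φ z : ℂ)) U) {lam : ℂ → ℝ}
    (hlam : ∀ z ∈ U, lam z = ‖deriv (fun z => (φ z : ℂ)) z‖ / (φ z).im) {γ : ℝ → ℂ}
    (hγ : ContDiffOn ℝ 1 γ (Icc 0 1)) (hγU : ∀ t ∈ Icc (0 : ℝ) 1, γ t ∈ U) :
    dist (φ (γ 0)) (φ (γ 1)) ≤ curveLen lam γ := by
  have hφc : ContinuousOn φ U :=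
    UpperHalfPlane.isEmbedding_coe.continuousOn_iff.2 hφ.continuousOn
  have hlamc : ContinuousOn lam U := by
    refine ContinuousOn.congr ?_ hlam
    exact ContinuousOn.div (hφ.deriv hU).continuousOn.norm
      (UpperHalfPlane.continuous_im.comp_continuousOn hφc) fun z _ => (φ z).im_pos.ne'
  let v : ℝ → ℝ := fun t => lam (γ t) * ‖derivWithin γ (Icc 0 1) t‖
  have hv : ContinuousOn v (Icc 0 1) := (hlamc.comp hγ.continuousOn hγU).mul
    (hγ.continuousOn_derivWithin (uniqueDiffOn_Icc one_pos) le_rfl).norm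
  let V : ℝ → ℝ := IccExtend zero_le_one ((Icc (0 : ℝ) 1).domRestrict v)
  have hV : Continuous V := hv.domRestrict.Icc_extend'
  have hVv : ∀ t ∈ Icc (0 : ℝ) 1, V t = v t := fun t ht => IccExtend_of_mem _ _ ht
  have hlen : curveLen lam γ = ∫ t in (0 : ℝ)..1, V t := by
    refine intervalIntegral.integral_congr_Ioo_of_le zero_le_one fun t ht => ?_
    simp only [hVv t (Ioo_subset_Icc_self ht), v]
    rw [derivWithin_of_mem_nhds (Icc_mem_nhds ht.1 ht.2)]
  rw [hlen]
  have hB : ∀ t, HasDerivAt (fun u => ∫ s in (0 : ℝ)..u, V s) (V t) t := fun t =>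
    (hV.integral_hasStrictDerivAt 0 t).hasDerivAt
  refine dist_le_of_eventually_dist_lt_mul (c := fun t => φ (γ t)) (a := 0) (b := 1)
    (hφc.comp hγ.continuousOn hγU) (fun t _ => (hB t).continuousAt.continuousWithinAt)
    (by simp) (fun t _ => (hB t).hasDerivWithinAt) (fun t ht => ?_) (right_mem_Icc.2 zero_le_one)
  have ht' := Ico_subset_Icc_self ht
  have hγd : HasDerivWithinAt γ (derivWithin γ (Icc 0 1) t) (Ioi t) t :=
    ((hγ.differentiableOn one_ne_zero t ht').hasDerivWithinAt.mono_of_mem_nhdsWithin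
      (mem_of_superset (Ioo_mem_nhdsGT ht.2)
        fun s hs => ⟨ht.1.trans hs.1.le, hs.2.le⟩))
  have hd := HasDerivAt.comp_hasDerivWithinAt (h₂ := fun z => (φ z : ℂ)) t
    (hφ.differentiableAt (hU.mem_nhds (hγU t ht'))).hasDerivAt hγd
  have hcont : ContinuousWithinAt (fun t => φ (γ t)) (Ioi t) t :=
    (hφc.continuousAt (hU.mem_nhds (hγU t ht'))).comp_continuousWithinAt hγd.continuousWithinAt
  have hVt : V t = ‖deriv (fun z => (φ z : ℂ)) (γ t) * derivWithin γ (Icc 0 1) t‖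
      / (φ (γ t)).im := by
    simp only [hVv t ht', v]
    rw [hlam _ (hγU t ht'), norm_mul]
    ring
  rw [hVt]
  exact UpperHalfPlane.eventually_dist_lt_mul hcont hd.eventually_norm_sub_le

/-- Reflection of the lower half plane into the upper half plane. -/
def foldUp (a : ℂ) : ℂ := ⟨a.re, |a.im|⟩

theorem foldUp_of_nonneg {a : ℂ} (ha : 0 ≤ a.im) : foldUp a = a :=
  Complex.ext rfl (abs_of_nonneg ha)

theorem foldUp_of_nonpos {a : ℂ} (ha : a.im ≤ 0) : foldUp a = (starRingEnd ℂ) a :=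
  Complex.ext rfl (abs_of_nonpos ha)

theorem norm_foldUp_sub_le (a b : ℂ) : ‖foldUp a - foldUp b‖ ≤ ‖a - b‖ := by
  refine (sq_le_sq₀ (norm_nonneg _) (norm_nonneg _)).1 ?_
  have h := sq_le_sq.2 (abs_abs_sub_abs_le_abs_sub a.im b.im)
  simp only [Complex.sq_norm, Complex.normSq_apply, foldUp, Complex.sub_re, Complex.sub_im]
  linarith

theorem continuous_foldUp : Continuous foldUp :=
  (LipschitzWith.mk_one fun a b => by
    simpa only [dist_eq_norm] using norm_foldUp_sub_le a b).continuous

theorem HasDerivAt.eventually_norm_sub_le {f : ℂ → ℂ} {f' b : ℂ} (h : HasDerivAt f f' b) :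
    ∀ r > ‖f'‖, ∀ᶠ a in nhds b, ‖f a - f b‖ ≤ r * ‖a - b‖ := by
  intro r hr
  filter_upwards [h.isLittleO.def (sub_pos.2 hr)] with a ha
  have h1 : ‖f a - f b‖ ≤ ‖f a - f b - (a - b) • f'‖ + ‖(a - b) • f'‖ := by
    simpa using norm_add_le (f a - f b - (a - b) • f') ((a - b) • f')
  rw [norm_smul] at h1
  linarith

/-- The distance between two points of the closed upper half of a symmetric domain is realized by a
curve staying in that half: reflecting the lower parts of a hyperbolic geodesic of the universal
cover does not lengthen it. -/
theorem exists_curveLen_eq_dist {Ω U : Set ℂ} (hU : IsOpen U) {φ : ℂ → UpperHalfPlane}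
    (hφ : DifferentiableOn ℂ (fun z => (φ z : ℂ)) U) {lam : ℂ → ℝ}
    (hlam : ∀ z ∈ U, lam z = ‖deriv (fun z => (φ z : ℂ)) z‖ / (φ z).im)
    (hΩU : ∀ z ∈ Ω, 0 ≤ z.im → z ∈ U) (hΩ : ∀ z ∈ Ω, (starRingEnd ℂ) z ∈ Ω)
    (hsymm : ∀ z ∈ Ω, lam ((starRingEnd ℂ) z) = lam z) {P : ℂ → ℂ}
    (hP : ∀ z : ℂ, 0 < z.im → DifferentiableAt ℂ P z) (hPΩ : ∀ z : ℂ, 0 < z.im → P z ∈ Ω)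
    (hPlam : ∀ z : ℂ, 0 < z.im → lam (P z) * ‖deriv P z‖ = 1 / z.im)
    (hPφ : ∀ z ∈ U, P (φ z) = z) {z w : ℂ} (hz : z ∈ Ω) (hz' : 0 ≤ z.im) (hw : w ∈ Ω)
    (hw' : 0 ≤ w.im) :
    ∃ γ : ℝ → ℂ, ContDiffOn ℝ 1 γ (Icc 0 1) ∧ γ 0 = z ∧ γ 1 = w ∧
      (∀ t ∈ Icc (0 : ℝ) 1, γ t ∈ Ω ∩ {z | 0 ≤ z.im}) ∧
      curveLen lam γ = dist (φ z) (φ w) := by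
  obtain ⟨γ, γ', hγ'c, hγ0, hγ1, hγ', hspeed⟩ :=
    UpperHalfPlane.exists_curve_of_constant_speed (φ z) (φ w)
  set L := dist (φ z) (φ w) with hL
  have hγcoe : Continuous fun t => (γ t : ℂ) :=
    continuous_iff_continuousAt.2 fun t => (hγ' t).continuousAt
  have hγc : Continuous γ := UpperHalfPlane.isEmbedding_coe.continuous_iff.2 hγcoe
  have hopen : IsOpen {z : ℂ | 0 < z.im} := isOpen_lt continuous_const Complex.continuous_im
  have hPd : DifferentiableOn ℂ P {z | 0 < z.im} := fun u hu =>
    (hP u hu).differentiableWithinAt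
  have ha : ∀ t, HasDerivAt (fun t => P (γ t)) (deriv P (γ t) * γ' t) t := fun t =>
    HasDerivAt.comp (h₂ := P) t (hP _ (γ t).im_pos).hasDerivAt (hγ' t)
  have hac : Continuous fun t => P (γ t) :=
    continuous_iff_continuousAt.2 fun t => (ha t).continuousAt
  have hlen : ∀ t, lam (P (γ t)) * ‖deriv P (γ t) * γ' t‖ = L := fun t => by
    have := (γ t).im_pos.ne'
    rw [norm_mul, ← mul_assoc, hPlam _ (γ t).im_pos, hspeed, UpperHalfPlane.coe_im]
    field_simp
  have hfold : ∀ a ∈ Ω, foldUp a ∈ Ω ∧ lam (foldUp a) = lam a := fun a ha => by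
    rcases le_total 0 a.im with h | h
    · rw [foldUp_of_nonneg h]; exact ⟨ha, rfl⟩
    · rw [foldUp_of_nonpos h]; exact ⟨hΩ a ha, hsymm a ha⟩
  have hfoldU : ∀ t, foldUp (P (γ t)) ∈ U := fun t =>
    hΩU _ (hfold _ (hPΩ _ (γ t).im_pos)).1 (abs_nonneg _)
  let c : ℝ → UpperHalfPlane := fun t => φ (foldUp (P (γ t)))
  have hc : Continuous c := by
    have h1 : ContinuousOn φ U :=
      UpperHalfPlane.isEmbedding_coe.continuousOn_iff.2 hφ.continuousOn
    exact h1.comp_continuous (continuous_foldUp.comp hac) hfoldU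
  have hclip : ∀ a b : ℝ, a ≤ b → dist (c a) (c b) ≤ L * (b - a) := by
    refine fun a b hab => UpperHalfPlane.dist_le_mul_sub hc (fun t r hr => ?_) hab
    set A := ‖deriv (fun z => (φ z : ℂ)) (foldUp (P (γ t)))‖
    set B := ‖deriv P (γ t) * γ' t‖
    have hAB : A * B = L * (c t).im := by
      have h1 := hlen t
      rw [← (hfold _ (hPΩ _ (γ t).im_pos)).2, hlam _ (hfoldU t)] at h1
      rw [← h1]
      have := (c t).im_pos.ne'
      change A * B = A / (c t).im * B * (c t).im
      field_simp
    rw [← hAB] at hr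
    obtain ⟨ε, hε, hε0⟩ : ∃ ε, (A + ε) * (B + ε) < r ∧ 0 < ε := by
      have h1 : Tendsto (fun ε => (A + ε) * (B + ε)) (nhdsWithin 0 (Ioi 0)) (nhds (A * B)) := by
        have : Continuous fun ε => (A + ε) * (B + ε) := by fun_prop
        simpa using (this.tendsto 0).mono_left nhdsWithin_le_nhds
      exact ((h1.eventually (gt_mem_nhds hr)).and self_mem_nhdsWithin).exists
    have h1 := (hφ.differentiableAt (hU.mem_nhds (hfoldU t))).hasDerivAt.eventually_norm_sub_le
      (A + ε) (by simpa [A] using hε0)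
    have h2 := ((continuous_foldUp.comp hac).continuousAt (x := t)).eventually h1
    have h3 := (ha t).hasDerivWithinAt.eventually_norm_sub_le (B + ε) (by simpa [B] using hε0)
    filter_upwards [h2.filter_mono nhdsWithin_le_nhds, h3, self_mem_nhdsWithin] with s hs hs' hts
    have hA : 0 ≤ A := norm_nonneg _
    calc ‖(c s : ℂ) - c t‖ ≤ (A + ε) * ‖foldUp (P (γ s)) - foldUp (P (γ t))‖ := hs
      _ ≤ (A + ε) * ((B + ε) * (s - t)) := by
        gcongr
        exact (norm_foldUp_sub_le _ _).trans hs'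
      _ ≤ r * (s - t) := by
        rw [← mul_assoc]
        exact mul_le_mul_of_nonneg_right hε.le (sub_pos.2 hts).le
  have hγlip : ∀ a b : ℝ, a ≤ b → dist (γ a) (γ b) ≤ L * (b - a) := by
    refine fun a b hab => UpperHalfPlane.dist_le_mul_sub hγc (fun t r hr => ?_) hab
    rw [← hspeed] at hr
    exact (hγ' t).hasDerivWithinAt.eventually_norm_sub_le r hr
  have hzU := hΩU z hz hz'
  have hwU := hΩU w hw hw'
  have hc0 : c 0 = φ z := by simp only [c, hγ0, hPφ z hzU, foldUp_of_nonneg hz']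
  have hc1 : c 1 = φ w := by simp only [c, hγ1, hPφ w hwU, foldUp_of_nonneg hw']
  have hcγ : ∀ t ∈ Icc (0 : ℝ) 1, c t = γ t := by
    intro t ht
    have h1 := hclip 0 t ht.1
    have h2 := hclip t 1 ht.2
    have h3 := hγlip 0 t ht.1
    have h4 := hγlip t 1 ht.2
    rw [hc0] at h1
    rw [hc1] at h2
    rw [hγ0] at h3
    rw [hγ1] at h4
    have h5 := dist_triangle (φ z) (c t) (φ w)
    have h6 := dist_triangle (φ z) (γ t) (φ w)
    apply UpperHalfPlane.eq_of_dist_add (x := φ z) (z := φ w) <;> linarith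
  refine ⟨fun t => P (γ t), ?_, ?_, ?_, fun t ht => ⟨hPΩ _ (γ t).im_pos, ?_⟩, ?_⟩
  · refine (contDiff_one_iff_deriv.2 ⟨fun t => (ha t).differentiableAt, ?_⟩).contDiffOn
    rw [funext fun t => (ha t).deriv]
    exact ((hPd.deriv hopen).continuousOn.comp_continuous hγcoe fun t => (γ t).im_pos).mul hγ'c
  · simp only [hγ0, hPφ z hzU]
  · simp only [hγ1, hPφ w hwU]
  · have h1 : P (γ t) = foldUp (P (γ t)) := by
      conv_lhs => rw [← hcγ t ht]
      exact hPφ _ (hfoldU t)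
    change 0 ≤ (P (γ t)).im
    rw [h1]
    exact abs_nonneg _
  · simp only [curveLen, (ha _).deriv, hlen]
    simp

/-- A density which is the pullback of the hyperbolic density by a section of the universal covering
defined on the closed upper half of a symmetric domain induces the pullback distance there. -/
theorem densityDist_eq_dist {Ω U : Set ℂ} (hU : IsOpen U) {φ : ℂ → UpperHalfPlane}
    (hφ : DifferentiableOn ℂ (fun z => (φ z : ℂ)) U) {lam : ℂ → ℝ}
    (hΩU : ∀ z ∈ Ω, 0 ≤ z.im → z ∈ U) (hΩ : ∀ z ∈ Ω, (starRingEnd ℂ) z ∈ Ω)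
    (hsymm : ∀ z ∈ Ω, lam ((starRingEnd ℂ) z) = lam z) {P : ℂ → ℂ}
    (hP : ∀ z : ℂ, 0 < z.im → DifferentiableAt ℂ P z) (hPΩ : ∀ z : ℂ, 0 < z.im → P z ∈ Ω)
    (hPlam : ∀ z : ℂ, 0 < z.im → lam (P z) * ‖deriv P z‖ = 1 / z.im)
    (hPφ : ∀ z ∈ U, P (φ z) = z) {z w : ℂ} (hz : z ∈ Ω ∩ {z | 0 ≤ z.im})
    (hw : w ∈ Ω ∩ {z | 0 ≤ z.im}) :
    densityDist (Ω ∩ {z | 0 ≤ z.im}) lam z w = dist (φ z) (φ w) := by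
  have hlam : ∀ z ∈ U, lam z = ‖deriv (fun z => (φ z : ℂ)) z‖ / (φ z).im := by
    intro z hz
    have h1 := hPlam _ (φ z).im_pos
    rw [hPφ z hz, UpperHalfPlane.coe_im] at h1
    have h2 : HasDerivAt (fun z => P (φ z)) (deriv P (φ z) * deriv (fun z => (φ z : ℂ)) z) z :=
      HasDerivAt.comp (h₂ := P) z (hP _ (φ z).im_pos).hasDerivAt
        (hφ.differentiableAt (hU.mem_nhds hz)).hasDerivAt
    have h3 : HasDerivAt (fun z => P (φ z)) 1 z := by
      refine (hasDerivAt_id z).congr_of_eventuallyEq ?_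
      filter_upwards [hU.mem_nhds hz] with y hy using hPφ y hy
    have h4 := congrArg norm (h2.unique h3)
    rw [norm_mul, norm_one] at h4
    calc lam z = lam z * (‖deriv P (φ z)‖ * ‖deriv (fun z => (φ z : ℂ)) z‖) := by
          rw [h4, mul_one]
      _ = ‖deriv (fun z => (φ z : ℂ)) z‖ / (φ z).im := by
          rw [← mul_assoc, h1]
          ring
  refine IsLeast.csInf_eq ⟨?_, ?_⟩
  · obtain ⟨γ, hγ, h0, h1, hγΩ, hlen⟩ := exists_curveLen_eq_dist hU hφ hlam hΩU hΩ hsymm hP hPΩ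
      hPlam hPφ hz.1 hz.2 hw.1 hw.2
    exact ⟨γ, hγ, h0, h1, hγΩ, hlen.symm⟩
  · rintro _ ⟨γ, hγ, rfl, rfl, hγΩ, rfl⟩
    exact dist_le_curveLen hU hφ hlam hγ fun t ht => hΩU _ (hγΩ t ht).1 (hγΩ t ht).2

/-- A space which embeds isometrically into the hyperbolic plane has `log (1 + √2)`-thin geodesic
triangles. -/
theorem GromovHyperbolicWith.of_isometry {α : Type*} {S : Set α} {d : α → α → ℝ}
    {φ : α → UpperHalfPlane} (hd : ∀ x ∈ S, ∀ y ∈ S, d x y = dist (φ x) (φ y)) :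
    GromovHyperbolicWith S d (Real.log (1 + Real.sqrt 2)) := by
  have hgeo : ∀ x ∈ S, ∀ y ∈ S, ∀ g : ℝ → α, IsGeodesicIn S d g x y →
      ∀ s ∈ Icc 0 (dist (φ x) (φ y)), g s ∈ S ∧
        dist (φ x) (φ (g s)) = s ∧ dist (φ (g s)) (φ y) = dist (φ x) (φ y) - s := by
    rintro x hx y hy g ⟨h0, h1, hS, hg⟩ s hs
    rw [hd x hx y hy] at h1 hS hg
    have hl := left_mem_Icc.2 (hs.1.trans hs.2)
    have hr := right_mem_Icc.2 (hs.1.trans hs.2)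
    have h2 := hg 0 hl s hs
    have h3 := hg s hs _ hr
    rw [h0, hd x hx _ (hS s hs), zero_sub, abs_neg, abs_of_nonneg hs.1] at h2
    rw [h1, hd _ (hS s hs) y hy, abs_sub_comm, abs_of_nonneg (sub_nonneg.2 hs.2)] at h3
    exact ⟨hS s hs, h2, h3⟩
  intro x hx y hy z hz gxy gxz gzy hxy hxz hzy t ht
  rw [hd x hx y hy] at ht
  obtain ⟨hqS, hq, hq'⟩ := hgeo x hx y hy gxy hxy t ht
  rw [hd x hx z hz, hd z hz y hy]
  rcases UpperHalfPlane.exists_dist_le_of_triangle (q := φ (gxy t)) (g := fun s => φ (gxz s))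
    (k := fun s => φ (gzy s)) (by rw [hq, hq']; ring)
    (fun s hs => (hgeo x hx z hz gxz hxz s hs).2) (fun s hs => (hgeo z hz y hy gzy hzy s hs).2)
    with ⟨s, hs, h⟩ | ⟨s, hs, h⟩
  · refine ⟨gxz s, Or.inl (mem_image_of_mem _ hs), ?_⟩
    rwa [hd _ hqS _ (hgeo x hx z hz gxz hxz s hs).1]
  · refine ⟨gzy s, Or.inr (mem_image_of_mem _ hs), ?_⟩
    rwa [hd _ hqS _ (hgeo z hz y hy gzy hzy s hs).1]

noncomputable section

/-- Lemma 3.1, Poincaré case: the closed upper half `D` of `D₀ = ℂ \ E`, with the inner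
metric obtained by restricting the Poincaré metric of `D₀`, has `log(1+√2)`-thin geodesic
triangles. -/
theorem upper_half_denjoy_poincare_hyperbolic
    (E : Set ℝ) (hcl : IsClosed E)
    (x y : ℝ) (hx : x ∈ E) (hy : y ∈ E) (hxy : x ≠ y)
    (D₀ D : Set ℂ)
    (hD₀ : D₀ = ((fun x : ℝ => (x : ℂ)) '' E)ᶜ)
    (hD : D = D₀ ∩ {z : ℂ | 0 ≤ z.im})
    (lam : ℂ → ℝ) (hlam : IsPoincareDensity D₀ lam) :
    GromovHyperbolicWith D (densityDist D lam) (Real.log (1 + Real.sqrt 2)) := by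
  have hopen : IsOpen D₀ := by
    rw [hD₀]
    exact (Complex.isometry_ofReal.isClosedEmbedding.isClosedMap E hcl).isOpen_compl
  have him : ∀ z : ℂ, z.im ≠ 0 → z ∈ D₀ := by
    rintro z hz
    rw [hD₀]
    rintro ⟨e, -, rfl⟩
    exact hz (Complex.ofReal_im e)
  have hconj : ∀ z ∈ D₀, (starRingEnd ℂ) z ∈ D₀ := by
    intro z hz
    rw [hD₀] at hz ⊢
    rintro ⟨e, he, h⟩
    refine hz ⟨e, he, ?_⟩
    rw [← Complex.conj_conj z, ← h]
    exact (Complex.conj_ofReal e).symm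
  obtain ⟨P, hP, hPΩ, -, hPlam, hlift⟩ := hlam.exists_upperHalfPlane_covering
  let U : Set ℂ := {z | segment ℝ I z ⊆ D₀}
  have hU : IsOpen U := isOpen_setOf_segment_subset hopen I
  have hUD : ∀ z ∈ U, z ∈ D₀ := fun z hz => hz (right_mem_segment ℝ I z)
  have hDU : ∀ z ∈ D₀, 0 ≤ z.im → z ∈ U := by
    rintro z hz hz' _ ⟨a, b, ha, hb, hab, rfl⟩
    rcases ha.eq_or_lt with rfl | ha
    · have : b = 1 := by linarith
      simpa [this] using hz
    · refine him _ (ne_of_gt ?_)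
      simp
      positivity
  have hIU : I ∈ U := hDU I (him I (by simp)) (by simp)
  have hUc : ContractibleSpace U := (starConvex_setOf_segment_subset I).contractibleSpace ⟨I, hIU⟩
  obtain ⟨g, hg, hgim, hPg⟩ := hlift U id hU inferInstance differentiableOn_id hUD
  let φ : ℂ → UpperHalfPlane := fun z => UpperHalfPlane.ofComplex (g z)
  have hφg : ∀ z ∈ U, (φ z : ℂ) = g z := fun z hz => by
    simp only [φ, UpperHalfPlane.ofComplex_apply_of_im_pos (hgim z hz)]
  subst hD
  exact GromovHyperbolicWith.of_isometry (φ := φ) fun z hz w hw =>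
    densityDist_eq_dist hU (hg.congr hφg) hDU hconj (fun v hv => hlam.conj hconj hv) hP hPΩ hPlam
      (fun v hv => (congrArg P (hφg v hv)).trans (hPg v hv)) hz hw

end
end

section
/- Let Ω ⊆ ℂ be a Denjoy domain with Ω ∩ ℝ = ⋃_{n≥0} (a_n, b_n), where the union is over a countable index set. Then the following conditions are equivalent: (1) the quasihyperbolic metric k_Ω is Gromov δ-hyperbolic for some δ; (2) there exists a constant c₁ such that for every choice of fundamental geodesics {γ_n}_{n=1}^∞ one has k_Ω(z, ℝ) ≤ c₁ for every z ∈ ⋃_{n≥1} γ_n; (3) there exists a constant c₂ such that for one fixed choice of fundamental geodesics {γ_n}_{n=1}^∞ one has k_Ω(z, ℝ) ≤ c₂ for every z ∈ ⋃_{n≥1} γ_n; (4) there exists a constant c₃ such that every geodesic bigon in Ω with vertices in ℝ is c₃-thin. Moreover, the constant appearing in each of these conditions can be bounded in terms of the constant appearing in any other of them. -/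
open Set Metric Filter Complex

noncomputable section

/-- Condition (2) of Theorem 3.3: every point of every fundamental geodesic is at distance
at most `c` from the real axis. -/
def DenjoyCondAllFund (Ω : Set ℂ) (d : ℂ → ℂ → ℝ) (I : ℕ → Set ℝ) (c : ℝ) : Prop :=
  ∀ n : ℕ, 1 ≤ n → ∀ (g : ℝ → ℂ) (x y : ℂ), IsFundGeodesic Ω d (I 0) (I n) g x y →
    ∀ z ∈ g '' Icc (0:ℝ) (d x y), distToSet d z (Ω ∩ realLine) ≤ c

/-- Condition (3) of Theorem 3.3: for one fixed choice of fundamental geodesics, every point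
of every chosen geodesic is at distance at most `c` from the real axis. -/
def DenjoyCondSomeFund (Ω : Set ℂ) (d : ℂ → ℂ → ℝ) (I : ℕ → Set ℝ) (c : ℝ) : Prop :=
  ∃ (g : ℕ → ℝ → ℂ) (x y : ℕ → ℂ),
    (∀ n : ℕ, 1 ≤ n → IsFundGeodesic Ω d (I 0) (I n) (g n) (x n) (y n)) ∧
    ∀ n : ℕ, 1 ≤ n → ∀ z ∈ g n '' Icc (0:ℝ) (d (x n) (y n)),
      distToSet d z (Ω ∩ realLine) ≤ c

/-- Condition (4) of Theorem 3.3: every geodesic bigon with vertices in `ℝ` is `c`-thin. -/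
def DenjoyCondBigon (Ω : Set ℂ) (d : ℂ → ℂ → ℝ) (c : ℝ) : Prop :=
  ∀ x ∈ Ω ∩ realLine, ∀ y ∈ Ω ∩ realLine, ∀ g₁ g₂ : ℝ → ℂ,
    IsGeodesicIn Ω d g₁ x y → IsGeodesicIn Ω d g₂ x y →
    ∀ z ∈ g₁ '' Icc (0:ℝ) (d x y), ∃ w ∈ g₂ '' Icc (0:ℝ) (d x y), d z w ≤ c

namespace Denjoy

section Density

variable {E : Type*} [NormedAddCommGroup E] [NormedSpace ℝ E]

/-- A globally defined C¹ curve which stays in `S`. -/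
def IsCurveIn (S : Set E) (γ : ℝ → E) : Prop :=
  ContDiff ℝ 1 γ ∧ ∀ t, γ t ∈ S

/-- The `ρ`-speed of a curve. -/
def speed (ρ : E → ℝ) (γ : ℝ → E) (t : ℝ) : ℝ := ρ (γ t) * ‖deriv γ t‖

lemma speed_nonneg {ρ : E → ℝ} (hρ : ∀ z, 0 ≤ ρ z) (γ : ℝ → E) (t : ℝ) : 0 ≤ speed ρ γ t :=
  mul_nonneg (hρ _) (norm_nonneg _)

lemma IsCurveIn.continuous_speed {S : Set E} {ρ : E → ℝ} (hc : ContinuousOn ρ S) {γ : ℝ → E}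
    (h : IsCurveIn S γ) : Continuous (speed ρ γ) := by
  have h1 : Continuous (fun t => ρ (γ t)) :=
    hc.comp_continuous h.1.continuous h.2
  exact h1.mul (h.1.continuous_deriv le_rfl).norm

lemma integral_speed_comp {ρ : E → ℝ} {γ : ℝ → E} {φ φ' : ℝ → ℝ} {a b : ℝ} (hab : a ≤ b)
    (hφ : ContinuousOn φ (Icc a b)) (hd : ∀ t ∈ Ioo a b, HasDerivAt φ (φ' t) t)
    (hn : ∀ t ∈ Ioo a b, 0 ≤ φ' t) (hγ : ∀ t ∈ Ioo a b, DifferentiableAt ℝ γ (φ t)) :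
    ∫ t in a..b, speed ρ (γ ∘ φ) t = ∫ t in φ a..φ b, speed ρ γ t := by
  rw [← intervalIntegral.integral_comp_mul_deriv_of_deriv_nonneg (f := φ) (f' := φ')]
  · refine intervalIntegral.integral_congr_Ioo_of_le hab ?_
    intro t ht
    have := (hγ t ht).hasDerivAt.scomp t (hd t ht)
    simp only [speed, Function.comp_apply]
    rw [this.deriv, norm_smul, Real.norm_of_nonneg (hn t ht)]
    ring
  · rwa [uIcc_of_le hab]
  · rwa [min_eq_left hab, max_eq_right hab]
  · rwa [min_eq_left hab, max_eq_right hab]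

lemma curveLen_eq (ρ : E → ℝ) (γ : ℝ → E) : curveLen ρ γ = ∫ t in (0:ℝ)..1, speed ρ γ t := rfl

lemma densityDist_nonneg {S : Set E} {ρ : E → ℝ} (hρ : ∀ z, 0 ≤ ρ z) (z w : E) :
    0 ≤ densityDist S ρ z w := by
  apply Real.sInf_nonneg
  rintro L ⟨γ, -, -, -, -, rfl⟩
  exact intervalIntegral.integral_nonneg zero_le_one fun t _ => speed_nonneg hρ γ t

lemma IsCurveIn.densityDist_le {S : Set E} {ρ : E → ℝ} (hρ : ∀ z, 0 ≤ ρ z) {γ : ℝ → E}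
    (h : IsCurveIn S γ) {a b : ℝ} (hab : a ≤ b) :
    densityDist S ρ (γ a) (γ b) ≤ ∫ t in a..b, speed ρ γ t := by
  set φ : ℝ → ℝ := fun t => a + t * (b - a) with hφ
  have hd : ∀ t, HasDerivAt φ (b - a) t := fun t =>
    ((hasDerivAt_mul_const (b - a)).const_add a)
  have key : ∫ t in (0:ℝ)..1, speed ρ (γ ∘ φ) t = ∫ t in a..b, speed ρ γ t := by
    rw [integral_speed_comp (φ' := fun _ => b - a) zero_le_one
      (fun t _ => (hd t).continuousAt.continuousWithinAt) (fun t _ => hd t)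
      (fun t _ => sub_nonneg.2 hab)
      (fun t _ => (h.1.differentiable one_ne_zero).differentiableAt)]
    simp [hφ]
  rw [← key]
  refine csInf_le ⟨0, ?_⟩ ⟨γ ∘ φ, ?_, ?_, ?_, fun t _ => h.2 _, rfl⟩
  · rintro L ⟨γ, -, -, -, -, rfl⟩
    exact intervalIntegral.integral_nonneg zero_le_one fun t _ => speed_nonneg hρ γ t
  · refine (h.1.comp ?_).contDiffOn
    fun_prop
  · simp [hφ]
  · simp [hφ]

lemma exists_isCurveIn_of_contDiffOn {S : Set E} (ρ : E → ℝ) {γ : ℝ → E}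
    (h : ContDiffOn ℝ 1 γ (Icc 0 1)) (hS : ∀ t ∈ Icc (0:ℝ) 1, γ t ∈ S) :
    ∃ σ, IsCurveIn S σ ∧ σ 0 = γ 0 ∧ σ 1 = γ 1 ∧
      ∫ t in (0:ℝ)..1, speed ρ σ t = curveLen ρ γ := by
  have hm : ∀ t, Real.smoothTransition t ∈ Icc (0:ℝ) 1 := fun t =>
    ⟨Real.smoothTransition.nonneg t, Real.smoothTransition.le_one t⟩
  have hs : ContDiff ℝ 1 Real.smoothTransition := Real.smoothTransition.contDiff (n := 1)
  refine ⟨γ ∘ Real.smoothTransition, ⟨?_, fun t => hS _ (hm t)⟩, by simp, by simp, ?_⟩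
  · exact h.comp_contDiff hs hm
  · rw [integral_speed_comp (φ' := deriv Real.smoothTransition) zero_le_one
      hs.continuous.continuousOn
      (fun t _ => (hs.differentiable one_ne_zero).differentiableAt.hasDerivAt)
      (fun t _ => Real.smoothTransition.monotone.deriv_nonneg)]
    · simp [curveLen_eq]
    · intro t ht
      have : Real.smoothTransition t ∈ Ioo (0:ℝ) 1 :=
        ⟨Real.smoothTransition.pos_of_pos ht.1, Real.smoothTransition.lt_one_of_lt_one ht.2⟩
      exact (h.differentiableOn one_ne_zero).differentiableAt (Icc_mem_nhds this.1 this.2)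

/-- Two curves can be concatenated, adding their lengths. -/
lemma IsCurveIn.concat {S : Set E} {ρ : E → ℝ} (hc : ContinuousOn ρ S) {γ₁ γ₂ : ℝ → E}
    (h₁ : IsCurveIn S γ₁) (h₂ : IsCurveIn S γ₂) (h : γ₁ 1 = γ₂ 0) :
    ∃ σ, IsCurveIn S σ ∧ σ 0 = γ₁ 0 ∧ σ 2 = γ₂ 1 ∧
      ∫ t in (0:ℝ)..2, speed ρ σ t =
        (∫ t in (0:ℝ)..1, speed ρ γ₁ t) + ∫ t in (0:ℝ)..1, speed ρ γ₂ t := by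
  have hs : ContDiff ℝ 1 Real.smoothTransition := Real.smoothTransition.contDiff (n := 1)
  set φ : ℝ → ℝ := fun t => Real.smoothTransition (t - 1) with hφ
  have hsφ : ContDiff ℝ 1 φ := hs.comp (by fun_prop)
  set σ : ℝ → E := fun t => γ₁ (Real.smoothTransition t) + γ₂ (φ t) - γ₂ 0 with hσ
  have hσ1 : ∀ t ≤ 1, σ t = (γ₁ ∘ Real.smoothTransition) t := fun t ht => by
    simp [hσ, hφ, Real.smoothTransition.zero_of_nonpos (sub_nonpos.2 ht)]
  have hσ2 : ∀ t, 1 ≤ t → σ t = (γ₂ ∘ φ) t := fun t ht => by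
    simp [hσ, Real.smoothTransition.one_of_one_le ht, h]
  have hcurve : IsCurveIn S σ := by
    refine ⟨((h₁.1.comp hs).add (h₂.1.comp hsφ)).sub contDiff_const, fun t => ?_⟩
    rcases le_total t 1 with ht | ht
    · rw [hσ1 t ht]; exact h₁.2 _
    · rw [hσ2 t ht]; exact h₂.2 _
  have hint : ∀ a b, IntervalIntegrable (speed ρ σ) MeasureTheory.volume a b := fun a b =>
    (hcurve.continuous_speed hc).intervalIntegrable a b
  refine ⟨σ, hcurve, ?_, ?_, ?_⟩
  · rw [hσ1 0 zero_le_one]; simp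
  · rw [hσ2 2 one_le_two]; norm_num [hφ]
  · rw [← intervalIntegral.integral_add_adjacent_intervals (hint 0 1) (hint 1 2)]
    congr 1
    · trans ∫ t in (0:ℝ)..1, speed ρ (γ₁ ∘ Real.smoothTransition) t
      · refine intervalIntegral.integral_congr_Ioo_of_le zero_le_one fun t ht => ?_
        have : σ =ᶠ[nhds t] γ₁ ∘ Real.smoothTransition := by
          filter_upwards [Iio_mem_nhds ht.2] with s hs using hσ1 s (le_of_lt hs)
        simp only [speed, this.deriv_eq, this.eq_of_nhds]
      · rw [integral_speed_comp (φ' := deriv Real.smoothTransition) zero_le_one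
          hs.continuous.continuousOn
          (fun t _ => (hs.differentiable one_ne_zero).differentiableAt.hasDerivAt)
          (fun t _ => Real.smoothTransition.monotone.deriv_nonneg)
          (fun t _ => (h₁.1.differentiable one_ne_zero).differentiableAt)]
        simp
    · trans ∫ t in (1:ℝ)..2, speed ρ (γ₂ ∘ φ) t
      · refine intervalIntegral.integral_congr_Ioo_of_le one_le_two fun t ht => ?_
        have : σ =ᶠ[nhds t] γ₂ ∘ φ := by
          filter_upwards [Ioi_mem_nhds ht.1] with s hs using hσ2 s (le_of_lt hs)
        simp only [speed, this.deriv_eq, this.eq_of_nhds]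
      · have hmono : Monotone φ := fun s t hst =>
          Real.smoothTransition.monotone (by linarith)
        rw [integral_speed_comp (φ' := deriv φ) one_le_two
          hsφ.continuous.continuousOn
          (fun t _ => (hsφ.differentiable one_ne_zero).differentiableAt.hasDerivAt)
          (fun t _ => hmono.deriv_nonneg)
          (fun t _ => (h₂.1.differentiable one_ne_zero).differentiableAt)]
        norm_num [hφ]

/-- Reversing a curve preserves its length. -/
lemma IsCurveIn.reverse {S : Set E} (ρ : E → ℝ) {γ : ℝ → E} (h : IsCurveIn S γ) :
    ∃ σ, IsCurveIn S σ ∧ σ 0 = γ 1 ∧ σ 1 = γ 0 ∧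
      ∫ t in (0:ℝ)..1, speed ρ σ t = ∫ t in (0:ℝ)..1, speed ρ γ t := by
  refine ⟨fun t => γ (1 - t), ⟨h.1.comp (by fun_prop), fun t => h.2 _⟩, by simp, by simp, ?_⟩
  have : speed ρ (fun t => γ (1 - t)) = fun t => speed ρ γ (1 - t) := by
    ext t
    simp [speed, deriv_comp_const_sub]
  rw [this, intervalIntegral.integral_comp_sub_left (fun t => speed ρ γ t) 1]
  simp

lemma rescale {S : Set E} {γ : ℝ → E} (ρ : E → ℝ) {b : ℝ} (hb : 0 ≤ b) (h : IsCurveIn S γ) :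
    ∃ σ, IsCurveIn S σ ∧ σ 0 = γ 0 ∧ σ 1 = γ b ∧
      ∫ t in (0:ℝ)..1, speed ρ σ t = ∫ t in (0:ℝ)..b, speed ρ γ t := by
  have hd : ∀ t, HasDerivAt (fun t : ℝ => t * b) b t := fun t => by
    simpa using (hasDerivAt_id t).mul_const b
  refine ⟨γ ∘ fun t => t * b, ⟨h.1.comp (by fun_prop), fun t => h.2 _⟩, by simp, by simp, ?_⟩
  rw [integral_speed_comp (φ' := fun _ => b) zero_le_one
      (fun t _ => (hd t).continuousAt.continuousWithinAt) (fun t _ => hd t)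
      (fun t _ => hb) (fun t _ => (h.1.differentiable one_ne_zero).differentiableAt)]
  simp

lemma exists_isCurveIn {S : Set E} (ho : IsOpen S) (hcon : IsPreconnected S) {x y : E}
    (hx : x ∈ S) (hy : y ∈ S) : ∃ γ, IsCurveIn S γ ∧ γ 0 = x ∧ γ 1 = y := by
  refine hcon.induction₂ (fun x y => ∃ γ, IsCurveIn S γ ∧ γ 0 = x ∧ γ 1 = y) ?_ ?_ ?_ hx hy
  · intro x hx
    obtain ⟨r, hr, hb⟩ := Metric.isOpen_iff.1 ho x hx
    filter_upwards [mem_nhdsWithin_of_mem_nhds (ball_mem_nhds x hr)] with y hy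
    have : ContDiffOn ℝ 1 (fun t : ℝ => x + t • (y - x)) (Icc 0 1) := by fun_prop
    obtain ⟨σ, h1, h2, h3, -⟩ := exists_isCurveIn_of_contDiffOn (S := S) (fun _ => 0) this (by
      intro t ht
      apply hb
      exact (convex_ball x r).add_smul_sub_mem (mem_ball_self hr) hy ht)
    exact ⟨σ, h1, by simpa using h2, by simpa using h3⟩
  · rintro x y z - - - ⟨γ, h1, h2, h3⟩ ⟨σ, h4, h5, h6⟩
    obtain ⟨τ, h7, h8, h9, -⟩ := h1.concat (ρ := fun _ => 0) continuousOn_const h4 (h3.trans h5.symm)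
    obtain ⟨υ, h10, h11, h12, -⟩ := rescale (fun _ => 0) zero_le_two h7
    exact ⟨υ, h10, h11.trans (h8.trans h2), h12.trans (h9.trans h6)⟩
  · rintro x y - - ⟨γ, h1, h2, h3⟩
    obtain ⟨τ, h7, h8, h9, -⟩ := h1.reverse (fun _ => 0)
    exact ⟨τ, h7, h8.trans h3, h9.trans h2⟩

lemma exists_isCurveIn_lt {S : Set E} (ρ : E → ℝ) (ho : IsOpen S) (hcon : IsPreconnected S)
    {x y : E} (hx : x ∈ S) (hy : y ∈ S) {ε : ℝ} (hε : 0 < ε) :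
    ∃ γ, IsCurveIn S γ ∧ γ 0 = x ∧ γ 1 = y ∧
      ∫ t in (0:ℝ)..1, speed ρ γ t < densityDist S ρ x y + ε := by
  obtain ⟨γ₀, h1, h2, h3⟩ := exists_isCurveIn ho hcon hx hy
  obtain ⟨L, ⟨γ, g1, g2, g3, g4, rfl⟩, hL⟩ := Real.lt_sInf_add_pos
    (s := { L | ∃ γ : ℝ → E, ContDiffOn ℝ 1 γ (Icc 0 1) ∧ γ 0 = x ∧ γ 1 = y ∧
      (∀ t ∈ Icc (0:ℝ) 1, γ t ∈ S) ∧ L = curveLen ρ γ })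
    ⟨_, γ₀, h1.1.contDiffOn, h2, h3, fun t _ => h1.2 t, rfl⟩ hε
  obtain ⟨σ, s1, s2, s3, s4⟩ := exists_isCurveIn_of_contDiffOn ρ g1 g4
  exact ⟨σ, s1, s2.trans g2, s3.trans g3, s4 ▸ hL⟩

lemma densityDist_self {S : Set E} {ρ : E → ℝ} (hρ : ∀ z, 0 ≤ ρ z) {x : E} (hx : x ∈ S) :
    densityDist S ρ x x = 0 := by
  refine le_antisymm ?_ (densityDist_nonneg hρ _ _)
  have h : IsCurveIn S (fun _ : ℝ => x) := ⟨contDiff_const, fun _ => hx⟩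
  simpa using h.densityDist_le hρ (le_refl 0)

lemma densityDist_triangle {S : Set E} {ρ : E → ℝ} (ho : IsOpen S) (hcon : IsPreconnected S)
    (hc : ContinuousOn ρ S) (hρ : ∀ z, 0 ≤ ρ z) {x y z : E}
    (hx : x ∈ S) (hy : y ∈ S) (hz : z ∈ S) :
    densityDist S ρ x z ≤ densityDist S ρ x y + densityDist S ρ y z := by
  refine le_of_forall_pos_le_add fun ε hε => ?_
  obtain ⟨γ, h1, h2, h3, h4⟩ := exists_isCurveIn_lt ρ ho hcon hx hy (half_pos hε)
  obtain ⟨σ, g1, g2, g3, g4⟩ := exists_isCurveIn_lt ρ ho hcon hy hz (half_pos hε)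
  obtain ⟨τ, h7, h8, h9, h10⟩ := h1.concat hc g1 (h3.trans g2.symm)
  have := h7.densityDist_le hρ zero_le_two
  rw [h8, h9, h10, h2, g3] at this
  linarith

lemma densityDist_comm {S : Set E} {ρ : E → ℝ} (ho : IsOpen S) (hcon : IsPreconnected S)
    (hρ : ∀ z, 0 ≤ ρ z) {x y : E} (hx : x ∈ S) (hy : y ∈ S) :
    densityDist S ρ x y = densityDist S ρ y x := by
  have key : ∀ x ∈ S, ∀ y ∈ S, densityDist S ρ x y ≤ densityDist S ρ y x := by
    intro x hx y hy
    refine le_of_forall_pos_le_add fun ε hε => ?_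
    obtain ⟨γ, h1, h2, h3, h4⟩ := exists_isCurveIn_lt ρ ho hcon hy hx hε
    obtain ⟨σ, g1, g2, g3, g4⟩ := h1.reverse ρ
    have := g1.densityDist_le hρ zero_le_one
    rw [g2, g3, g4, h2, h3] at this
    linarith
  exact le_antisymm (key x hx y hy) (key y hy x hx)

end Density

section Abstract

variable {α : Type*}

/-- `d` satisfies the axioms of a pseudometric on `S`. -/
structure IsDistOn (S : Set α) (d : α → α → ℝ) : Prop where
  nonneg : ∀ x ∈ S, ∀ y ∈ S, 0 ≤ d x y
  self : ∀ x ∈ S, d x x = 0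
  comm : ∀ x ∈ S, ∀ y ∈ S, d x y = d y x
  triangle : ∀ x ∈ S, ∀ y ∈ S, ∀ z ∈ S, d x z ≤ d x y + d y z

lemma IsDistOn.isGeodesicIn_of_le {S : Set α} {d : α → α → ℝ} (hd : IsDistOn S d) {g : ℝ → α}
    {x y : α} (hx : x ∈ S) (hy : y ∈ S) (h0 : g 0 = x) (h1 : g (d x y) = y)
    (hS : ∀ t ∈ Icc (0:ℝ) (d x y), g t ∈ S)
    (hle : ∀ s ∈ Icc (0:ℝ) (d x y), ∀ t ∈ Icc (0:ℝ) (d x y), s ≤ t → d (g s) (g t) ≤ t - s) :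
    IsGeodesicIn S d g x y := by
  refine ⟨h0, h1, hS, ?_⟩
  have hL := hd.nonneg x hx y hy
  have key : ∀ s ∈ Icc (0:ℝ) (d x y), ∀ t ∈ Icc (0:ℝ) (d x y), s ≤ t → d (g s) (g t) = t - s := by
    intro s hs t ht hst
    refine le_antisymm (hle s hs t ht hst) ?_
    have e1 := hle 0 ⟨le_rfl, hL⟩ s hs hs.1
    have e2 := hle t ht (d x y) ⟨hL, le_rfl⟩ ht.2
    rw [h0] at e1
    rw [h1] at e2
    have t1 := hd.triangle x hx (g s) (hS s hs) y hy
    have t2 := hd.triangle (g s) (hS s hs) (g t) (hS t ht) y hy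
    linarith
  intro s hs t ht
  rcases le_total s t with h | h
  · rw [key s hs t ht h, abs_sub_comm, abs_of_nonneg (sub_nonneg.2 h)]
  · rw [hd.comm _ (hS s hs) _ (hS t ht), key t ht s hs h, abs_of_nonneg (sub_nonneg.2 h)]

end Abstract

section Quasihyperbolic

variable {E : Type*} [NormedAddCommGroup E] [NormedSpace ℝ E]

/-- A connected open set different from the whole space. -/
structure IsProperDomain (Ω : Set E) : Prop where
  isOpen : IsOpen Ω
  isPreconnected : IsPreconnected Ω
  compl_nonempty : Ωᶜ.Nonempty

namespace IsProperDomain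

variable {Ω : Set E} (h : IsProperDomain Ω)
include h

omit [NormedSpace ℝ E] in
lemma infDist_pos {z : E} (hz : z ∈ Ω) : 0 < infDist z Ωᶜ :=
  (h.isOpen.isClosed_compl.notMem_iff_infDist_pos h.compl_nonempty).1 (fun hn => hn hz)

omit [NormedSpace ℝ E] h in
lemma mem_of_infDist_pos {z : E} (hz : 0 < infDist z Ωᶜ) : z ∈ Ω :=
  not_notMem.1 fun hn => hz.ne' (infDist_zero_of_mem hn)

omit h in
lemma qhDensity_nonneg (z : E) : 0 ≤ qhDensity Ω z := inv_nonneg.2 infDist_nonneg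

lemma continuousOn_qhDensity : ContinuousOn (qhDensity Ω) Ω :=
  (continuous_infDist_pt _).continuousOn.inv₀ fun _ hz => (h.infDist_pos hz).ne'

lemma isDistOn : IsDistOn Ω (qhDist Ω) where
  nonneg _ _ _ _ := densityDist_nonneg qhDensity_nonneg _ _
  self _ hx := densityDist_self qhDensity_nonneg hx
  comm _ hx _ hy := densityDist_comm h.isOpen h.isPreconnected qhDensity_nonneg hx hy
  triangle _ hx _ hy _ hz := densityDist_triangle h.isOpen h.isPreconnected
    h.continuousOn_qhDensity qhDensity_nonneg hx hy hz

lemma exists_curve {x y : E} (hx : x ∈ Ω) (hy : y ∈ Ω) {ε : ℝ} (hε : 0 < ε) :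
    ∃ γ, IsCurveIn Ω γ ∧ γ 0 = x ∧ γ 1 = y ∧
      ∫ t in (0:ℝ)..1, speed (qhDensity Ω) γ t < qhDist Ω x y + ε :=
  exists_isCurveIn_lt _ h.isOpen h.isPreconnected hx hy hε

omit h in
lemma qhDist_le_integral {γ : ℝ → E} (hγ : IsCurveIn Ω γ) {a b : ℝ} (hab : a ≤ b) :
    qhDist Ω (γ a) (γ b) ≤ ∫ t in a..b, speed (qhDensity Ω) γ t :=
  hγ.densityDist_le qhDensity_nonneg hab

lemma intervalIntegrable_speed {γ : ℝ → E} (hγ : IsCurveIn Ω γ) (a b : ℝ) :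
    IntervalIntegrable (speed (qhDensity Ω) γ) MeasureTheory.volume a b :=
  (hγ.continuous_speed h.continuousOn_qhDensity).intervalIntegrable a b

lemma qhDist_add_qhDist_le {γ : ℝ → E} (hγ : IsCurveIn Ω γ) {a b c : ℝ} (hab : a ≤ b)
    (hbc : b ≤ c) : qhDist Ω (γ a) (γ b) + qhDist Ω (γ b) (γ c) ≤
      ∫ t in a..c, speed (qhDensity Ω) γ t := by
  rw [← intervalIntegral.integral_add_adjacent_intervals (h.intervalIntegrable_speed hγ a b)
    (h.intervalIntegrable_speed hγ b c)]
  exact add_le_add (qhDist_le_integral hγ hab) (qhDist_le_integral hγ hbc)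

lemma log_le_integral_speed [CompleteSpace E] {γ : ℝ → E} (hγ : IsCurveIn Ω γ) {a b : ℝ}
    (hab : a ≤ b) :
    Real.log (1 + ‖γ b - γ a‖ / infDist (γ a) Ωᶜ) ≤ ∫ t in a..b, speed (qhDensity Ω) γ t := by
  set δ := infDist (γ a) Ωᶜ
  have hδ : 0 < δ := h.infDist_pos (hγ.2 a)
  have hc : Continuous (fun t => ‖deriv γ t‖) := (hγ.1.continuous_deriv le_rfl).norm
  set s : ℝ → ℝ := fun t => ∫ u in a..t, ‖deriv γ u‖ with hs
  have hs0 : ∀ t, a ≤ t → 0 ≤ s t := fun t ht =>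
    intervalIntegral.integral_nonneg ht fun _ _ => norm_nonneg _
  have hsd : ∀ t, HasDerivAt s (‖deriv γ t‖) t := fun t =>
    intervalIntegral.integral_hasDerivAt_right (hc.intervalIntegrable _ _)
      (hc.stronglyMeasurableAtFilter _ _) hc.continuousAt
  have hdist : ∀ t, a ≤ t → ‖γ t - γ a‖ ≤ s t := fun t ht => by
    rw [← intervalIntegral.integral_deriv_eq_sub
      (fun u _ => (hγ.1.differentiable one_ne_zero).differentiableAt)
      ((hγ.1.continuous_deriv le_rfl).intervalIntegrable _ _)]
    exact intervalIntegral.norm_integral_le_integral_norm ht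
  have hsc : Continuous s := continuous_iff_continuousAt.2 fun t => (hsd t).continuousAt
  have hlog : ∀ t ∈ uIcc a b, HasDerivAt (fun t => Real.log (δ + s t))
      (‖deriv γ t‖ / (δ + s t)) t := fun t ht => by
    rw [uIcc_of_le hab] at ht
    have := hs0 t ht.1
    exact ((hsd t).const_add δ).log (by positivity)
  have hint : IntervalIntegrable (fun t => ‖deriv γ t‖ / (δ + s t)) MeasureTheory.volume a b := by
    apply ContinuousOn.intervalIntegrable
    refine hc.continuousOn.div (by fun_prop) fun t ht => ?_
    rw [uIcc_of_le hab] at ht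
    have := hs0 t ht.1
    positivity
  have hmono := intervalIntegral.integral_mono_on hab hint (h.intervalIntegrable_speed hγ a b)
    (fun t ht => by
      have h1 := hs0 t ht.1
      have h2 : infDist (γ t) Ωᶜ ≤ δ + s t := by
        refine (infDist_le_infDist_add_dist (y := γ a)).trans ?_
        rw [dist_eq_norm]
        exact add_le_add_right (hdist t ht.1) _
      have h3 := h.infDist_pos (hγ.2 t)
      rw [speed, qhDensity, div_eq_inv_mul]
      gcongr)
  rw [intervalIntegral.integral_eq_sub_of_hasDerivAt hlog hint] at hmono
  refine le_trans ?_ hmono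
  have ha : s a = 0 := by simp [hs]
  rw [ha, add_zero, ← Real.log_div (by have := hs0 b hab; positivity) hδ.ne']
  have := hdist b hab
  apply Real.log_le_log (by positivity)
  rw [add_div, div_self hδ.ne']
  gcongr

lemma log_le_qhDist [CompleteSpace E] {x y : E} (hx : x ∈ Ω) (hy : y ∈ Ω) :
    Real.log (1 + ‖x - y‖ / infDist x Ωᶜ) ≤ qhDist Ω x y := by
  refine le_of_forall_pos_le_add fun ε hε => ?_
  obtain ⟨γ, h1, h2, h3, h4⟩ := h.exists_curve hx hy hε
  have := h.log_le_integral_speed h1 zero_le_one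
  rw [h2, h3, norm_sub_rev] at this
  linarith

lemma log_add_log_le_qhDist [CompleteSpace E] {x y : E} (hx : x ∈ Ω) (hy : y ∈ Ω) :
    Real.log (1 + ‖x - y‖ / (2 * infDist x Ωᶜ)) + Real.log (1 + ‖x - y‖ / (2 * infDist y Ωᶜ)) ≤
      qhDist Ω x y := by
  refine le_of_forall_pos_le_add fun ε hε => ?_
  obtain ⟨γ, h1, h2, h3, h4⟩ := h.exists_curve hx hy hε
  have hδx := h.infDist_pos hx
  have hδy := h.infDist_pos hy
  obtain ⟨T, hT, hT'⟩ : ∃ T ∈ Icc (0:ℝ) 1, ‖x - γ T‖ = ‖x - y‖ / 2 := by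
    have hc : ContinuousOn (fun t => ‖x - γ t‖) (Icc 0 1) := by
      have := h1.1.continuous
      fun_prop
    refine intermediate_value_Icc zero_le_one hc ⟨?_, ?_⟩
    · rw [h2, sub_self, norm_zero]; positivity
    · rw [h3]; linarith [norm_nonneg (x - y)]
  have hT2 : ‖x - y‖ / 2 ≤ ‖y - γ T‖ := by
    have := norm_sub_le_norm_sub_add_norm_sub x (γ T) y
    rw [norm_sub_rev y]
    linarith
  have e1 := h.log_le_qhDist hx (h1.2 T)
  have e2 := h.log_le_qhDist hy (h1.2 T)
  have e3 := h.qhDist_add_qhDist_le h1 hT.1 hT.2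
  rw [h2, h3, h.isDistOn.comm _ (h1.2 T) _ hy] at e3
  have l1 : Real.log (1 + ‖x - y‖ / (2 * infDist x Ωᶜ)) ≤ qhDist Ω x (γ T) := by
    rwa [hT', div_div] at e1
  have l2 : Real.log (1 + ‖x - y‖ / (2 * infDist y Ωᶜ)) ≤ qhDist Ω y (γ T) := by
    refine le_trans (Real.log_le_log (by positivity) ?_) e2
    rw [← div_div]
    gcongr
  linarith

omit h in
lemma qhDist_le_of_norm_deriv_le {γ : ℝ → E} {M : ℝ} (hγ : ContDiff ℝ 1 γ)
    (hΩ : ∀ t ∈ Icc (0:ℝ) 1, γ t ∈ Ω)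
    (hM : ∀ t ∈ Icc (0:ℝ) 1, ‖deriv γ t‖ ≤ M * infDist (γ t) Ωᶜ) (h : IsProperDomain Ω) :
    qhDist Ω (γ 0) (γ 1) ≤ M := by
  obtain ⟨σ, h1, h2, h3, h4⟩ := exists_isCurveIn_of_contDiffOn (qhDensity Ω) hγ.contDiffOn hΩ
  have h5 := qhDist_le_integral h1 zero_le_one
  rw [h2, h3, h4, curveLen_eq] at h5
  refine h5.trans ?_
  have hint : IntervalIntegrable (speed (qhDensity Ω) γ) MeasureTheory.volume 0 1 := by
    apply ContinuousOn.intervalIntegrable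
    rw [uIcc_of_le zero_le_one]
    exact (h.continuousOn_qhDensity.comp hγ.continuous.continuousOn hΩ).mul
      (hγ.continuous_deriv le_rfl).norm.continuousOn
  have := intervalIntegral.integral_mono_on (g := fun _ => M) zero_le_one hint
    intervalIntegrable_const (fun t ht => by
      have h3 := h.infDist_pos (hΩ t ht)
      rw [speed, qhDensity, inv_mul_le_iff₀ h3, mul_comm]
      exact hM t ht)
  simpa using this

lemma qhDist_le_of_segment {x y : E} {m : ℝ} (hm : 0 < m)
    (hxy : ∀ t ∈ Icc (0:ℝ) 1, m ≤ infDist (x + t • (y - x)) Ωᶜ) :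
    qhDist Ω x y ≤ ‖y - x‖ / m := by
  have hd : ∀ t : ℝ, HasDerivAt (fun t : ℝ => x + t • (y - x)) (y - x) t := fun t => by
    simpa using ((hasDerivAt_id t).smul_const (y - x)).const_add x
  have := qhDist_le_of_norm_deriv_le (γ := fun t : ℝ => x + t • (y - x)) (M := ‖y - x‖ / m)
    (by fun_prop) (fun t ht => mem_of_infDist_pos (hm.trans_le (hxy t ht))) (fun t ht => by
      rw [(hd t).deriv, div_mul_eq_mul_div, le_div_iff₀ hm]
      gcongr
      exact hxy t ht) h
  simpa using this

lemma qhDist_le_of_norm_sub_le {x y : E} (hx : x ∈ Ω) (hxy : ‖y - x‖ ≤ infDist x Ωᶜ / 2) :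
    qhDist Ω x y ≤ ‖y - x‖ * (2 / infDist x Ωᶜ) := by
  have hδ := h.infDist_pos hx
  have := h.qhDist_le_of_segment (x := x) (y := y) (half_pos hδ) (fun t ht => by
    have h1 := infDist_le_infDist_add_dist (s := Ωᶜ) (x := x) (y := x + t • (y - x))
    have h2 : dist x (x + t • (y - x)) ≤ ‖y - x‖ := by
      rw [dist_self_add_right, norm_smul, Real.norm_of_nonneg ht.1]
      exact mul_le_of_le_one_left (norm_nonneg _) ht.2
    linarith)
  refine this.trans (le_of_eq ?_)
  field_simp

lemma continuous_qhDist : Continuous (fun p : Ω × Ω => qhDist Ω p.1 p.2) := by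
  have hd := h.isDistOn
  have hnear : ∀ x : Ω, Tendsto (fun y : Ω => qhDist Ω x y) (nhds x) (nhds 0) := by
    intro x
    have h1 : Tendsto (fun y : Ω => ‖(y:E) - x‖ * (2 / infDist (x:E) Ωᶜ)) (nhds x) (nhds 0) := by
      have : Continuous (fun y : Ω => ‖(y:E) - x‖ * (2 / infDist (x:E) Ωᶜ)) := by fun_prop
      simpa using this.tendsto x
    refine tendsto_of_tendsto_of_tendsto_of_le_of_le' tendsto_const_nhds h1
      (Eventually.of_forall fun y => hd.nonneg _ x.2 _ y.2) ?_
    have h2 : Tendsto (fun y : Ω => ‖(y:E) - x‖) (nhds x) (nhds 0) := by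
      have : Continuous (fun y : Ω => ‖(y:E) - x‖) := by fun_prop
      simpa using this.tendsto x
    filter_upwards [h2.eventually_le_const (half_pos (h.infDist_pos x.2))] with y hy
    exact h.qhDist_le_of_norm_sub_le x.2 hy
  rw [continuous_iff_continuousAt]
  rintro ⟨x, y⟩
  have h0 : Tendsto (fun p : Ω × Ω => qhDist Ω x p.1 + qhDist Ω y p.2) (nhds (x, y)) (nhds 0) := by
    have := ((hnear x).comp (continuous_fst.tendsto (x, y))).add
      ((hnear y).comp (continuous_snd.tendsto (x, y)))
    simpa using this
  refine tendsto_iff_dist_tendsto_zero.2 (squeeze_zero (fun _ => dist_nonneg) (fun p => ?_) h0)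
  rw [Real.dist_eq, abs_le]
  have t1 := hd.triangle p.1 p.1.2 x x.2 p.2 p.2.2
  have t2 := hd.triangle x x.2 y y.2 p.2 p.2.2
  have t3 := hd.triangle x x.2 p.1 p.1.2 y y.2
  have t4 := hd.triangle p.1 p.1.2 p.2 p.2.2 y y.2
  have c1 := hd.comm p.1 p.1.2 x x.2
  have c2 := hd.comm p.2 p.2.2 y y.2
  constructor <;> simp only <;> linarith

lemma eq_of_qhDist_le_zero [CompleteSpace E] {x y : E} (hx : x ∈ Ω) (hy : y ∈ Ω)
    (hxy : qhDist Ω x y ≤ 0) : x = y := by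
  have h1 := (h.log_le_qhDist hx hy).trans hxy
  have hδ := h.infDist_pos hx
  by_contra hne
  have : 0 < ‖x - y‖ := norm_pos_iff.2 (sub_ne_zero.2 hne)
  have := Real.log_pos (x := 1 + ‖x - y‖ / infDist x Ωᶜ) (by
    have : 0 < ‖x - y‖ / infDist x Ωᶜ := by positivity
    linarith)
  linarith

lemma norm_sub_le_of_qhDist_le [CompleteSpace E] {x y : E} (hx : x ∈ Ω) (hy : y ∈ Ω) {R : ℝ}
    (hxy : qhDist Ω x y ≤ R) : ‖x - y‖ ≤ infDist x Ωᶜ * (Real.exp R - 1) := by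
  have h1 := (h.log_le_qhDist hx hy).trans hxy
  have hδ := h.infDist_pos hx
  rw [Real.log_le_iff_le_exp (by positivity)] at h1
  have : ‖x - y‖ / infDist x Ωᶜ ≤ Real.exp R - 1 := by linarith
  rwa [div_le_iff₀ hδ, mul_comm] at this

lemma infDist_le_of_qhDist_le [CompleteSpace E] {x y : E} (hx : x ∈ Ω) (hy : y ∈ Ω) {R : ℝ}
    (hxy : qhDist Ω x y ≤ R) : infDist y Ωᶜ ≤ infDist x Ωᶜ * Real.exp R := by
  have h1 := h.norm_sub_le_of_qhDist_le hx hy hxy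
  have h2 := infDist_le_infDist_add_dist (s := Ωᶜ) (x := y) (y := x)
  rw [dist_comm, dist_eq_norm] at h2
  linarith

/-- Any two points of a proper domain are joined by a quasihyperbolic geodesic. -/
theorem exists_isGeodesicIn [ProperSpace E] {x y : E} (hx : x ∈ Ω) (hy : y ∈ Ω) :
    ∃ g, IsGeodesicIn Ω (qhDist Ω) g x y := by
  have hd := h.isDistOn
  set L := qhDist Ω x y with hL
  have hL0 : 0 ≤ L := hd.nonneg x hx y hy
  set K : Set E := {z | ‖x - z‖ ≤ infDist x Ωᶜ * (Real.exp L - 1) ∧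
    infDist x Ωᶜ * Real.exp (-L) ≤ infDist z Ωᶜ} with hK
  have hδ := h.infDist_pos hx
  have hKΩ : K ⊆ Ω := fun z hz => mem_of_infDist_pos (lt_of_lt_of_le (by positivity) hz.2)
  have hKball : ∀ z ∈ Ω, qhDist Ω x z ≤ L → z ∈ K := by
    intro z hz hxz
    refine ⟨h.norm_sub_le_of_qhDist_le hx hz hxz, ?_⟩
    rw [hd.comm x hx z hz] at hxz
    have := h.infDist_le_of_qhDist_le hz hx hxz
    rw [Real.exp_neg, ← div_eq_mul_inv, div_le_iff₀ (Real.exp_pos _)]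
    exact this
  have hKc : IsCompact K := by
    refine Metric.isCompact_of_isClosed_isBounded ?_ ?_
    · exact (isClosed_le (f := fun z : E => ‖x - z‖) (by fun_prop) continuous_const).inter
        (isClosed_le continuous_const (continuous_infDist_pt _))
    · refine (isBounded_closedBall (x := x)
        (r := infDist x Ωᶜ * (Real.exp L - 1))).subset fun z hz => ?_
      rw [mem_closedBall, dist_comm, dist_eq_norm]
      exact hz.1
  have : CompactSpace K := isCompact_iff_compactSpace.1 hKc
  have hkc : ∀ s t : ℝ, Continuous (fun g : ℝ → K => qhDist Ω (g s) (g t)) := fun s t =>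
    h.continuous_qhDist.comp (f := fun g : ℝ → K =>
      ((⟨g s, hKΩ (g s).2⟩, ⟨g t, hKΩ (g t).2⟩) : Ω × Ω)) (by fun_prop)
  have hkx : Continuous (fun g : ℝ → K => qhDist Ω x (g 0)) :=
    h.continuous_qhDist.comp (f := fun g : ℝ → K =>
      ((⟨x, hx⟩, ⟨g 0, hKΩ (g 0).2⟩) : Ω × Ω)) (by fun_prop)
  have hky : Continuous (fun g : ℝ → K => qhDist Ω (g L) y) :=
    h.continuous_qhDist.comp (f := fun g : ℝ → K =>
      ((⟨g L, hKΩ (g L).2⟩, ⟨y, hy⟩) : Ω × Ω)) (by fun_prop)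
  set C : ℕ → Set (ℝ → K) := fun n => {g | qhDist Ω x (g 0) ≤ 0} ∩
    {g | qhDist Ω (g L) y ≤ 1 / ((n:ℝ) + 1)} ∩
    ⋂ s ∈ Icc (0:ℝ) L, ⋂ t ∈ Icc (0:ℝ) L, ⋂ (_ : s ≤ t), {g | qhDist Ω (g s) (g t) ≤ t - s} with hC
  have hclosed : ∀ n, IsClosed (C n) := fun n =>
    ((isClosed_le hkx continuous_const).inter (isClosed_le hky continuous_const)).inter
      (isClosed_biInter fun s _ => isClosed_biInter fun t _ => isClosed_iInter fun _ =>
        isClosed_le (hkc s t) continuous_const)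
  have hanti : ∀ n, C (n + 1) ⊆ C n := by
    rintro n g ⟨⟨g1, g2⟩, g3⟩
    refine ⟨⟨g1, le_trans (b := 1 / (((n + 1 : ℕ) : ℝ) + 1)) g2 ?_⟩, g3⟩
    push_cast
    gcongr
    linarith
  have hne : ∀ n, (C n).Nonempty := by
    intro n
    have hε : (0:ℝ) < 1 / ((n:ℝ) + 1) := by positivity
    obtain ⟨γ, h1, h2, h3, h4⟩ := h.exists_curve hx hy hε
    set ℓ : ℝ → ℝ := fun T => ∫ t in (0:ℝ)..T, speed (qhDensity Ω) γ t with hℓ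
    have hsub : ∀ a b, a ≤ b → qhDist Ω (γ a) (γ b) ≤ ℓ b - ℓ a := fun a b hab => by
      rw [hℓ]
      simp only
      rw [intervalIntegral.integral_interval_sub_left (h.intervalIntegrable_speed h1 _ _)
        (h.intervalIntegrable_speed h1 _ _)]
      exact qhDist_le_integral h1 hab
    have hmono : Monotone ℓ := fun a b hab => by
      have := hsub a b hab
      have := hd.nonneg _ (h1.2 a) _ (h1.2 b)
      linarith
    have hℓc : Continuous ℓ := intervalIntegral.continuous_primitive
      (fun a b => h.intervalIntegrable_speed h1 a b) 0
    have hℓ0 : ℓ 0 = 0 := by simp [hℓ]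
    have hℓ1 : L ≤ ℓ 1 := by
      have := hsub 0 1 zero_le_one
      rw [h2, h3, hℓ0] at this
      linarith
    have hτ : ∀ s ∈ Icc (0:ℝ) L, ∃ τ ∈ Icc (0:ℝ) 1, ℓ τ = s := fun s hs =>
      intermediate_value_Icc zero_le_one hℓc.continuousOn
        ⟨hℓ0.le.trans hs.1, hs.2.trans hℓ1⟩
    choose! τ hτ1 hτ2 using hτ
    have hτK : ∀ s ∈ Icc (0:ℝ) L, γ (τ s) ∈ K := fun s hs => by
      refine hKball _ (h1.2 _) ?_
      have := hsub 0 (τ s) (hτ1 s hs).1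
      rw [h2, hℓ0, hτ2 s hs] at this
      linarith [hs.2]
    have hle : ∀ s ∈ Icc (0:ℝ) L, ∀ t ∈ Icc (0:ℝ) L, s ≤ t →
        qhDist Ω (γ (τ s)) (γ (τ t)) ≤ t - s := by
      intro s hs t ht hst
      rcases le_total (τ s) (τ t) with hc | hc
      · have := hsub _ _ hc
        rwa [hτ2 s hs, hτ2 t ht] at this
      · have := hsub _ _ hc
        have hm := hmono hc
        rw [hτ2 s hs, hτ2 t ht] at this hm
        rw [hd.comm _ (h1.2 _) _ (h1.2 _)]
        linarith
    have hxK : x ∈ K := hKball x hx (by rw [hd.self x hx]; exact hL0)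
    classical
    set g : ℝ → K := fun s => if hs : s ∈ Icc (0:ℝ) L then ⟨γ (τ s), hτK s hs⟩ else ⟨x, hxK⟩ with hg
    have hgs : ∀ s ∈ Icc (0:ℝ) L, (g s : E) = γ (τ s) := fun s hs => by
      simp only [hg, dif_pos hs]
    have m0 : (0:ℝ) ∈ Icc 0 L := ⟨le_rfl, hL0⟩
    have mL : L ∈ Icc 0 L := ⟨hL0, le_rfl⟩
    refine ⟨g, ⟨⟨?_, ?_⟩, ?_⟩⟩
    · show qhDist Ω x (g 0) ≤ 0
      have := hsub 0 _ (hτ1 0 m0).1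
      rw [h2, hℓ0, hτ2 0 m0, sub_self] at this
      rwa [hgs 0 m0]
    · show qhDist Ω (g L) y ≤ _
      have := hsub _ 1 (hτ1 L mL).2
      rw [h3, hτ2 L mL] at this
      rw [hgs L mL]
      linarith
    · simp only [mem_iInter]
      intro s hs t ht hst
      show qhDist Ω (g s) (g t) ≤ t - s
      rw [hgs s hs, hgs t ht]
      exact hle s hs t ht hst
  obtain ⟨g, hg⟩ := IsCompact.nonempty_iInter_of_sequence_nonempty_isCompact_isClosed C hanti hne
    (hclosed 0).isCompact hclosed
  rw [mem_iInter] at hg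
  have hgΩ : ∀ t, (g t : E) ∈ Ω := fun t => hKΩ (g t).2
  have g0 : x = g 0 := h.eq_of_qhDist_le_zero hx (hgΩ 0) (hg 0).1.1
  have gL : (g L : E) = y := by
    refine h.eq_of_qhDist_le_zero (hgΩ L) hy ?_
    refine ge_of_tendsto' tendsto_one_div_add_atTop_nhds_zero_nat fun n => (hg n).1.2
  refine ⟨fun t => g t, hd.isGeodesicIn_of_le hx hy g0.symm gL (fun t _ => hgΩ t) ?_⟩
  intro s hs t ht hst
  have := (hg 0).2
  simp only [mem_iInter] at this
  exact this s hs t ht hst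

end IsProperDomain

end Quasihyperbolic

/-- The four-point condition on `P`. -/
def FourPoint {α : Type*} (P : Set α) (d : α → α → ℝ) (D : ℝ) : Prop :=
  ∀ x ∈ P, ∀ y ∈ P, ∀ z ∈ P, ∀ w ∈ P,
    d x z + d y w ≤ max (d x y + d z w) (d x w + d y z) + D

/-- Reflection of the lower half plane onto the upper half plane. -/
def fold (z : ℂ) : ℂ := ⟨z.re, |z.im|⟩

lemma fold_of_nonneg {z : ℂ} (hz : 0 ≤ z.im) : fold z = z := by
  apply Complex.ext <;> simp [fold, abs_of_nonneg hz]

lemma fold_of_nonpos {z : ℂ} (hz : z.im ≤ 0) : fold z = (starRingEnd ℂ) z := by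
  apply Complex.ext <;> simp [fold, abs_of_nonpos hz]

lemma fold_im_nonneg (z : ℂ) : 0 ≤ (fold z).im := abs_nonneg _

/-- A proper domain which contains every non-real complex number. -/
structure IsRealSlit (Ω : Set ℂ) : Prop where
  isProperDomain : IsProperDomain Ω
  mem_of_im_ne_zero : ∀ z : ℂ, z.im ≠ 0 → z ∈ Ω

/-- The points of `Ω` in the closed upper half plane. -/
def upper (Ω : Set ℂ) : Set ℂ := {z ∈ Ω | 0 ≤ z.im}

namespace IsRealSlit

variable {Ω : Set ℂ} (h : IsRealSlit Ω)
include h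

lemma im_eq_zero {z : ℂ} (hz : z ∈ Ωᶜ) : z.im = 0 := by
  by_contra hne
  exact hz (h.mem_of_im_ne_zero z hne)

lemma conj_mem {z : ℂ} (hz : z ∈ Ω) : (starRingEnd ℂ) z ∈ Ω := by
  by_cases h0 : z.im = 0
  · rwa [Complex.conj_eq_iff_im.2 h0]
  · exact h.mem_of_im_ne_zero _ (by simpa using h0)

lemma fold_mem {z : ℂ} (hz : z ∈ Ω) : fold z ∈ upper Ω := by
  refine ⟨?_, fold_im_nonneg z⟩
  rcases le_total 0 z.im with h0 | h0
  · rwa [fold_of_nonneg h0]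
  · rw [fold_of_nonpos h0]; exact h.conj_mem hz

lemma infDist_conj (z : ℂ) : infDist ((starRingEnd ℂ) z) Ωᶜ = infDist z Ωᶜ := by
  have himage : (starRingEnd ℂ) '' Ωᶜ = Ωᶜ := by
    have : (starRingEnd ℂ) '' Ωᶜ = id '' Ωᶜ :=
      image_congr fun w hw => Complex.conj_eq_iff_im.2 (h.im_eq_zero hw)
    rw [this, image_id]
  have := infDist_image (Φ := (starRingEnd ℂ)) (t := Ωᶜ) (x := z) Complex.isometry_conj
  rwa [himage] at this

lemma qhDist_conj_le {z w : ℂ} (hz : z ∈ Ω) (hw : w ∈ Ω) :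
    qhDist Ω ((starRingEnd ℂ) z) ((starRingEnd ℂ) w) ≤ qhDist Ω z w := by
  refine le_of_forall_pos_le_add fun ε hε => ?_
  obtain ⟨γ, h1, h2, h3, h4⟩ := h.isProperDomain.exists_curve hz hw hε
  have hcurve : IsCurveIn Ω (fun t => (starRingEnd ℂ) (γ t)) :=
    ⟨Complex.conjCLE.contDiff.comp h1.1, fun t => h.conj_mem (h1.2 t)⟩
  have hspeed : speed (qhDensity Ω) (fun t => (starRingEnd ℂ) (γ t)) = speed (qhDensity Ω) γ := by
    ext t
    have hd : HasDerivAt (fun t => (starRingEnd ℂ) (γ t)) ((starRingEnd ℂ) (deriv γ t)) t :=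
      Complex.conjCLE.toContinuousLinearMap.hasFDerivAt.comp_hasDerivAt t
        (h1.1.differentiable one_ne_zero).differentiableAt.hasDerivAt
    rw [speed, speed, hd.deriv, Complex.norm_conj, qhDensity, qhDensity, h.infDist_conj]
  have := IsProperDomain.qhDist_le_integral hcurve zero_le_one
  rw [hspeed] at this
  simp only [h2, h3] at this
  linarith

lemma qhDist_conj {z w : ℂ} (hz : z ∈ Ω) (hw : w ∈ Ω) :
    qhDist Ω ((starRingEnd ℂ) z) ((starRingEnd ℂ) w) = qhDist Ω z w := by
  refine le_antisymm (h.qhDist_conj_le hz hw) ?_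
  simpa using h.qhDist_conj_le (h.conj_mem hz) (h.conj_mem hw)

/-- Points in opposite half planes are almost separated by a real point. -/
lemma exists_real_between {z w : ℂ} (hz : z ∈ Ω) (hw : w ∈ Ω) (hz0 : 0 ≤ z.im) (hw0 : w.im ≤ 0)
    {ε : ℝ} (hε : 0 < ε) :
    ∃ p ∈ Ω ∩ realLine, qhDist Ω z p + qhDist Ω p w ≤ qhDist Ω z w + ε := by
  obtain ⟨γ, h1, h2, h3, h4⟩ := h.isProperDomain.exists_curve hz hw hε
  have hc : ContinuousOn (fun t => (γ t).im) (Icc 0 1) :=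
    (Complex.continuous_im.comp h1.1.continuous).continuousOn
  obtain ⟨T, hT, hT0⟩ := intermediate_value_Icc' zero_le_one hc
    (show (0:ℝ) ∈ _ from ⟨by rwa [h3], by rwa [h2]⟩)
  have := h.isProperDomain.qhDist_add_qhDist_le h1 hT.1 hT.2
  rw [h2, h3] at this
  exact ⟨γ T, ⟨h1.2 T, hT0⟩, this.trans h4.le⟩

lemma qhDist_fold_le {z w : ℂ} (hz : z ∈ Ω) (hw : w ∈ Ω) :
    qhDist Ω (fold z) (fold w) ≤ qhDist Ω z w := by
  have hd := h.isProperDomain.isDistOn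
  have key : ∀ z ∈ Ω, ∀ w ∈ Ω, 0 ≤ z.im → w.im ≤ 0 →
      qhDist Ω (fold z) (fold w) ≤ qhDist Ω z w := by
    intro z hz w hw h0 h1
    refine le_of_forall_pos_le_add fun ε hε => ?_
    obtain ⟨p, ⟨hp, hp0⟩, hpe⟩ := h.exists_real_between hz hw h0 h1 hε
    rw [fold_of_nonneg h0, fold_of_nonpos h1]
    refine (hd.triangle _ hz _ hp _ (h.conj_mem hw)).trans ?_
    have := h.qhDist_conj hp hw
    rw [Complex.conj_eq_iff_im.2 hp0] at this
    linarith
  rcases le_total 0 z.im with h0 | h0 <;> rcases le_total 0 w.im with h1 | h1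
  · rw [fold_of_nonneg h0, fold_of_nonneg h1]
  · exact key z hz w hw h0 h1
  · rw [hd.comm _ (h.fold_mem hz).1 _ (h.fold_mem hw).1, hd.comm z hz w hw]
    exact key w hw z hz h1 h0
  · rw [fold_of_nonpos h0, fold_of_nonpos h1, h.qhDist_conj hz hw]

lemma abs_im_le_infDist (z : ℂ) : |z.im| ≤ infDist z Ωᶜ := by
  refine (le_infDist h.isProperDomain.compl_nonempty).2 fun e he => ?_
  have := Complex.abs_im_le_norm (z - e)
  rwa [Complex.sub_im, h.im_eq_zero he, sub_zero, ← dist_eq_norm] at this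

lemma infDist_le_infDist_add_mul_I {z : ℂ} (hz : 0 ≤ z.im) {t : ℝ} (ht : 0 ≤ t) :
    infDist z Ωᶜ ≤ infDist (z + t * I) Ωᶜ := by
  refine (le_infDist h.isProperDomain.compl_nonempty).2 fun e he => ?_
  refine (infDist_le_dist_of_mem he).trans ?_
  have he0 := h.im_eq_zero he
  rw [Complex.dist_eq_re_im, Complex.dist_eq_re_im]
  refine Real.sqrt_le_sqrt ?_
  have h1 : (z + t * I).re = z.re := by simp
  have h2 : (z + t * I).im = z.im + t := by simp
  rw [h1, h2, he0]
  nlinarith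

lemma qhDist_vertical_le_one {z : ℂ} (hz : z ∈ upper Ω) {r : ℝ} (hr : 0 ≤ r)
    (hrz : r ≤ infDist z Ωᶜ) : qhDist Ω z (z + r * I) ≤ 1 := by
  have hδ := h.isProperDomain.infDist_pos hz.1
  refine (h.isProperDomain.qhDist_le_of_segment hδ fun t ht => ?_).trans ?_
  · have := h.infDist_le_infDist_add_mul_I hz.2 (mul_nonneg ht.1 hr)
    have e : z + t • (z + r * I - z) = z + ((t * r : ℝ) : ℂ) * I := by
      rw [Complex.real_smul]
      push_cast
      ring
    rwa [e]
  · rw [div_le_one hδ]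
    simpa [abs_of_nonneg hr] using hrz

lemma qhDist_vertical_le_log {z : ℂ} (hz : 0 ≤ z.im) {s r : ℝ} (hs : 0 < s) (hsr : s ≤ r) :
    qhDist Ω (z + s * I) (z + r * I) ≤ Real.log (r / s) := by
  have hr : 0 < r := hs.trans_le hsr
  set M := Real.log (r / s) with hM
  have hM0 : 0 ≤ M := Real.log_nonneg ((one_le_div hs).2 hsr)
  set γ : ℝ → ℂ := fun t => z + ((s * Real.exp (t * M) : ℝ) : ℂ) * I with hγ
  have hd : ∀ t, HasDerivAt γ (((s * (Real.exp (t * M) * M) : ℝ) : ℂ) * I) t := fun t => by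
    have h1 : HasDerivAt (fun t : ℝ => s * Real.exp (t * M)) (s * (Real.exp (t * M) * M)) t :=
      ((hasDerivAt_mul_const M).exp).const_mul s
    exact (h1.ofReal_comp.mul_const I).const_add z
  have him : ∀ t, s * Real.exp (t * M) ≤ infDist (γ t) Ωᶜ := fun t => by
    have hp : 0 < s * Real.exp (t * M) := by positivity
    refine le_trans ?_ (h.abs_im_le_infDist (γ t))
    refine le_trans ?_ (le_abs_self _)
    simp [hγ, -Complex.ofReal_mul, -Complex.ofReal_exp]
    exact hz
  have hcd : ContDiff ℝ 1 γ := by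
    have : ContDiff ℝ 1 (fun t : ℝ => s * Real.exp (t * M)) := by fun_prop
    exact contDiff_const.add ((Complex.ofRealCLM.contDiff.comp this).mul contDiff_const)
  have := IsProperDomain.qhDist_le_of_norm_deriv_le (γ := γ) (M := M) hcd
    (fun t _ => IsProperDomain.mem_of_infDist_pos
      (lt_of_lt_of_le (by positivity) (him t))) (fun t _ => by
      rw [(hd t).deriv, norm_mul, Complex.norm_real, Complex.norm_I, mul_one,
        Real.norm_of_nonneg (by positivity)]
      nlinarith [him t]) h.isProperDomain
  convert this using 2
  · simp [hγ]
  · have : s * (r / s) = r := by field_simp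
    simp only [hγ, one_mul, hM]
    rw [Real.exp_log (by positivity), this]

lemma qhDist_vertical_le {z : ℂ} (hz : z ∈ upper Ω) {r : ℝ} (hr : 0 ≤ r) :
    qhDist Ω z (z + r * I) ≤ 1 + Real.log (1 + r / infDist z Ωᶜ) := by
  have hδ := h.isProperDomain.infDist_pos hz.1
  have hmem : ∀ t : ℝ, 0 ≤ t → z + t * I ∈ Ω := fun t ht =>
    IsProperDomain.mem_of_infDist_pos (hδ.trans_le (h.infDist_le_infDist_add_mul_I hz.2 ht))
  rcases le_total r (infDist z Ωᶜ) with h1 | h1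
  · refine (h.qhDist_vertical_le_one hz hr h1).trans ?_
    have := Real.log_nonneg (x := 1 + r / infDist z Ωᶜ) (by
      have : 0 ≤ r / infDist z Ωᶜ := by positivity
      linarith)
    linarith
  · refine (h.isProperDomain.isDistOn.triangle z hz.1 _ (hmem _ hδ.le) _ (hmem r hr)).trans ?_
    refine add_le_add (h.qhDist_vertical_le_one hz hδ.le le_rfl) ?_
    refine (h.qhDist_vertical_le_log hz.2 hδ h1).trans (Real.log_le_log ?_ ?_)
    · exact div_pos (hδ.trans_le h1) hδ
    · linarith

lemma qhDist_horizontal_le {z w : ℂ} (hz : 0 ≤ z.im) (hw : 0 ≤ w.im) (hne : z ≠ w) :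
    qhDist Ω (z + (‖z - w‖ : ℝ) * I) (w + (‖z - w‖ : ℝ) * I) ≤ 1 := by
  have hr : 0 < ‖z - w‖ := norm_pos_iff.2 (sub_ne_zero.2 hne)
  refine (h.isProperDomain.qhDist_le_of_segment hr fun t ht => ?_).trans (le_of_eq ?_)
  · refine le_trans ?_ (h.abs_im_le_infDist _)
    refine le_trans ?_ (le_abs_self _)
    simp
    nlinarith [ht.1, ht.2]
  · rw [add_sub_add_right_eq_sub, norm_sub_rev w z, div_self hr.ne']

lemma qhDist_le_log_add_log {z w : ℂ} (hz : z ∈ upper Ω) (hw : w ∈ upper Ω) :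
    qhDist Ω z w ≤ 3 + Real.log (1 + ‖z - w‖ / infDist z Ωᶜ) +
      Real.log (1 + ‖z - w‖ / infDist w Ωᶜ) := by
  have hd := h.isProperDomain.isDistOn
  by_cases hne : z = w
  · subst hne
    rw [hd.self z hz.1]
    simp
  have hmem : ∀ z ∈ upper Ω, z + (‖z - w‖ : ℝ) * I ∈ Ω := fun z hz =>
    IsProperDomain.mem_of_infDist_pos ((h.isProperDomain.infDist_pos hz.1).trans_le
      (h.infDist_le_infDist_add_mul_I hz.2 (norm_nonneg _)))
  have hmem' : w + (‖z - w‖ : ℝ) * I ∈ Ω :=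
    IsProperDomain.mem_of_infDist_pos ((h.isProperDomain.infDist_pos hw.1).trans_le
      (h.infDist_le_infDist_add_mul_I hw.2 (norm_nonneg _)))
  have t1 := hd.triangle z hz.1 _ (hmem z hz) w hw.1
  have t2 := hd.triangle _ (hmem z hz) _ hmem' w hw.1
  rw [hd.comm _ hmem' w hw.1] at t2
  have e1 := h.qhDist_vertical_le hz (norm_nonneg (z - w))
  have e2 := h.qhDist_vertical_le hw (norm_nonneg (z - w))
  have e3 := h.qhDist_horizontal_le hz.2 hw.2 hne
  linarith

end IsRealSlit

/-- The sum of the boundary distances of two points and of their mutual distance. -/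
def spread (Ω : Set ℂ) (z w : ℂ) : ℝ := infDist z Ωᶜ + infDist w Ωᶜ + ‖z - w‖

lemma spread_comm (Ω : Set ℂ) (z w : ℂ) : spread Ω z w = spread Ω w z := by
  rw [spread, spread, norm_sub_rev]; ring

lemma spread_triangle (Ω : Set ℂ) (x y z : ℂ) : spread Ω x z ≤ spread Ω x y + spread Ω y z := by
  have := norm_sub_le_norm_sub_add_norm_sub x y z
  have : 0 ≤ infDist y Ωᶜ := infDist_nonneg
  simp only [spread]
  linarith

namespace IsRealSlit

variable {Ω : Set ℂ} (h : IsRealSlit Ω)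
include h

lemma spread_pos {z w : ℂ} (hz : z ∈ Ω) : 0 < spread Ω z w := by
  have := h.isProperDomain.infDist_pos hz
  have : 0 ≤ infDist w Ωᶜ := infDist_nonneg
  unfold spread
  positivity

lemma le_qhDist {z w : ℂ} (hz : z ∈ Ω) (hw : w ∈ Ω) :
    2 * Real.log (spread Ω z w) - Real.log (infDist z Ωᶜ) - Real.log (infDist w Ωᶜ) - 3 ≤
      qhDist Ω z w := by
  refine le_trans ?_ (h.isProperDomain.log_add_log_le_qhDist hz hw)
  have hδz := h.isProperDomain.infDist_pos hz
  have hδw := h.isProperDomain.infDist_pos hw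
  have hq := h.spread_pos (w := w) hz
  have h1 := infDist_le_infDist_add_dist (s := Ωᶜ) (x := z) (y := w)
  have h2 := infDist_le_infDist_add_dist (s := Ωᶜ) (x := w) (y := z)
  rw [dist_comm] at h2
  rw [dist_eq_norm] at h1 h2
  have key : ∀ δ > 0, spread Ω z w ≤ 2 * (2 * δ + ‖z - w‖) →
      Real.log (spread Ω z w) - Real.log δ - 2 * Real.log 2 ≤
        Real.log (1 + ‖z - w‖ / (2 * δ)) := by
    intro δ hδ hle
    have : 2 * Real.log 2 = Real.log 4 := by
      rw [show (4:ℝ) = 2 ^ 2 by norm_num, Real.log_pow]; norm_num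
    rw [this, ← Real.log_div hq.ne' hδ.ne', ← Real.log_div (by positivity) (by norm_num)]
    apply Real.log_le_log (by positivity)
    rw [div_div, one_add_div (by positivity), div_le_div_iff₀ (by positivity) (by positivity)]
    nlinarith
  have k1 := key _ hδz (by unfold spread; linarith [norm_nonneg (z - w)])
  have k2 := key _ hδw (by unfold spread; linarith [norm_nonneg (z - w)])
  have := Real.log_two_lt_d9
  linarith

lemma qhDist_le {z w : ℂ} (hz : z ∈ upper Ω) (hw : w ∈ upper Ω) :
    qhDist Ω z w ≤
      2 * Real.log (spread Ω z w) - Real.log (infDist z Ωᶜ) - Real.log (infDist w Ωᶜ) + 3 := by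
  refine (h.qhDist_le_log_add_log hz hw).trans ?_
  have hδz := h.isProperDomain.infDist_pos hz.1
  have hδw := h.isProperDomain.infDist_pos hw.1
  have hq := h.spread_pos (w := w) hz.1
  have key : ∀ δ > 0, δ + ‖z - w‖ ≤ spread Ω z w →
      Real.log (1 + ‖z - w‖ / δ) ≤ Real.log (spread Ω z w) - Real.log δ := by
    intro δ hδ hle
    rw [← Real.log_div hq.ne' hδ.ne']
    apply Real.log_le_log (by positivity)
    rw [one_add_div hδ.ne']
    gcongr
  have k1 := key _ hδz (by unfold spread; linarith)
  have k2 := key _ hδw (by unfold spread; linarith)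
  linarith

lemma fourPoint : FourPoint (upper Ω) (qhDist Ω) 15 := by
  intro x hx y hy z hz w hw
  have hxz := h.qhDist_le hx hz
  have hyw := h.qhDist_le hy hw
  have hxy := h.le_qhDist hx.1 hy.1
  have hzw := h.le_qhDist hz.1 hw.1
  have hxw := h.le_qhDist hx.1 hw.1
  have hyz := h.le_qhDist hy.1 hz.1
  have pxz := h.spread_pos (w := z) hx.1
  have pyw := h.spread_pos (w := w) hy.1
  have pxy := h.spread_pos (w := y) hx.1
  have pzw := h.spread_pos (w := w) hz.1
  have pxw := h.spread_pos (w := w) hx.1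
  have pyz := h.spread_pos (w := z) hy.1
  have l2 := Real.log_two_lt_d9
  have logle : ∀ {a b : ℝ}, 0 < a → 0 < b → a ≤ 2 * b → Real.log a ≤ Real.log 2 + Real.log b := by
    intro a b ha hb hab
    rw [← Real.log_mul two_ne_zero hb.ne']
    exact Real.log_le_log ha hab
  have t1 := spread_triangle Ω x y z
  have t2 := spread_triangle Ω x w z
  have t3 := spread_triangle Ω y x w
  have t4 := spread_triangle Ω y z w
  rw [spread_comm Ω w z] at t2
  rw [spread_comm Ω y x] at t3
  have hmax : Real.log (spread Ω x z) + Real.log (spread Ω y w) ≤ 2 * Real.log 2 +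
      max (Real.log (spread Ω x y) + Real.log (spread Ω z w))
        (Real.log (spread Ω x w) + Real.log (spread Ω y z)) := by
    have m1 := le_max_left (Real.log (spread Ω x y) + Real.log (spread Ω z w))
        (Real.log (spread Ω x w) + Real.log (spread Ω y z))
    have m2 := le_max_right (Real.log (spread Ω x y) + Real.log (spread Ω z w))
        (Real.log (spread Ω x w) + Real.log (spread Ω y z))
    rcases le_total (spread Ω x y) (spread Ω y z) with c1 | c1 <;>
    rcases le_total (spread Ω x w) (spread Ω z w) with c2 | c2
    · rcases le_total (spread Ω x y) (spread Ω x w) with c3 | c3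
      · have a1 := logle pxz pyz (by linarith)
        have a2 := logle pyw pxw (by linarith)
        linarith
      · have a1 := logle pxz pzw (by linarith)
        have a2 := logle pyw pxy (by linarith)
        linarith
    · rcases le_total (spread Ω x y) (spread Ω x w) with c3 | c3
      · have a1 := logle pxz pyz (by linarith)
        have a2 := logle pyw pxw (by linarith)
        linarith
      · have a1 := logle pxz pxw (by linarith)
        have a2 := logle pyw pyz (by linarith)
        linarith
    · rcases le_total (spread Ω y z) (spread Ω x w) with c3 | c3
      · have a1 := logle pxz pxy (by linarith)
        have a2 := logle pyw pzw (by linarith)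
        linarith
      · have a1 := logle pxz pzw (by linarith)
        have a2 := logle pyw pxy (by linarith)
        linarith
    · rcases le_total (spread Ω y z) (spread Ω z w) with c3 | c3
      · have a1 := logle pxz pxy (by linarith)
        have a2 := logle pyw pzw (by linarith)
        linarith
      · have a1 := logle pxz pxw (by linarith)
        have a2 := logle pyw pyz (by linarith)
        linarith
  rcases max_cases (Real.log (spread Ω x y) + Real.log (spread Ω z w))
        (Real.log (spread Ω x w) + Real.log (spread Ω y z)) with ⟨hm, -⟩ | ⟨hm, -⟩ <;>
    rw [hm] at hmax
  · have := le_max_left (qhDist Ω x y + qhDist Ω z w) (qhDist Ω x w + qhDist Ω y z)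
    linarith
  · have := le_max_right (qhDist Ω x y + qhDist Ω z w) (qhDist Ω x w + qhDist Ω y z)
    linarith

/-- Real segments inside `Ω` are geodesic up to an additive constant. -/
lemma qhDist_add_qhDist_le_of_real {x y u : ℂ} (hx : x ∈ Ω) (hy : y ∈ Ω) (hx0 : x.im = 0)
    (hy0 : y.im = 0) (hu0 : u.im = 0) (hxy : ∀ t ∈ Icc x.re y.re, (t : ℂ) ∈ Ω)
    (hu : u.re ∈ Icc x.re y.re) :
    qhDist Ω x u + qhDist Ω u y ≤ qhDist Ω x y + 11 := by
  have huΩ : u ∈ Ω := by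
    have : (u.re : ℂ) = u := by apply Complex.ext <;> simp [hu0]
    exact this ▸ hxy _ hu
  have hnorm : ∀ a b : ℂ, a.im = 0 → b.im = 0 → ‖a - b‖ = |a.re - b.re| := by
    intro a b ha hb
    rw [← Complex.abs_re_eq_norm.2 (by simp [ha, hb])]
    simp
  have nxu : ‖x - u‖ = u.re - x.re := by
    rw [hnorm x u hx0 hu0, abs_of_nonpos] <;> linarith [hu.1]
  have nuy : ‖u - y‖ = y.re - u.re := by
    rw [hnorm u y hu0 hy0, abs_of_nonpos] <;> linarith [hu.2]
  have nxy : ‖x - y‖ = y.re - x.re := by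
    rw [hnorm x y hx0 hy0, abs_of_nonpos] <;> linarith [hu.2, hu.1]
  have hδx := h.isProperDomain.infDist_pos hx
  have hδy := h.isProperDomain.infDist_pos hy
  have hδu := h.isProperDomain.infDist_pos huΩ
  have h1 := infDist_le_infDist_add_dist (s := Ωᶜ) (x := u) (y := x)
  have h2 := infDist_le_infDist_add_dist (s := Ωᶜ) (x := u) (y := y)
  rw [dist_comm] at h1
  rw [dist_eq_norm] at h1 h2
  rw [nxu] at h1
  rw [nuy] at h2
  have hprod : spread Ω x u * spread Ω u y ≤ 2 * infDist u Ωᶜ * spread Ω x y := by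
    obtain ⟨e, he, hedist⟩ := h.isProperDomain.isOpen.isClosed_compl.exists_infDist_eq_dist
      h.isProperDomain.compl_nonempty u
    have he0 := h.im_eq_zero he
    have hex := infDist_le_dist_of_mem (x := x) he
    have hey := infDist_le_dist_of_mem (x := y) he
    rw [dist_eq_norm, hnorm _ _ ‹_› he0] at hedist hex hey
    have hnot : e.re ∉ Icc x.re y.re := fun hmem => he (by
      have : (e.re : ℂ) = e := by apply Complex.ext <;> simp [he0]
      exact this ▸ hxy _ hmem)
    have p1 := h.spread_pos (w := u) hx
    have p2 := h.spread_pos (w := y) huΩ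
    have p3 := h.spread_pos (w := y) hx
    rcases lt_or_ge e.re x.re with hlt | hge
    · rw [abs_of_pos (by linarith [hu.1])] at hedist hex
      have a1 : spread Ω x u ≤ 2 * infDist u Ωᶜ := by
        rw [spread, nxu]; linarith
      have a2 : spread Ω u y ≤ spread Ω x y := by
        rw [spread, spread, nuy, nxy]; linarith
      exact mul_le_mul a1 a2 p2.le (by positivity)
    · have hgt : y.re < e.re := by
        by_contra hc
        exact hnot ⟨hge, not_lt.1 hc⟩
      rw [abs_of_neg (by linarith [hu.2])] at hedist hey
      have a1 : spread Ω u y ≤ 2 * infDist u Ωᶜ := by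
        rw [spread, nuy]; linarith
      have a2 : spread Ω x u ≤ spread Ω x y := by
        rw [spread, spread, nxu, nxy]; linarith
      rw [mul_comm]
      exact mul_le_mul a1 a2 p1.le (by positivity)
  have p1 := h.spread_pos (w := u) hx
  have p2 := h.spread_pos (w := y) huΩ
  have p3 := h.spread_pos (w := y) hx
  have hlog := Real.log_le_log (by positivity) hprod
  rw [Real.log_mul p1.ne' p2.ne', Real.log_mul (by positivity) p3.ne',
    Real.log_mul two_ne_zero hδu.ne'] at hlog
  have b1 := h.qhDist_le (z := x) (w := u) ⟨hx, hx0.ge⟩ ⟨huΩ, hu0.ge⟩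
  have b2 := h.qhDist_le (z := u) (w := y) ⟨huΩ, hu0.ge⟩ ⟨hy, hy0.ge⟩
  have b3 := h.le_qhDist hx hy
  have := Real.log_two_lt_d9
  linarith

lemma exists_real_near_of_segment {x y a : ℂ} (hx : x ∈ Ω) (hy : y ∈ Ω) (hx0 : x.im = 0)
    (hy0 : y.im = 0) (hle : x.re ≤ y.re) (hxy : ∀ t ∈ Icc x.re y.re, (t : ℂ) ∈ Ω)
    (ha : a ∈ upper Ω) (hxay : qhDist Ω x a + qhDist Ω a y = qhDist Ω x y) :
    ∃ p ∈ Ω ∩ realLine, qhDist Ω a p ≤ 26 := by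
  have hd := h.isProperDomain.isDistOn
  have hxe : ((x.re : ℝ) : ℂ) = x := by apply Complex.ext <;> simp [hx0]
  have hye : ((y.re : ℝ) : ℂ) = y := by apply Complex.ext <;> simp [hy0]
  have hcont : ContinuousOn (fun t : ℝ => qhDist Ω x t) (Icc x.re y.re) := by
    rw [continuousOn_iff_continuous_domRestrict]
    exact h.isProperDomain.continuous_qhDist.comp (f := fun t : Icc x.re y.re =>
      ((⟨x, hx⟩, ⟨(t : ℝ), hxy t t.2⟩) : Ω × Ω)) (by fun_prop)
  have hna := hd.nonneg x hx a ha.1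
  have hna' := hd.nonneg a ha.1 y hy
  obtain ⟨t, ht, hxt⟩ := intermediate_value_Icc hle hcont
    (show qhDist Ω x a ∈ _ by
      simp only [hxe, hye, hd.self x hx]
      exact ⟨hna, by linarith⟩)
  simp only at hxt
  have hseg := h.qhDist_add_qhDist_le_of_real hx hy hx0 hy0 (Complex.ofReal_im t) hxy
    (by simpa using ht)
  have h4 := h.fourPoint x ⟨hx, hx0.ge⟩ t ⟨hxy t ht, (Complex.ofReal_im t).ge⟩ y ⟨hy, hy0.ge⟩ a ha
  rw [hd.comm y hy a ha.1] at h4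
  refine ⟨t, ⟨hxy t ht, Complex.ofReal_im t⟩, ?_⟩
  rw [hd.comm _ ha.1 _ (hxy t ht)]
  rcases max_cases (qhDist Ω x t + qhDist Ω a y) (qhDist Ω x a + qhDist Ω t y)
    with ⟨hm, -⟩ | ⟨hm, -⟩ <;> rw [hm] at h4 <;> linarith

end IsRealSlit

section Segment

variable {α : Type*} {S : Set α} {d : α → α → ℝ}

/-- `A` is the trace of a geodesic of `(S, d)` from `x` to `y`. -/
def GeodSeg (S : Set α) (d : α → α → ℝ) (x y : α) (A : Set α) : Prop :=
  x ∈ S ∧ y ∈ S ∧ ∃ g : ℝ → α, IsGeodesicIn S d g x y ∧ g '' Icc 0 (d x y) = A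

namespace GeodSeg

variable {x y u v : α} {A : Set α} (hA : GeodSeg S d x y A)
include hA

lemma subset : A ⊆ S := by
  obtain ⟨-, -, g, hg, rfl⟩ := hA
  rintro _ ⟨t, ht, rfl⟩
  exact hg.2.2.1 t ht

lemma dist_eq (hu : u ∈ A) (hv : v ∈ A) : d u v = |d x u - d x v| := by
  obtain ⟨hx, hy, g, hg, rfl⟩ := hA
  obtain ⟨s, hs, rfl⟩ := hu
  obtain ⟨t, ht, rfl⟩ := hv
  have h0 : (0:ℝ) ∈ Icc 0 (d x y) := ⟨le_rfl, hs.1.trans hs.2⟩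
  have e1 := hg.2.2.2 0 h0 s hs
  have e2 := hg.2.2.2 0 h0 t ht
  rw [hg.1, zero_sub, abs_neg, abs_of_nonneg hs.1] at e1
  rw [hg.1, zero_sub, abs_neg, abs_of_nonneg ht.1] at e2
  rw [e1, e2, hg.2.2.2 s hs t ht]

lemma dist_left_le (hu : u ∈ A) : d x u ≤ d x y := by
  obtain ⟨hx, hy, g, hg, rfl⟩ := hA
  obtain ⟨s, hs, rfl⟩ := hu
  have e1 := hg.2.2.2 0 ⟨le_rfl, hs.1.trans hs.2⟩ s hs
  rw [hg.1, zero_sub, abs_neg, abs_of_nonneg hs.1] at e1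
  exact e1.trans_le hs.2

lemma exists_dist_eq {t : ℝ} (h0 : 0 ≤ t) (h1 : t ≤ d x y) : ∃ u ∈ A, d x u = t := by
  obtain ⟨hx, hy, g, hg, rfl⟩ := hA
  refine ⟨g t, ⟨t, ⟨h0, h1⟩, rfl⟩, ?_⟩
  have e1 := hg.2.2.2 0 ⟨le_rfl, h0.trans h1⟩ t ⟨h0, h1⟩
  rwa [hg.1, zero_sub, abs_neg, abs_of_nonneg h0] at e1

lemma left_part (hu : u ∈ A) : GeodSeg S d x u {w ∈ A | d x w ≤ d x u} := by
  have hle := hA.dist_left_le hu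
  have huS := hA.subset hu
  obtain ⟨hx, hy, g, hg, rfl⟩ := hA
  have hdist : ∀ t ∈ Icc (0:ℝ) (d x y), d x (g t) = t := fun t ht => by
    have e1 := hg.2.2.2 0 ⟨le_rfl, ht.1.trans ht.2⟩ t ht
    rwa [hg.1, zero_sub, abs_neg, abs_of_nonneg ht.1] at e1
  have hsub : Icc (0:ℝ) (d x u) ⊆ Icc 0 (d x y) := Icc_subset_Icc_right hle
  refine ⟨hx, huS, g, ⟨hg.1, ?_, fun t ht => hg.2.2.1 t (hsub ht),
    fun s hs t ht => hg.2.2.2 s (hsub hs) t (hsub ht)⟩, ?_⟩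
  · obtain ⟨s, hs, rfl⟩ := hu
    rw [hdist s hs]
  · ext w
    constructor
    · rintro ⟨t, ht, rfl⟩
      exact ⟨⟨t, hsub ht, rfl⟩, by rw [hdist t (hsub ht)]; exact ht.2⟩
    · rintro ⟨⟨t, ht, rfl⟩, hle'⟩
      rw [hdist t ht] at hle'
      exact ⟨t, ⟨ht.1, hle'⟩, rfl⟩

variable (hd : IsDistOn S d)
include hd

lemma left_mem : x ∈ A := by
  obtain ⟨hx, hy, g, hg, rfl⟩ := hA
  exact ⟨0, ⟨le_rfl, hd.nonneg x hx y hy⟩, hg.1⟩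

lemma right_mem : y ∈ A := by
  obtain ⟨hx, hy, g, hg, rfl⟩ := hA
  exact ⟨d x y, ⟨hd.nonneg x hx y hy, le_rfl⟩, hg.2.1⟩

lemma dist_add_dist (hu : u ∈ A) : d x u + d u y = d x y := by
  have h1 := hA.dist_eq hu (hA.right_mem hd)
  rw [abs_of_nonpos (by linarith [hA.dist_left_le hu])] at h1
  linarith

lemma map {φ : α → α} (hφS : ∀ a ∈ S, φ a ∈ S)
    (hφ : ∀ a ∈ S, ∀ b ∈ S, d (φ a) (φ b) ≤ d a b) (hxy : d (φ x) (φ y) = d x y) :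
    GeodSeg S d (φ x) (φ y) (φ '' A) := by
  obtain ⟨hx, hy, g, hg, rfl⟩ := hA
  refine ⟨hφS x hx, hφS y hy, φ ∘ g, ?_, by rw [hxy, image_comp]⟩
  refine hd.isGeodesicIn_of_le (hφS x hx) (hφS y hy) ?_ ?_ ?_ ?_
  · rw [Function.comp, hg.1]
  · rw [hxy, Function.comp, hg.2.1]
  · rw [hxy]
    exact fun t ht => hφS _ (hg.2.2.1 t ht)
  · rw [hxy]
    intro s hs t ht hst
    refine (hφ _ (hg.2.2.1 s hs) _ (hg.2.2.1 t ht)).trans ?_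
    rw [hg.2.2.2 s hs t ht, abs_sub_comm, abs_of_nonneg (sub_nonneg.2 hst)]

lemma symm : GeodSeg S d y x A := by
  have hA' := hA
  obtain ⟨hx, hy, g, hg, rfl⟩ := hA
  have hc := hd.comm x hx y hy
  refine ⟨hy, hx, fun t => g (d x y - t), ?_, ?_⟩
  · refine ⟨by simp [hg.2.1], by simp [← hc, hg.1], ?_, ?_⟩
    · intro t ht
      rw [← hc] at ht
      exact hg.2.2.1 _ ⟨by linarith [ht.2], by linarith [ht.1]⟩
    · intro s hs t ht
      rw [← hc] at hs ht
      rw [hg.2.2.2 _ ⟨by linarith [hs.2], by linarith [hs.1]⟩ _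
        ⟨by linarith [ht.2], by linarith [ht.1]⟩, abs_sub_comm]
      congr 1
      ring
  · rw [← hc]
    have : (fun t => g (d x y - t)) = g ∘ fun t => d x y - t := rfl
    rw [this, image_comp]
    congr 1
    simp

lemma right_part (hu : u ∈ A) : GeodSeg S d u y {w ∈ A | d x u ≤ d x w} := by
  have hs := hA.symm hd
  have h1 := (hs.left_part hu).symm hd
  convert h1 using 1
  ext w
  refine and_congr_right fun hw => ?_
  have e1 := hA.dist_add_dist hd hu
  have e2 := hA.dist_add_dist hd hw
  rw [hd.comm y hA.2.1 w (hA.subset hw), hd.comm y hA.2.1 u (hA.subset hu)]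
  constructor <;> intro <;> linarith

lemma middle_part (hu : u ∈ A) (hv : v ∈ A) (huv : d x u ≤ d x v) :
    GeodSeg S d u v {w ∈ A | d x u ≤ d x w ∧ d x w ≤ d x v} := by
  have h1 := (hA.right_part hd hu).left_part (u := v) ⟨hv, huv⟩
  convert h1 using 1
  ext w
  simp only [mem_ofPred_eq, and_assoc]
  refine and_congr_right fun hw => and_congr_right fun huw => ?_
  rw [hA.dist_eq hu hw, hA.dist_eq hu hv, abs_of_nonpos (by linarith), abs_of_nonpos (by linarith)]
  constructor <;> intro <;> linarith

end GeodSeg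

lemma GeodSeg.of_isGeodesicIn {g : ℝ → α} {x y : α} (hg : IsGeodesicIn S d g x y) (hx : x ∈ S)
    (hy : y ∈ S) : GeodSeg S d x y (g '' Icc 0 (d x y)) := ⟨hx, hy, g, hg, rfl⟩

lemma GeodSeg.singleton (hd : IsDistOn S d) {x : α} (hx : x ∈ S) : GeodSeg S d x x {x} := by
  refine ⟨hx, hx, fun _ => x, ⟨rfl, rfl, fun _ _ => hx, ?_⟩, ?_⟩
  · intro s hs t ht
    rw [hd.self x hx] at hs ht
    rw [hd.self x hx, le_antisymm hs.2 hs.1, le_antisymm ht.2 ht.1]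
    simp
  · rw [hd.self x hx]
    simp

/-- In a geodesic triangle with the four-point property a point of one side close to the vertex
`x` is near the other side through `x`. -/
lemma exists_near_of_le (hd : IsDistOn S d) {P A B : Set α} {D : ℝ} (hP : P ⊆ S)
    (h4 : FourPoint P d D) (hD : 0 ≤ D) {x y z u : α} (hA : GeodSeg S d x y A)
    (hB : GeodSeg S d x z B) (hAP : A ⊆ P) (hBP : B ⊆ P) (hu : u ∈ A)
    (hle : d x u + d z y ≤ d u y + d x z) : ∃ v ∈ B, d u v ≤ 2 * D := by
  have hx := hAP (hA.left_mem hd)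
  have hy := hAP (hA.right_mem hd)
  have hz := hBP (hB.right_mem hd)
  have huP := hAP hu
  have e1 := hA.dist_add_dist hd hu
  have htri := hd.triangle x (hP hx) z (hP hz) y (hP hy)
  have hxu := hd.nonneg x (hP hx) u (hP huP)
  obtain ⟨v, hv, hxv⟩ := hB.exists_dist_eq hxu (by linarith)
  have e2 := hB.dist_add_dist hd hv
  have hvP := hBP hv
  refine ⟨v, hv, ?_⟩
  have k1 := h4 u huP x hx z hz y hy
  have k2 := h4 u huP x hx v hvP z hz
  rw [hd.comm u (hP huP) x (hP hx)] at k1 k2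
  rw [max_eq_right hle] at k1
  have : max (d x u + d v z) (d u z + d x v) ≤ d x z + D := max_le (by linarith) (by linarith)
  linarith

lemma exists_near_of_fourPoint (hd : IsDistOn S d) {P A B C : Set α} {D : ℝ} (hP : P ⊆ S)
    (h4 : FourPoint P d D) (hD : 0 ≤ D) {x y z u : α} (hA : GeodSeg S d x y A)
    (hB : GeodSeg S d x z B) (hC : GeodSeg S d z y C) (hAP : A ⊆ P) (hBP : B ⊆ P) (hCP : C ⊆ P)
    (hu : u ∈ A) : ∃ v ∈ B ∪ C, d u v ≤ 2 * D := by
  rcases le_total (d x u + d z y) (d u y + d x z) with hle | hle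
  · obtain ⟨v, hv, h⟩ := exists_near_of_le hd hP h4 hD hA hB hAP hBP hu hle
    exact ⟨v, Or.inl hv, h⟩
  · have hy := hA.2.1
    have huS := hP (hAP hu)
    rw [hd.comm x hA.1 u huS, hd.comm u huS y hy, hd.comm x hA.1 z hC.1, hd.comm z hC.1 y hy]
      at hle
    obtain ⟨v, hv, h⟩ := exists_near_of_le hd hP h4 hD (hA.symm hd) (hC.symm hd) hAP hCP hu
      (by linarith)
    exact ⟨v, Or.inr hv, h⟩

/-- In triangles with vertices `x`, `y`, `z` the side `[x, y]` lies in the `r`-neighbourhood of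
the union of the two other sides. -/
def NearSides (S : Set α) (d : α → α → ℝ) (r : ℝ) (x y z : α) : Prop :=
  ∀ A B C : Set α, GeodSeg S d x y A → GeodSeg S d x z B → GeodSeg S d z y C →
    ∀ u ∈ A, ∃ v ∈ B ∪ C, d u v ≤ r

lemma NearSides.swap (hd : IsDistOn S d) {r : ℝ} {x y z : α} (h : NearSides S d r x y z) :
    NearSides S d r y x z := by
  intro A B C hA hB hC u hu
  rw [union_comm]
  exact h A C B (hA.symm hd) (hC.symm hd) (hB.symm hd) u hu

lemma NearSides.mono {r r' : ℝ} {x y z : α} (h : NearSides S d r x y z) (hr : r ≤ r') :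
    NearSides S d r' x y z := fun A B C hA hB hC u hu =>
  let ⟨v, hv, huv⟩ := h A B C hA hB hC u hu
  ⟨v, hv, huv.trans hr⟩

/-- Thinness of the side `[x, y]` of a triangle cut into three thin triangles. -/
lemma exists_near_of_cut (hd : IsDistOn S d) {A B C : Set α} {x y z p q : α} {t : ℝ}
    (hgeo : ∀ a ∈ S, ∀ b ∈ S, ∃ M, GeodSeg S d a b M)
    (hA : GeodSeg S d x y A) (hB : GeodSeg S d x z B) (hC : GeodSeg S d z y C)
    (hp : p ∈ B) (hq : q ∈ C) (h1 : NearSides S d t x y q) (h2 : NearSides S d t x q p)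
    (h3 : NearSides S d t p q z) : ∀ u ∈ A, ∃ v ∈ B ∪ C, d u v ≤ 3 * t := by
  intro u hu
  have hpS := hB.subset hp
  have hqS := hC.subset hq
  obtain ⟨M, hM⟩ := hgeo p hpS q hqS
  obtain ⟨M', hM'⟩ := hgeo x hA.1 q hqS
  have huS := hA.subset hu
  obtain ⟨v, hv, huv⟩ := h1 A M' _ hA hM' (hC.right_part hd hq) u hu
  have ht : 0 ≤ t := (hd.nonneg u huS v
    (hv.elim (hM'.subset ·) fun hv => hC.subset hv.1)).trans huv
  rcases hv with hv | hv
  · have hvS := hM'.subset hv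
    obtain ⟨w, hw, hvw⟩ := h2 M' _ M hM' (hB.left_part hp) hM v hv
    rcases hw with hw | hw
    · have := hd.triangle u huS v hvS w (hB.subset hw.1)
      exact ⟨w, Or.inl hw.1, by linarith⟩
    · have hwS := hM.subset hw
      obtain ⟨s, hs, hws⟩ := h3 M _ _ hM (hB.right_part hd hp) (hC.left_part hq) w hw
      have hsBC : s ∈ B ∪ C := hs.imp (fun hs => hs.1) fun hs => hs.1
      have hsS : s ∈ S := hsBC.elim (hB.subset ·) (hC.subset ·)
      have k1 := hd.triangle u huS v hvS s hsS
      have k2 := hd.triangle v hvS w hwS s hsS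
      exact ⟨s, hsBC, by linarith⟩
  · exact ⟨v, Or.inr hv.1, by linarith⟩

/-- Thinness of the side `[x, z]` of a triangle cut into three thin triangles. -/
lemma exists_near_of_cut' (hd : IsDistOn S d) {A B C : Set α} {x y z p q : α} {t : ℝ}
    (hgeo : ∀ a ∈ S, ∀ b ∈ S, ∃ M, GeodSeg S d a b M)
    (hA : GeodSeg S d x y A) (hB : GeodSeg S d x z B) (hC : GeodSeg S d z y C)
    (hp : p ∈ B) (hq : q ∈ C) (h1 : NearSides S d t x q y) (h2 : NearSides S d t p q x)
    (h3 : NearSides S d t p q z) (h4 : NearSides S d t x p q) (h5 : NearSides S d t p z q) :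
    ∀ u ∈ B, ∃ v ∈ A ∪ C, d u v ≤ 7 * t + 1 := by
  have hpS := hB.subset hp
  have hqS := hC.subset hq
  obtain ⟨M, hM⟩ := hgeo p hpS q hqS
  obtain ⟨M', hM'⟩ := hgeo x hA.1 q hqS
  have hACS : ∀ v ∈ A ∪ C, v ∈ S := fun v hv => hv.elim (hA.subset ·) (hC.subset ·)
  have hB1 := hB.left_part hp
  have hB2 := hB.right_part hd hp
  have hC1 := hC.left_part hq
  have hC2 := hC.right_part hd hq
  have step1 : ∀ m ∈ M', ∃ v ∈ A ∪ C, d m v ≤ t := fun m hm =>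
    let ⟨v, hv, hmv⟩ := h1 M' A _ hM' hA (hC2.symm hd) m hm
    ⟨v, hv.imp id fun hv => hv.1, hmv⟩
  have ht : 0 ≤ t := by
    obtain ⟨v, hv, hxv⟩ := step1 x (hM'.left_mem hd)
    exact (hd.nonneg x hA.1 v (hACS v hv)).trans hxv
  have step2 : ∀ m ∈ M, (∃ b ∈ B, d x b ≤ d x p ∧ d m b ≤ t) ∨ ∃ v ∈ A ∪ C, d m v ≤ 2 * t := by
    intro m hm
    obtain ⟨v, hv | hv, hmv⟩ := h2 M _ M' hM (hB1.symm hd) hM' m hm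
    · exact Or.inl ⟨v, hv.1, hv.2, hmv⟩
    · obtain ⟨w, hw, hvw⟩ := step1 v hv
      have := hd.triangle m (hM.subset hm) v (hM'.subset hv) w (hACS w hw)
      exact Or.inr ⟨w, hw, by linarith⟩
  have step3 : ∀ m ∈ M, (∃ b ∈ B, d x p ≤ d x b ∧ d m b ≤ t) ∨ ∃ v ∈ A ∪ C, d m v ≤ 2 * t := by
    intro m hm
    obtain ⟨v, hv | hv, hmv⟩ := h3 M _ _ hM hB2 hC1 m hm
    · exact Or.inl ⟨v, hv.1, hv.2, hmv⟩
    · exact Or.inr ⟨v, Or.inr hv.1, by linarith⟩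
  have cross : ∀ a ∈ B, ∀ b ∈ B, ∀ m ∈ M, d x a ≤ d x p → d x p ≤ d x b → d m a ≤ t →
      d m b ≤ t → d a p ≤ 2 * t ∧ d b p ≤ 2 * t := by
    intro a ha b hb m hm hap hpb hma hmb
    have haS := hB.subset ha
    have hmS := hM.subset hm
    have k := hd.triangle a haS m hmS b (hB.subset hb)
    rw [hd.comm a haS m hmS, hB.dist_eq ha hb, abs_of_nonpos (by linarith)] at k
    rw [hB.dist_eq ha hp, hB.dist_eq hb hp, abs_of_nonpos (by linarith),
      abs_of_nonneg (by linarith)]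
    constructor <;> linarith
  have hpAC : ∃ v ∈ A ∪ C, d p v ≤ 5 * t + 1 := by
    rcases le_total (d p q) (3 * t + 1) with hle | hle
    · exact ⟨q, Or.inr hq, by linarith⟩
    · obtain ⟨m, hm, hpm⟩ := hM.exists_dist_eq (by linarith) hle
      have hmS := hM.subset hm
      have fin : (∃ v ∈ A ∪ C, d m v ≤ 2 * t) → ∃ v ∈ A ∪ C, d p v ≤ 5 * t + 1 := by
        rintro ⟨v, hv, hmv⟩
        have := hd.triangle p hpS m hmS v (hACS v hv)
        exact ⟨v, hv, by linarith⟩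
      rcases step2 m hm with ⟨a, ha, hap, hma⟩ | hm2
      · rcases step3 m hm with ⟨b, hb, hpb, hmb⟩ | hm3
        · have k := (cross a ha b hb m hm hap hpb hma hmb).1
          have haS := hB.subset ha
          have := hd.triangle p hpS a haS m hmS
          rw [hd.comm p hpS a haS, hd.comm a haS m hmS] at this
          linarith
        · exact fin hm3
      · exact fin hm2
  obtain ⟨r, hr, hpr⟩ := hpAC
  have hrS := hACS r hr
  intro u hu
  have huS := hB.subset hu
  have far : d u p ≤ 2 * t → ∃ v ∈ A ∪ C, d u v ≤ 7 * t + 1 := fun hup => by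
    have := hd.triangle u huS p hpS r hrS
    exact ⟨r, hr, by linarith⟩
  have close : ∀ m ∈ S, d u m ≤ t → (∃ v ∈ A ∪ C, d m v ≤ 2 * t) →
      ∃ v ∈ A ∪ C, d u v ≤ 7 * t + 1 := by
    rintro m hm hum ⟨v, hv, hmv⟩
    have := hd.triangle u huS m hm v (hACS v hv)
    exact ⟨v, hv, by linarith⟩
  rcases le_total (d x u) (d x p) with hup | hup
  · obtain ⟨m, hm, hum⟩ := h4 _ M' M hB1 hM' (hM.symm hd) u ⟨hu, hup⟩
    rcases hm with hm | hm
    · obtain ⟨v, hv, hmv⟩ := step1 m hm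
      exact close m (hM'.subset hm) hum ⟨v, hv, by linarith⟩
    · have hmS := hM.subset hm
      rcases step3 m hm with ⟨b, hb, hpb, hmb⟩ | hm3
      · rw [hd.comm u huS m hmS] at hum
        exact far (cross u hu b hb m hm hup hpb hum hmb).1
      · exact close m hmS hum hm3
  · obtain ⟨m, hm, hum⟩ := h5 _ M _ hB2 hM (hC1.symm hd) u ⟨hu, hup⟩
    rcases hm with hm | hm
    · have hmS := hM.subset hm
      rcases step2 m hm with ⟨a, ha, hap, hma⟩ | hm2
      · rw [hd.comm u huS m hmS] at hum
        exact far (cross a ha u hu m hm hap hup hma hum).2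
      · exact close m hmS hum hm2
    · exact ⟨m, Or.inr hm.1, by linarith⟩

end Segment

/-- Every point of `A` is at quasihyperbolic distance at most `C` from a real point. -/
def NearReal (Ω : Set ℂ) (C : ℝ) (A : Set ℂ) : Prop :=
  ∀ u ∈ A, ∃ p ∈ Ω ∩ realLine, qhDist Ω u p ≤ C

lemma NearReal.mono {Ω A : Set ℂ} {C C' : ℝ} (h : NearReal Ω C A) (hC : C ≤ C') :
    NearReal Ω C' A := fun u hu =>
  let ⟨p, hp, hup⟩ := h u hu
  ⟨p, hp, hup.trans hC⟩

lemma mem_upper_of_real {Ω : Set ℂ} {p : ℂ} (hp : p ∈ Ω ∩ realLine) : p ∈ upper Ω :=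
  ⟨hp.1, le_of_eq hp.2.symm⟩

namespace IsRealSlit

variable {Ω : Set ℂ} (h : IsRealSlit Ω)
include h

lemma isDistOn : IsDistOn Ω (qhDist Ω) := h.isProperDomain.isDistOn

lemma exists_geodSeg {x : ℂ} (hx : x ∈ Ω) {y : ℂ} (hy : y ∈ Ω) :
    ∃ A, GeodSeg Ω (qhDist Ω) x y A :=
  let ⟨_, hg⟩ := h.isProperDomain.exists_isGeodesicIn hx hy
  ⟨_, GeodSeg.of_isGeodesicIn hg hx hy⟩

lemma geodSeg_conj {x y : ℂ} {A : Set ℂ} (hA : GeodSeg Ω (qhDist Ω) x y A) :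
    GeodSeg Ω (qhDist Ω) ((starRingEnd ℂ) x) ((starRingEnd ℂ) y) ((starRingEnd ℂ) '' A) :=
  hA.map h.isDistOn (fun _ ha => h.conj_mem ha) (fun _ ha _ hb => (h.qhDist_conj ha hb).le)
    (h.qhDist_conj hA.1 hA.2.1)

lemma geodSeg_fold {x y : ℂ} {A : Set ℂ} (hx : 0 ≤ x.im) (hy : 0 ≤ y.im)
    (hA : GeodSeg Ω (qhDist Ω) x y A) : GeodSeg Ω (qhDist Ω) x y (fold '' A) := by
  have := hA.map h.isDistOn (φ := fold) (fun _ ha => (h.fold_mem ha).1)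
    (fun _ ha _ hb => h.qhDist_fold_le ha hb) (by rw [fold_of_nonneg hx, fold_of_nonneg hy])
  rwa [fold_of_nonneg hx, fold_of_nonneg hy] at this

lemma fold_image_subset {A : Set ℂ} (hA : A ⊆ Ω) : fold '' A ⊆ upper Ω := by
  rintro _ ⟨a, ha, rfl⟩
  exact h.fold_mem (hA ha)

lemma exists_geodSeg_upper {x : ℂ} (hx : x ∈ upper Ω) {y : ℂ} (hy : y ∈ upper Ω) :
    ∃ A, GeodSeg Ω (qhDist Ω) x y A ∧ A ⊆ upper Ω :=
  let ⟨_, hA⟩ := h.exists_geodSeg hx.1 hy.1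
  ⟨_, h.geodSeg_fold hx.2 hy.2 hA, h.fold_image_subset hA.subset⟩

lemma qhDist_fold_real {u p : ℂ} (hu : u ∈ Ω) (hp : p ∈ Ω ∩ realLine) :
    qhDist Ω (fold u) p = qhDist Ω u p := by
  rcases le_total 0 u.im with h0 | h0
  · rw [fold_of_nonneg h0]
  · rw [fold_of_nonpos h0]
    have := h.qhDist_conj hu hp.1
    rwa [Complex.conj_eq_iff_im.2 hp.2] at this

lemma nearReal_of_triangle {x y z : ℂ} {A B B' : Set ℂ} {C : ℝ}
    (hA : GeodSeg Ω (qhDist Ω) x y A) (hB : GeodSeg Ω (qhDist Ω) x z B)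
    (hB' : GeodSeg Ω (qhDist Ω) z y B') (hAu : A ⊆ upper Ω) (hBu : B ⊆ upper Ω)
    (hBu' : B' ⊆ upper Ω) (hN : NearReal Ω C B) (hN' : NearReal Ω C B') :
    NearReal Ω (C + 30) A := by
  intro u hu
  obtain ⟨v, hv, huv⟩ := exists_near_of_fourPoint h.isDistOn (fun a ha => ha.1) h.fourPoint
    (by norm_num) hA hB hB' hAu hBu hBu' hu
  have hvΩ : v ∈ Ω := hv.elim (hB.subset ·) (hB'.subset ·)
  obtain ⟨p, hp, hvp⟩ : ∃ p ∈ Ω ∩ realLine, qhDist Ω v p ≤ C := hv.elim (hN v) (hN' v)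
  have := h.isDistOn.triangle u (hA.subset hu) v hvΩ p hp.1
  exact ⟨p, hp, by linarith⟩

/-- Two geodesics between real points are close to each other if all geodesics in the upper half
plane between these points stay close to the real axis. -/
lemma bigon_of_nearReal {x y : ℂ} (hx : x ∈ Ω ∩ realLine) (hy : y ∈ Ω ∩ realLine) {C : ℝ}
    (hN : ∀ A, GeodSeg Ω (qhDist Ω) x y A → A ⊆ upper Ω → NearReal Ω C A) {A B : Set ℂ}
    (hA : GeodSeg Ω (qhDist Ω) x y A) (hB : GeodSeg Ω (qhDist Ω) x y B) {u : ℂ} (hu : u ∈ A) :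
    ∃ v ∈ B, qhDist Ω u v ≤ 4 * C + 15 := by
  have hd := h.isDistOn
  have hxu := mem_upper_of_real hx
  have hyu := mem_upper_of_real hy
  have key : ∀ A, GeodSeg Ω (qhDist Ω) x y A → ∀ a ∈ A, qhDist Ω a (fold a) ≤ 2 * C := by
    intro A hA a ha
    have haΩ := hA.subset ha
    have hfΩ := (h.fold_mem haΩ).1
    obtain ⟨p, hp, hap⟩ := hN _ (h.geodSeg_fold hxu.2 hyu.2 hA) (h.fold_image_subset hA.subset)
      (fold a) ⟨a, ha, rfl⟩
    have k := hd.triangle a haΩ p hp.1 (fold a) hfΩ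
    rw [hd.comm p hp.1 _ hfΩ, ← h.qhDist_fold_real haΩ hp] at k
    linarith
  have hx' : ∀ a ∈ Ω, qhDist Ω x (fold a) = qhDist Ω x a := fun a ha => by
    rw [hd.comm x hx.1 _ (h.fold_mem ha).1, h.qhDist_fold_real ha hx, hd.comm a ha x hx.1]
  have huΩ := hA.subset hu
  obtain ⟨v, hv, hxv⟩ := hB.exists_dist_eq (hd.nonneg x hx.1 u huΩ) (hA.dist_left_le hu)
  have hvΩ := hB.subset hv
  have hfu := h.fold_mem huΩ
  have hfv := h.fold_mem hvΩ
  have k1 := hA.dist_add_dist hd hu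
  have k2 := hB.dist_add_dist hd hv
  have k3 := h.fourPoint _ hfu x hxu _ hfv y hyu
  rw [h.qhDist_fold_real huΩ hy, h.qhDist_fold_real hvΩ hy, hx' v hvΩ, hd.comm _ hfu.1 x hx.1,
    hx' u huΩ] at k3
  have k4 : max (qhDist Ω x u + qhDist Ω v y) (qhDist Ω u y + qhDist Ω x v) ≤ qhDist Ω x y :=
    max_le (by linarith) (by linarith)
  have k5 := key A hA u hu
  have k6 := key B hB v hv
  rw [hd.comm v hvΩ _ hfv.1] at k6
  have k7 := hd.triangle u huΩ _ hfu.1 v hvΩ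
  have k8 := hd.triangle _ hfu.1 _ hfv.1 v hvΩ
  exact ⟨v, hv, by linarith⟩

lemma exists_real_mem {x y : ℂ} {A : Set ℂ} (hA : GeodSeg Ω (qhDist Ω) x y A) (hx : 0 ≤ x.im)
    (hy : y.im ≤ 0) : ∃ p ∈ A, p ∈ Ω ∩ realLine := by
  obtain ⟨hxΩ, hyΩ, g, hg, rfl⟩ := hA
  have hL := h.isDistOn.nonneg x hxΩ y hyΩ
  have hcont : ContinuousOn g (Icc 0 (qhDist Ω x y)) := by
    intro s hs
    rw [ContinuousWithinAt, tendsto_iff_dist_tendsto_zero]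
    have hlim : Tendsto (fun t => infDist (g s) Ωᶜ * (Real.exp |s - t| - 1))
        (nhdsWithin s (Icc 0 (qhDist Ω x y))) (nhds 0) := by
      have : Continuous fun t => infDist (g s) Ωᶜ * (Real.exp |s - t| - 1) := by fun_prop
      have := (this.tendsto s).mono_left (nhdsWithin_le_nhds (s := Icc 0 (qhDist Ω x y)))
      simpa using this
    refine squeeze_zero' (Eventually.of_forall fun _ => dist_nonneg) ?_ hlim
    filter_upwards [self_mem_nhdsWithin] with t ht
    rw [dist_comm, dist_eq_norm]
    exact h.isProperDomain.norm_sub_le_of_qhDist_le (hg.2.2.1 s hs) (hg.2.2.1 t ht)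
      (hg.2.2.2 s hs t ht).le
  obtain ⟨T, hT, hT0⟩ := intermediate_value_Icc' hL
    (Complex.continuous_im.comp_continuousOn hcont)
    (show (0:ℝ) ∈ _ from ⟨by simpa [hg.2.1] using hy, by simpa [hg.1] using hx⟩)
  exact ⟨g T, ⟨T, hT, rfl⟩, hg.2.2.1 T hT, hT0⟩

lemma nearSides_of_conj {x y z : ℂ} {r : ℝ}
    (hN : NearSides Ω (qhDist Ω) r ((starRingEnd ℂ) x) ((starRingEnd ℂ) y) ((starRingEnd ℂ) z)) :
    NearSides Ω (qhDist Ω) r x y z := by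
  intro A B C hA hB hC u hu
  obtain ⟨w, hw, huw⟩ := hN _ _ _ (h.geodSeg_conj hA) (h.geodSeg_conj hB) (h.geodSeg_conj hC) _
    (mem_image_of_mem _ hu)
  rw [← image_union] at hw
  obtain ⟨v, hv, rfl⟩ := hw
  have hvΩ : v ∈ Ω := hv.elim (hB.subset ·) (hC.subset ·)
  exact ⟨v, hv, by rwa [h.qhDist_conj (hA.subset hu) hvΩ] at huw⟩

section Bigon

variable {c : ℝ} (hb : DenjoyCondBigon Ω (qhDist Ω) c)
include hb

lemma qhDist_conj_le_of_real {p q u : ℂ} {A : Set ℂ} (hp : p ∈ Ω ∩ realLine)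
    (hq : q ∈ Ω ∩ realLine) (hA : GeodSeg Ω (qhDist Ω) p q A) (hu : u ∈ A) :
    qhDist Ω u ((starRingEnd ℂ) u) ≤ 2 * c := by
  have hd := h.isDistOn
  have hpe := Complex.conj_eq_iff_im.2 hp.2
  have hB := h.geodSeg_conj hA
  rw [hpe, Complex.conj_eq_iff_im.2 hq.2] at hB
  have hB' := hB
  obtain ⟨g₁, hg₁, e₁⟩ := hA.2.2
  obtain ⟨g₂, hg₂, e₂⟩ := hB.2.2
  obtain ⟨v, hv, huv⟩ := hb p hp q hq g₁ g₂ hg₁ hg₂ u (by rwa [e₁])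
  rw [e₂] at hv
  have huΩ := hA.subset hu
  have hvΩ := hB'.subset hv
  have hcu : (starRingEnd ℂ) u ∈ (starRingEnd ℂ) '' A := ⟨u, hu, rfl⟩
  have k1 := hB'.dist_eq hv hcu
  have k2 : qhDist Ω p ((starRingEnd ℂ) u) = qhDist Ω p u := by
    have := h.qhDist_conj hp.1 huΩ
    rwa [hpe] at this
  have k3 := hd.triangle p hp.1 u huΩ v hvΩ
  have k4 := hd.triangle p hp.1 v hvΩ u huΩ
  rw [hd.comm v hvΩ u huΩ] at k4
  have k5 := hd.triangle u huΩ v hvΩ _ (h.conj_mem huΩ)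
  rw [k2] at k1
  have k6 : |qhDist Ω p v - qhDist Ω p u| ≤ c := abs_le.2 ⟨by linarith, by linarith⟩
  linarith

variable (hc : 0 ≤ c)
include hc

lemma qhDist_fold_self_le {x y u : ℂ} {A : Set ℂ} (hx : 0 ≤ x.im) (hy : 0 ≤ y.im)
    (hA : GeodSeg Ω (qhDist Ω) x y A) (hu : u ∈ A) : qhDist Ω u (fold u) ≤ 2 * c := by
  have hd := h.isDistOn
  rcases le_total 0 u.im with h0 | h0
  · rw [fold_of_nonneg h0, hd.self u (hA.subset hu)]
    positivity
  · rw [fold_of_nonpos h0]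
    obtain ⟨p, hp, hpr⟩ := h.exists_real_mem (hA.left_part hu) hx h0
    obtain ⟨q, hq, hqr⟩ := h.exists_real_mem ((hA.right_part hd hu).symm hd) hy h0
    exact h.qhDist_conj_le_of_real hb hpr hqr
      (hA.middle_part hd hp.1 hq.1 (hp.2.trans hq.2)) ⟨hu, hp.2, hq.2⟩

lemma nearSides_upper {x y z : ℂ} (hx : 0 ≤ x.im) (hy : 0 ≤ y.im) (hz : 0 ≤ z.im) :
    NearSides Ω (qhDist Ω) (4 * c + 30) x y z := by
  intro A B C hA hB hC u hu
  have hd := h.isDistOn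
  obtain ⟨w, hw, huw⟩ := exists_near_of_fourPoint hd (fun a ha => ha.1) h.fourPoint
    (by norm_num) (h.geodSeg_fold hx hy hA) (h.geodSeg_fold hx hz hB) (h.geodSeg_fold hz hy hC)
    (h.fold_image_subset hA.subset) (h.fold_image_subset hB.subset)
    (h.fold_image_subset hC.subset) (mem_image_of_mem fold hu)
  rw [← image_union] at hw
  obtain ⟨v, hv, rfl⟩ := hw
  have hvΩ : v ∈ Ω := hv.elim (hB.subset ·) (hC.subset ·)
  have huΩ := hA.subset hu
  have k1 := h.qhDist_fold_self_le hb hc hx hy hA hu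
  have k2 : qhDist Ω v (fold v) ≤ 2 * c := hv.elim (h.qhDist_fold_self_le hb hc hx hz hB ·)
    (h.qhDist_fold_self_le hb hc hz hy hC ·)
  have hfu := (h.fold_mem huΩ).1
  have hfv := (h.fold_mem hvΩ).1
  rw [hd.comm v hvΩ _ hfv] at k2
  have k3 := hd.triangle u huΩ _ hfu v hvΩ
  have k4 := hd.triangle _ hfu _ hfv v hvΩ
  exact ⟨v, hv, by linarith⟩

lemma nearSides_lower {x y z : ℂ} (hx : x.im ≤ 0) (hy : y.im ≤ 0) (hz : z.im ≤ 0) :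
    NearSides Ω (qhDist Ω) (4 * c + 30) x y z :=
  h.nearSides_of_conj (h.nearSides_upper hb hc (by simpa) (by simpa) (by simpa))

lemma nearSides_mixed {x y z : ℂ} (hx : 0 ≤ x.im) (hy : 0 ≤ y.im) (hz : z.im ≤ 0) :
    NearSides Ω (qhDist Ω) (7 * (4 * c + 30) + 1) x y z := by
  intro A B C hA hB hC u hu
  have hd := h.isDistOn
  obtain ⟨p, hp, hpr⟩ := h.exists_real_mem hB hx hz
  obtain ⟨q, hq, hqr⟩ := h.exists_real_mem (hC.symm hd) hy hz
  have hp0 : p.im = 0 := hpr.2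
  have hq0 : q.im = 0 := hqr.2
  obtain ⟨v, hv, huv⟩ := exists_near_of_cut hd (fun a ha b hb => h.exists_geodSeg ha hb) hA hB hC
    hp hq (h.nearSides_upper hb hc hx hy hq0.ge) (h.nearSides_upper hb hc hx hq0.ge hp0.ge)
    (h.nearSides_lower hb hc hp0.le hq0.le hz) u hu
  exact ⟨v, hv, by linarith⟩

lemma nearSides_mixed' {x y z : ℂ} (hx : 0 ≤ x.im) (hy : 0 ≤ y.im) (hz : z.im ≤ 0) :
    NearSides Ω (qhDist Ω) (7 * (4 * c + 30) + 1) x z y := by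
  intro B A C hB hA hC u hu
  have hd := h.isDistOn
  obtain ⟨p, hp, hpr⟩ := h.exists_real_mem hB hx hz
  obtain ⟨q, hq, hqr⟩ := h.exists_real_mem hC hy hz
  have hp0 : p.im = 0 := hpr.2
  have hq0 : q.im = 0 := hqr.2
  exact exists_near_of_cut' hd (fun a ha b hb => h.exists_geodSeg ha hb) hA hB (hC.symm hd)
    hp hq (h.nearSides_upper hb hc hx hq0.ge hy) (h.nearSides_upper hb hc hp0.ge hq0.ge hx)
    (h.nearSides_lower hb hc hp0.le hq0.le hz) (h.nearSides_upper hb hc hx hp0.ge hq0.ge)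
    (h.nearSides_lower hb hc hp0.le hz hq0.le) u hu

lemma nearSides_of_nonneg {x y z : ℂ} (hx : 0 ≤ x.im) :
    NearSides Ω (qhDist Ω) (7 * (4 * c + 30) + 1) x y z := by
  rcases le_total 0 y.im with hy | hy <;> rcases le_total 0 z.im with hz | hz
  · exact (h.nearSides_upper hb hc hx hy hz).mono (by linarith)
  · exact h.nearSides_mixed hb hc hx hy hz
  · exact h.nearSides_mixed' hb hc hx hz hy
  · exact h.nearSides_of_conj ((h.nearSides_mixed' hb hc (by simpa) (by simpa)
      (by simpa)).swap h.isDistOn)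

lemma nearSides_of_bigon (x y z : ℂ) : NearSides Ω (qhDist Ω) (7 * (4 * c + 30) + 1) x y z := by
  rcases le_total 0 x.im with hx | hx
  · exact h.nearSides_of_nonneg hb hc hx
  · exact h.nearSides_of_conj (h.nearSides_of_nonneg hb hc (by simpa))

lemma gromovHyperbolicWith_of_bigon :
    GromovHyperbolicWith Ω (qhDist Ω) (7 * (4 * c + 30) + 1) :=
  fun x hx y hy z hz _ _ _ hg₁ hg₂ hg₃ t ht => h.nearSides_of_bigon hb hc x y z _ _ _
    (.of_isGeodesicIn hg₁ hx hy) (.of_isGeodesicIn hg₂ hx hz) (.of_isGeodesicIn hg₃ hz hy) _ ⟨t, ht, rfl⟩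

end Bigon

end IsRealSlit

/-- A slit domain whose real points are the points of the intervals `I n`. -/
structure IsSlitAlong (Ω : Set ℂ) (I : ℕ → Set ℝ) : Prop where
  isRealSlit : IsRealSlit Ω
  nonempty : ∀ n, (I n).Nonempty
  ordConnected : ∀ n, (I n).OrdConnected
  ofReal_mem_iff : ∀ t : ℝ, (t : ℂ) ∈ Ω ↔ ∃ n, t ∈ I n

lemma subset_of_disjoint_frontier {X : Type*} [TopologicalSpace X] {U V : Set X}
    (hU : IsPreconnected U) (hV : IsOpen V) (hd : Disjoint U (frontier V))
    (hne : (U ∩ V).Nonempty) : U ⊆ V := by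
  intro u hu
  by_contra huV
  have hcl : u ∉ closure V := fun hcl =>
    disjoint_left.1 hd hu (by rw [hV.frontier_eq]; exact ⟨hcl, huV⟩)
  obtain ⟨w, -, hwV, hw⟩ := hU V (closure V)ᶜ hV isClosed_closure.isOpen_compl
    (fun w hw => by
      by_contra hcon
      simp only [mem_union, mem_compl_iff, not_or, not_not] at hcon
      exact disjoint_left.1 hd hw (by rw [hV.frontier_eq]; exact ⟨hcon.2, hcon.1⟩))
    hne ⟨u, hu, hcl⟩
  exact hw (subset_closure hwV)

lemma isSlitAlong_of_isDenjoyDomain {Ω : Set ℂ} {I : ℕ → Set ℝ} (hΩ : IsDenjoyDomain Ω)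
    (hI : ∀ n, (I n).Nonempty ∧ IsOpen (I n) ∧ (I n).OrdConnected)
    (hdisj : Pairwise (Function.onFun Disjoint I))
    (hpre : (fun x : ℝ => (x : ℂ)) ⁻¹' Ω = ⋃ n, I n) : IsSlitAlong Ω I := by
  have hmem : ∀ t : ℝ, (t : ℂ) ∈ Ω ↔ ∃ n, t ∈ I n := fun t => by
    have : t ∈ (fun x : ℝ => (x : ℂ)) ⁻¹' Ω ↔ t ∈ ⋃ n, I n := by rw [hpre]
    simpa using this
  obtain ⟨hopen, hconn, hfr⟩ := hΩ
  have hcompl : Ωᶜ.Nonempty := by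
    rw [nonempty_compl]
    rintro rfl
    have hclopen : IsClopen (I 0) := by
      refine ⟨⟨?_⟩, (hI 0).2.1⟩
      have : (I 0)ᶜ = ⋃ n ≠ 0, I n := by
        ext t
        simp only [mem_compl_iff, mem_iUnion, exists_prop]
        constructor
        · intro h0
          obtain ⟨n, hn⟩ := (hmem t).1 (mem_univ _)
          exact ⟨n, fun hn0 => h0 (hn0 ▸ hn), hn⟩
        · rintro ⟨n, hn0, hn⟩ h0
          exact disjoint_left.1 (hdisj hn0) hn h0
      rw [this]
      exact isOpen_iUnion fun n => isOpen_iUnion fun _ => (hI n).2.1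
    obtain ⟨t, ht⟩ := (hI 1).1
    exact disjoint_left.1 (hdisj (zero_ne_one : (0:ℕ) ≠ 1))
      (by rw [hclopen.eq_univ (hI 0).1]; exact mem_univ t) ht
  refine ⟨⟨⟨hopen, hconn.isPreconnected, hcompl⟩, ?_⟩, fun n => (hI n).1, fun n => (hI n).2.2, hmem⟩
  obtain ⟨a, ha⟩ := (hI 0).1
  obtain ⟨ε, hε, hball⟩ := Metric.isOpen_iff.1 hopen a ((hmem a).2 ⟨0, ha⟩)
  have hin : ∀ s : ℝ, |s| < ε → (a : ℂ) + s * Complex.I ∈ Ω := fun s hs =>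
    hball (by simpa [dist_eq_norm] using hs)
  have hfr' : ∀ U : Set ℂ, (∀ w ∈ U, w.im ≠ 0) → Disjoint U (frontier Ω) := fun U hU =>
    disjoint_left.2 fun w hw hw' => hU w hw (hfr hw')
  intro z hz
  rcases lt_or_gt_of_ne hz with h0 | h0
  · exact subset_of_disjoint_frontier (convex_halfSpace_im_lt 0).isPreconnected hopen
      (hfr' _ fun w hw => ne_of_lt hw)
      ⟨(a : ℂ) + ((-(ε / 2) : ℝ) : ℂ) * Complex.I, by simpa using hε,
        hin _ (by rw [abs_neg, abs_of_pos] <;> linarith)⟩ h0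
  · exact subset_of_disjoint_frontier (convex_halfSpace_im_gt 0).isPreconnected hopen
      (hfr' _ fun w hw => ne_of_gt hw)
      ⟨(a : ℂ) + ((ε / 2 : ℝ) : ℂ) * Complex.I, by simpa using hε,
        hin _ (by rw [abs_of_pos] <;> linarith)⟩ h0

namespace IsSlitAlong

variable {Ω : Set ℂ} {I : ℕ → Set ℝ} (h : IsSlitAlong Ω I)
include h

lemma exists_index {p : ℂ} (hp : p ∈ Ω ∩ realLine) : ∃ n, p.re ∈ I n := by
  rw [← h.ofReal_mem_iff]
  have : (p.re : ℂ) = p := Complex.ext (by simp) (by simpa using hp.2.symm)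
  exact this ▸ hp.1

lemma mem_of_re_mem {p : ℂ} (hp : p.im = 0) {n : ℕ} (hn : p.re ∈ I n) : p ∈ Ω ∩ realLine := by
  have : (p.re : ℂ) = p := Complex.ext (by simp) (by simpa using hp.symm)
  exact ⟨this ▸ (h.ofReal_mem_iff _).2 ⟨n, hn⟩, hp⟩

lemma bddBelow_qhDist {z : ℂ} (hz : z ∈ Ω) :
    BddBelow (qhDist Ω z '' (Ω ∩ realLine)) :=
  ⟨0, by
    rintro _ ⟨p, hp, rfl⟩
    exact h.isRealSlit.isDistOn.nonneg z hz p hp.1⟩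

lemma exists_real : ∃ p, p ∈ Ω ∩ realLine :=
  let ⟨t, ht⟩ := h.nonempty 0
  ⟨t, (h.ofReal_mem_iff t).2 ⟨0, ht⟩, Complex.ofReal_im t⟩

lemma condAllFund {δ : ℝ} (hδ : GromovHyperbolicWith Ω (qhDist Ω) δ) :
    DenjoyCondAllFund Ω (qhDist Ω) I δ := by
  rintro n - g x y ⟨hg, hx0, hxI, hy0, hyI, him⟩ _ ⟨t, ht, rfl⟩
  have hs := h.isRealSlit
  have hd := hs.isDistOn
  have hx := h.mem_of_re_mem hx0 hxI
  have hy := h.mem_of_re_mem hy0 hyI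
  have hgt := hg.2.2.1 t ht
  obtain ⟨-, -, g', hg', e'⟩ := hs.geodSeg_conj (.of_isGeodesicIn hg hx.1 hy.1)
  rw [Complex.conj_eq_iff_im.2 hx0, Complex.conj_eq_iff_im.2 hy0] at hg' e'
  obtain ⟨-, -, g₀, hg₀, e₀⟩ := GeodSeg.singleton hd hy.1
  obtain ⟨p, hp, hle⟩ := hδ x hx.1 y hy.1 y hy.1 g g' g₀ hg hg' hg₀ t ht
  rw [e', e₀] at hp
  have hp' : p ∈ Ω ∧ p.im ≤ 0 := by
    rcases hp with ⟨_, ⟨s, hs', rfl⟩, rfl⟩ | rfl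
    · exact ⟨hs.conj_mem (hg.2.2.1 s hs'), by simpa using him s hs'⟩
    · exact ⟨hy.1, hy0.le⟩
  refine le_of_forall_pos_le_add fun ε hε => ?_
  obtain ⟨r, hr, hsum⟩ := hs.exists_real_between hgt hp'.1 (him t ht) hp'.2 hε
  refine (csInf_le (h.bddBelow_qhDist hgt) ⟨r, hr, rfl⟩).trans ?_
  have := hd.nonneg r hr.1 p hp'.1
  linarith

lemma condSomeFund {c : ℝ} (hc : DenjoyCondAllFund Ω (qhDist Ω) I c) :
    DenjoyCondSomeFund Ω (qhDist Ω) I c := by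
  have hs := h.isRealSlit
  have key : ∀ n, ∃ (g : ℝ → ℂ) (x y : ℂ), IsFundGeodesic Ω (qhDist Ω) (I 0) (I n) g x y := by
    intro n
    obtain ⟨a, ha⟩ := h.nonempty 0
    obtain ⟨b, hb⟩ := h.nonempty n
    have hx := h.mem_of_re_mem (p := a) (Complex.ofReal_im a) (n := 0) (by simpa)
    have hy := h.mem_of_re_mem (p := b) (Complex.ofReal_im b) (n := n) (by simpa)
    obtain ⟨A, ⟨-, -, g, hg, rfl⟩, hAu⟩ :=
      hs.exists_geodSeg_upper (mem_upper_of_real hx) (mem_upper_of_real hy)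
    exact ⟨g, a, b, hg, Complex.ofReal_im a, by simpa, Complex.ofReal_im b, by simpa,
      fun t ht => (hAu ⟨t, ht, rfl⟩).2⟩
  choose g x y hg using key
  exact ⟨g, x, y, fun n _ => hg n, fun n hn => hc n hn _ _ _ (hg n)⟩

lemma nearReal_of_same_interval {x y : ℂ} {A : Set ℂ} {n : ℕ} (hx : x ∈ Ω ∩ realLine)
    (hy : y ∈ Ω ∩ realLine) (hxn : x.re ∈ I n) (hyn : y.re ∈ I n)
    (hA : GeodSeg Ω (qhDist Ω) x y A) (hAu : A ⊆ upper Ω) : NearReal Ω 26 A := by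
  have hs := h.isRealSlit
  have hd := hs.isDistOn
  intro u hu
  rcases le_total x.re y.re with hle | hle
  · exact hs.exists_real_near_of_segment hx.1 hy.1 hx.2 hy.2 hle
      (fun t ht => (h.ofReal_mem_iff t).2 ⟨n, (h.ordConnected n).out hxn hyn ht⟩) (hAu hu)
      (hA.dist_add_dist hd hu)
  · exact hs.exists_real_near_of_segment hy.1 hx.1 hy.2 hx.2 hle
      (fun t ht => (h.ofReal_mem_iff t).2 ⟨n, (h.ordConnected n).out hyn hxn ht⟩) (hAu hu)
      ((hA.symm hd).dist_add_dist hd hu)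

lemma condBigon {c : ℝ} (hc : DenjoyCondSomeFund Ω (qhDist Ω) I c) :
    DenjoyCondBigon Ω (qhDist Ω) (4 * (|c| + 117) + 15) := by
  have hs := h.isRealSlit
  have hd := hs.isDistOn
  obtain ⟨g, a, b, hg, hgc⟩ := hc
  have fund : ∀ n, ∃ (w v : ℂ) (B : Set ℂ), w ∈ Ω ∩ realLine ∧ w.re ∈ I 0 ∧ v ∈ Ω ∩ realLine ∧
      v.re ∈ I n ∧ GeodSeg Ω (qhDist Ω) w v B ∧ B ⊆ upper Ω ∧ NearReal Ω (|c| + 27) B := by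
    intro n
    rcases Nat.eq_zero_or_pos n with rfl | hn
    · obtain ⟨t, ht⟩ := h.nonempty 0
      have hp := h.mem_of_re_mem (p := t) (Complex.ofReal_im t) (n := 0) (by simpa)
      refine ⟨t, t, {(t : ℂ)}, hp, by simpa, hp, by simpa, .singleton hd hp.1, ?_, ?_⟩
      · rintro _ rfl
        exact mem_upper_of_real hp
      · rintro _ rfl
        refine ⟨t, hp, ?_⟩
        rw [hd.self _ hp.1]
        positivity
    · obtain ⟨hgeo, hx0, hxI, hy0, hyI, him⟩ := hg n hn
      have hx := h.mem_of_re_mem hx0 hxI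
      have hy := h.mem_of_re_mem hy0 hyI
      refine ⟨a n, b n, _, hx, hxI, hy, hyI, .of_isGeodesicIn hgeo hx.1 hy.1, ?_, ?_⟩
      · rintro _ ⟨t, ht, rfl⟩
        exact ⟨hgeo.2.2.1 t ht, him t ht⟩
      · intro u hu
        have hlt : distToSet (qhDist Ω) u (Ω ∩ realLine) < |c| + 27 :=
          (hgc n hn u hu).trans_lt (by linarith [le_abs_self c])
        obtain ⟨_, ⟨p, hp, rfl⟩, hlt'⟩ := exists_lt_of_csInf_lt
          (Nonempty.image _ (⟨a n, hx⟩ : (Ω ∩ realLine).Nonempty)) hlt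
        exact ⟨p, hp, hlt'.le⟩
  have toBase : ∀ x ∈ Ω ∩ realLine, ∀ w ∈ Ω ∩ realLine, w.re ∈ I 0 →
      ∀ A, GeodSeg Ω (qhDist Ω) x w A → A ⊆ upper Ω → NearReal Ω (|c| + 87) A := by
    intro x hx w hw hw0 A hA hAu
    obtain ⟨n, hn⟩ := h.exists_index hx
    obtain ⟨w', v, B, hw', hw'0, hv, hvn, hB, hBu, hBN⟩ := fund n
    obtain ⟨C, hC, hCu⟩ := hs.exists_geodSeg_upper (mem_upper_of_real hx) (mem_upper_of_real hv)
    obtain ⟨M, hM, hMu⟩ := hs.exists_geodSeg_upper (mem_upper_of_real hx) (mem_upper_of_real hw')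
    obtain ⟨L, hL, hLu⟩ := hs.exists_geodSeg_upper (mem_upper_of_real hw') (mem_upper_of_real hw)
    have hc0 := abs_nonneg c
    have hCN := (h.nearReal_of_same_interval hx hv hn hvn hC hCu).mono
      (show (26:ℝ) ≤ |c| + 27 by linarith)
    have hLN := (h.nearReal_of_same_interval hw' hw hw'0 hw0 hL hLu).mono
      (show (26:ℝ) ≤ |c| + 57 by linarith)
    have hMN := (hs.nearReal_of_triangle hM hC (hB.symm hd) hMu hCu hBu hCN hBN).mono
      (show |c| + 27 + 30 ≤ |c| + 57 by linarith)
    exact (hs.nearReal_of_triangle hA hM hL hAu hMu hLu hMN hLN).mono (by linarith)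
  obtain ⟨w, -, -, hw, hw0, -⟩ := fund 0
  intro x hx y hy g₁ g₂ hg₁ hg₂ u hu
  refine hs.bigon_of_nearReal hx hy (fun A hA hAu => ?_) (.of_isGeodesicIn hg₁ hx.1 hy.1)
    (.of_isGeodesicIn hg₂ hx.1 hy.1) hu
  obtain ⟨B, hB, hBu⟩ := hs.exists_geodSeg_upper (mem_upper_of_real hx) (mem_upper_of_real hw)
  obtain ⟨C, hC, hCu⟩ := hs.exists_geodSeg_upper (mem_upper_of_real hy) (mem_upper_of_real hw)
  exact (hs.nearReal_of_triangle hA hB (hC.symm hd) hAu hBu hCu (toBase x hx w hw hw0 B hB hBu)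
    (toBase y hy w hw hw0 C hC hCu)).mono (by linarith)

lemma gromovHyperbolicWith {c : ℝ} (hc : DenjoyCondBigon Ω (qhDist Ω) c) :
    GromovHyperbolicWith Ω (qhDist Ω) (7 * (4 * c + 30) + 1) := by
  have hs := h.isRealSlit
  have hd := hs.isDistOn
  obtain ⟨p, hp⟩ := h.exists_real
  obtain ⟨hpΩ, -, g, hg, hA⟩ := GeodSeg.singleton hd hp.1
  obtain ⟨w, hw, hle⟩ := hc p hp p hp g g hg hg p (by rw [hA]; rfl)
  rw [hA, mem_singleton_iff] at hw
  rw [hw, hd.self p hpΩ] at hle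
  exact hs.gromovHyperbolicWith_of_bigon hc hle

end IsSlitAlong

end Denjoy

/-- Theorem 3.3 for the quasihyperbolic metric: the four conditions are equivalent, with each
constant bounded in terms of any other (via the universal functions `F₁₂, F₂₃, F₃₄, F₄₁`). -/
theorem denjoy_qh_characterization :
    ∃ F12 F23 F34 F41 : ℝ → ℝ,
      ∀ (Ω : Set ℂ) (I : ℕ → Set ℝ),
        IsDenjoyDomain Ω →
        (∀ n, (I n).Nonempty ∧ IsOpen (I n) ∧ (I n).OrdConnected) →
        Pairwise (Function.onFun Disjoint I) →
        (fun x : ℝ => (x : ℂ)) ⁻¹' Ω = (⋃ n, I n) →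
        (∀ δ : ℝ, GromovHyperbolicWith Ω (qhDist Ω) δ →
          DenjoyCondAllFund Ω (qhDist Ω) I (F12 δ)) ∧
        (∀ c : ℝ, DenjoyCondAllFund Ω (qhDist Ω) I c →
          DenjoyCondSomeFund Ω (qhDist Ω) I (F23 c)) ∧
        (∀ c : ℝ, DenjoyCondSomeFund Ω (qhDist Ω) I c →
          DenjoyCondBigon Ω (qhDist Ω) (F34 c)) ∧
        (∀ c : ℝ, DenjoyCondBigon Ω (qhDist Ω) c →
          GromovHyperbolicWith Ω (qhDist Ω) (F41 c)) := by
  refine ⟨id, id, fun c => 4 * (|c| + 117) + 15, fun c => 7 * (4 * c + 30) + 1, ?_⟩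
  intro Ω I hΩ hI hdisj hpre
  have h := Denjoy.isSlitAlong_of_isDenjoyDomain hΩ hI hdisj hpre
  exact ⟨fun _ => h.condAllFund, fun _ => h.condSomeFund, fun _ => h.condBigon,
    fun _ => h.gromovHyperbolicWith⟩

end
end
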